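/- arXiv:2108.05201 — 3 statements merged into one kernel-verified Lean document; each statement's English description precedes it below -/
import Mathlib

section
/- Let H be a separable Hilbert space with Hilbert basis (v_k)_{k∈ℕ}, let 0 < λ_1 ≤ λ_2 ≤ ⋯ be a nondecreasing sequence of positive reals, let A be the operator Ah = Σ_k λ_k (h, v_k) v_k defined on {h ∈ H : Σ_k λ_k²|(h, v_k)|² < ∞}, and fix ρ ∈ (0,1), T > 0 and φ ∈ H. Then the series u(t) = Σ_{k=1}^∞ t^{ρ-1} E_{ρ,ρ}(-λ_k t^ρ)(φ, v_k) v_k converges in H for every t ∈ (0,T], the maps t ↦ Au(t) and t ↦ ∂_t^ρ u(t) are continuous from (0,T] to H, u satisfies ∂_t^ρ u(t) + Au(t) = 0 for all t ∈ (0,T], and ∂_t^{ρ-1} u(t) → φ in H as t → 0⁺. -/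
open MeasureTheory Filter
open scoped RealInnerProductSpace

/-- The two-parameter Mittag-Leffler function `E_{ρ,μ}(x) = Σ_{k=0}^∞ x^k / Γ(ρk + μ)`
(real argument). -/
noncomputable def mittagLeffler (ρ μ x : ℝ) : ℝ :=
  ∑' k : ℕ, x ^ k / Real.Gamma (ρ * k + μ)

/-- The Riemann–Liouville fractional integral of order `σ ∈ (0,1)` of a vector-valued
function `h`:  `∂_t^{-σ} h(t) = (1/Γ(σ)) ∫_0^t (t-ξ)^{σ-1} h(ξ) dξ` (Bochner integral). -/
noncomputable def rlIntegral {H : Type*} [NormedAddCommGroup H] [NormedSpace ℝ H]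
    (σ : ℝ) (h : ℝ → H) (t : ℝ) : H :=
  (1 / Real.Gamma σ) • (∫ ξ in (0 : ℝ)..t, ((t - ξ) ^ (σ - 1)) • h ξ)

/-- The Riemann–Liouville fractional derivative of order `ρ ∈ (0,1)`:
`∂_t^ρ h(t) = (d/dt)[∂_t^{-(1-ρ)} h](t)`. -/
noncomputable def rlDeriv {H : Type*} [NormedAddCommGroup H] [NormedSpace ℝ H]
    (ρ : ℝ) (h : ℝ → H) (t : ℝ) : H :=
  deriv (rlIntegral (1 - ρ) h) t

lemma beta_int_val {a σ t : ℝ} (ha : 0 < a) (hσ : 0 < σ) (ht : 0 < t) :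
    ∫ ξ in (0:ℝ)..t, (t - ξ) ^ (σ - 1) * ξ ^ (a - 1)
      = t ^ (a + σ - 1) * (Real.Gamma a * Real.Gamma σ / Real.Gamma (a + σ)) := by
  have h1 := Complex.betaIntegral_scaled (a : ℂ) (σ : ℂ) ht
  rw [Complex.betaIntegral_eq_Gamma_mul_div _ _ (by simpa) (by simpa)] at h1
  have h2 : ∫ x in (0:ℝ)..t, (x : ℂ) ^ ((a:ℂ) - 1) * ((t : ℂ) - x) ^ ((σ:ℂ) - 1)
      = ∫ x in (0:ℝ)..t, (((t - x) ^ (σ - 1) * x ^ (a - 1) : ℝ) : ℂ) := by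
    apply intervalIntegral.integral_congr
    intro x hx
    rw [Set.uIcc_of_le ht.le] at hx
    simp only
    rw [Complex.ofReal_mul, Complex.ofReal_cpow (by linarith [hx.2]),
      Complex.ofReal_cpow (by linarith [hx.1])]
    push_cast
    ring
  rw [h2, intervalIntegral.integral_ofReal] at h1
  have h3 : (t : ℂ) ^ ((a:ℂ) + σ - 1) = ((t ^ (a + σ - 1) : ℝ) : ℂ) := by
    rw [Complex.ofReal_cpow ht.le]; push_cast; rfl
  rw [h3, ← Complex.ofReal_add, Complex.Gamma_ofReal, Complex.Gamma_ofReal,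
    Complex.Gamma_ofReal] at h1
  exact_mod_cast h1

lemma beta_int_integrable {a σ t : ℝ} (ha : 0 < a) (hσ : 0 < σ) (ht : 0 < t) :
    IntervalIntegrable (fun ξ => (t - ξ) ^ (σ - 1) * ξ ^ (a - 1)) volume 0 t := by
  apply intervalIntegral.intervalIntegrable_of_integral_ne_zero
  rw [beta_int_val ha hσ ht]
  have := Real.Gamma_pos_of_pos ha
  have := Real.Gamma_pos_of_pos hσ
  have := Real.Gamma_pos_of_pos (add_pos ha hσ)
  positivity

lemma Gamma_lower {R s : ℝ} (hR : 0 < R) (hs : 1 ≤ s) :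
    R ^ (s - 1) * Real.exp (-R) ≤ Real.Gamma s := by
  rw [Real.Gamma_eq_integral (by linarith), ← integral_exp_neg_Ioi, ← integral_const_mul]
  have hint := Real.GammaIntegral_convergent (s := s) (by linarith)
  have hsub : Set.Ioi R ⊆ Set.Ioi 0 := Set.Ioi_subset_Ioi hR.le
  calc _ ≤ ∫ x in Set.Ioi R, Real.exp (-x) * x ^ (s - 1) := by
        apply setIntegral_mono_on
        · exact (integrableOn_exp_neg_Ioi R).const_mul _
        · exact hint.mono_set hsub
        · exact measurableSet_Ioi
        · intro x hx
          rw [mul_comm]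
          have : R ^ (s-1) ≤ x ^ (s-1) := Real.rpow_le_rpow hR.le (le_of_lt hx) (by linarith)
          gcongr
    _ ≤ _ := by
        apply setIntegral_mono_set hint
        · filter_upwards [ae_restrict_mem measurableSet_Ioi] with x hx
          have : (0:ℝ) < x := hx
          simp only [Pi.zero_apply]
          positivity
        · exact hsub.eventuallyLE

lemma summable_base {ρ μ : ℝ} (hρ : 0 < ρ) (hμ : 0 < μ) {y : ℝ} (hy : 0 ≤ y) :
    Summable (fun j : ℕ => y ^ j / Real.Gamma (ρ * j + μ)) := by
  set R : ℝ := (2 * y + 1) ^ (1 / ρ) with hRdef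
  have hR : 0 < R := by positivity
  have hRρ : R ^ ρ = 2 * y + 1 := by
    rw [hRdef, ← Real.rpow_mul (by positivity)]
    field_simp
    simp
  have hq : y / (2 * y + 1) < 1 := by
    rw [div_lt_one (by positivity)]; linarith
  have hs : Summable (fun j : ℕ => (R ^ (1 - μ) * Real.exp R) * (y / (2 * y + 1)) ^ j) :=
    (summable_geometric_of_lt_one (by positivity) hq).mul_left _
  refine Summable.of_norm_bounded_eventually_nat hs ?_
  have : Tendsto (fun j : ℕ => ρ * (j:ℝ) + μ) atTop atTop :=
    tendsto_atTop_add_const_right _ _ (tendsto_natCast_atTop_atTop.const_mul_atTop hρ)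
  filter_upwards [this.eventually_ge_atTop 1] with j hj
  have hG := Gamma_lower hR hj
  have hGp : 0 < Real.Gamma (ρ * j + μ) := Real.Gamma_pos_of_pos (by linarith)
  rw [Real.norm_of_nonneg (by positivity), div_le_iff₀ hGp]
  have e1 : R ^ (ρ * j + μ - 1) = (2 * y + 1) ^ j * (R ^ (1 - μ))⁻¹ := by
    rw [← Real.rpow_neg hR.le, ← hRρ, ← Real.rpow_natCast, ← Real.rpow_mul hR.le,
      ← Real.rpow_add hR]
    congr 1; ring
  rw [e1] at hG
  have hRm : 0 < R ^ (1 - μ) := by positivity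
  have h2 : (0:ℝ) < 2 * y + 1 := by positivity
  calc y ^ j = (R ^ (1 - μ) * Real.exp R) * (y / (2 * y + 1)) ^ j *
        ((2 * y + 1) ^ j * (R ^ (1 - μ))⁻¹ * Real.exp (-R)) := by
        rw [Real.exp_neg, div_pow]; field_simp
    _ ≤ _ := by gcongr

/-- geometric growth bound on coefficients -/
def GB (b : ℕ → ℝ) : Prop := ∃ C r : ℝ, 0 ≤ C ∧ 0 ≤ r ∧ ∀ j, |b j| ≤ C * r ^ j

noncomputable def pS (ρ : ℝ) (b : ℕ → ℝ) (μ x : ℝ) : ℝ :=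
  ∑' j : ℕ, b j * x ^ j / Real.Gamma (ρ * j + μ)

noncomputable def ptS (ρ : ℝ) (b : ℕ → ℝ) (μ t : ℝ) : ℝ := t ^ (μ - 1) * pS ρ b μ (t ^ ρ)

lemma Gpos {ρ μ : ℝ} (hρ : 0 < ρ) (hμ : 0 < μ) (j : ℕ) : 0 < Real.Gamma (ρ * j + μ) :=
  Real.Gamma_pos_of_pos (by positivity)

lemma summable_abs {ρ μ : ℝ} (hρ : 0 < ρ) (hμ : 0 < μ) {b : ℕ → ℝ} (hb : GB b) {x : ℝ}
    (hx : 0 ≤ x) : Summable (fun j : ℕ => |b j| * x ^ j / Real.Gamma (ρ * j + μ)) := by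
  obtain ⟨C, r, hC, hr, h⟩ := hb
  refine Summable.of_nonneg_of_le ?_ ?_ ((summable_base hρ hμ (mul_nonneg hr hx)).mul_left C)
  · intro j; have := Gpos hρ hμ j; positivity
  · intro j
    have := Gpos hρ hμ j
    rw [mul_pow, ← mul_div_assoc, ← mul_assoc]
    gcongr
    exact h j

lemma summable_pS {ρ μ : ℝ} (hρ : 0 < ρ) (hμ : 0 < μ) {b : ℕ → ℝ} (hb : GB b) (x : ℝ) :
    Summable (fun j : ℕ => b j * x ^ j / Real.Gamma (ρ * j + μ)) := by
  refine Summable.of_norm_bounded (summable_abs hρ hμ hb (abs_nonneg x)) ?_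
  intro j
  rw [norm_div, norm_mul, norm_pow, Real.norm_eq_abs, Real.norm_eq_abs,
    Real.norm_of_nonneg (Gpos hρ hμ j).le]

lemma continuous_pS {ρ μ : ℝ} (hρ : 0 < ρ) (hμ : 0 < μ) {b : ℕ → ℝ} (hb : GB b) :
    Continuous (pS ρ b μ) := by
  rw [continuous_iff_continuousAt]
  intro x
  have : ContinuousOn (pS ρ b μ) (Metric.ball 0 (|x| + 1)) := by
    refine continuousOn_tsum (fun j => by fun_prop)
      (summable_abs hρ hμ hb (x := |x| + 1) (by positivity)) ?_
    intro j y hy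
    rw [norm_div, norm_mul, norm_pow, Real.norm_eq_abs, Real.norm_eq_abs,
      Real.norm_of_nonneg (Gpos hρ hμ j).le]
    have := Gpos hρ hμ j
    have hy' : |y| ≤ |x| + 1 := by simpa using (le_of_lt (by simpa using hy) : |y| ≤ |x| + 1)
    gcongr
  exact this.continuousAt (Metric.isOpen_ball.mem_nhds (by simp))

lemma term_eq {ρ μ t : ℝ} (ht : 0 < t) (j : ℕ) :
    t ^ (ρ * j + μ - 1) = t ^ (μ - 1) * (t ^ ρ) ^ j := by
  rw [← Real.rpow_natCast, ← Real.rpow_mul ht.le, ← Real.rpow_add ht]; congr 1; ring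

lemma hasSum_ptS {ρ μ : ℝ} (hρ : 0 < ρ) (hμ : 0 < μ) {b : ℕ → ℝ} (hb : GB b) {t : ℝ}
    (ht : 0 < t) :
    HasSum (fun j : ℕ => b j * t ^ (ρ * j + μ - 1) / Real.Gamma (ρ * j + μ)) (ptS ρ b μ t) := by
  have := ((summable_pS hρ hμ hb (t ^ ρ)).hasSum.mul_left (t ^ (μ - 1)))
  unfold ptS pS
  convert! this using 2 with j
  rw [term_eq ht]; ring

lemma summable_abs_ptS {ρ μ : ℝ} (hρ : 0 < ρ) (hμ : 0 < μ) {b : ℕ → ℝ} (hb : GB b) {t : ℝ}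
    (ht : 0 < t) :
    Summable (fun j : ℕ => |b j| * t ^ (ρ * j + μ - 1) / Real.Gamma (ρ * j + μ)) := by
  have := ((summable_abs hρ hμ hb (x := t ^ ρ) (by positivity)).mul_left (t ^ (μ - 1)))
  convert! this using 2 with j
  rw [term_eq ht]; ring

lemma rl_ptS {ρ μ σ : ℝ} (hρ : 0 < ρ) (hμ : 0 < μ) (hσ : 0 < σ) {b : ℕ → ℝ} (hb : GB b) {t : ℝ}
    (ht : 0 < t) :
    ∫ ξ in (0:ℝ)..t, (t - ξ) ^ (σ - 1) * ptS ρ b μ ξ = Real.Gamma σ * ptS ρ b (μ + σ) t := by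
  have hterm : ∀ j : ℕ, ∀ c : ℝ, 
      ∫ ξ in Set.Ioc 0 t, c * ((t - ξ) ^ (σ - 1) * ξ ^ (ρ * j + μ - 1)) / Real.Gamma (ρ * j + μ)
       = Real.Gamma σ * (c * t ^ (ρ * j + (μ + σ) - 1) / Real.Gamma (ρ * j + (μ + σ))) := by
    intro j c
    have hp : 0 < ρ * j + μ := by positivity
    have := (Gpos hρ hμ j).ne'
    rw [integral_div, integral_const_mul, ← intervalIntegral.integral_of_le ht.le,
      beta_int_val hp hσ ht, add_assoc]
    field_simp
  have hint : ∀ j : ℕ, ∀ c : ℝ, IntegrableOn (fun ξ =>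
      c * ((t - ξ) ^ (σ - 1) * ξ ^ (ρ * j + μ - 1)) / Real.Gamma (ρ * j + μ)) (Set.Ioc 0 t) := by
    intro j c
    have hp : 0 < ρ * j + μ := by positivity
    have := (intervalIntegrable_iff_integrableOn_Ioc_of_le ht.le).1 (beta_int_integrable hp hσ ht)
    exact (this.const_mul c).div_const _
  have key := hasSum_integral_of_summable_integral_norm (μ := volume.restrict (Set.Ioc 0 t))
    (F := fun (j : ℕ) ξ => 
      b j * ((t - ξ) ^ (σ - 1) * ξ ^ (ρ * j + μ - 1)) / Real.Gamma (ρ * j + μ))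
    (fun j => hint j (b j)) (by
      have h1 := (summable_abs_ptS hρ (add_pos hμ hσ) hb ht).mul_left (Real.Gamma σ)
      convert! h1 using 2 with j
      rw [← hterm j |b j|]
      apply setIntegral_congr_fun measurableSet_Ioc
      intro ξ hξ
      have h0 : 0 < ξ := hξ.1
      have h2 : 0 ≤ t - ξ := by linarith [hξ.2]
      simp only
      rw [norm_div, norm_mul, Real.norm_eq_abs, Real.norm_of_nonneg (by positivity),
        Real.norm_of_nonneg (Gpos hρ hμ j).le])
  simp only [hterm] at key
  have k2 := (hasSum_ptS hρ (add_pos hμ hσ) hb ht).mul_left (Real.Gamma σ)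
  rw [← key.unique k2, intervalIntegral.integral_of_le ht.le]
  apply setIntegral_congr_fun measurableSet_Ioc
  intro ξ hξ
  simp only
  rw [← (hasSum_ptS hρ hμ hb hξ.1).tsum_eq, ← tsum_mul_left]
  congr 1; ext j; ring

lemma deriv_ptS {ρ μ : ℝ} (hρ : 0 < ρ) (hμ : 0 < μ) {b : ℕ → ℝ} (hb : GB b) {t : ℝ}
    (ht : 0 < t) : HasDerivAt (ptS ρ b (μ + 1)) (ptS ρ b μ t) t := by
  have hs := (summable_abs hρ hμ hb (x := (2 * t) ^ ρ) (by positivity)).mul_left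
    ((t / 2) ^ (μ - 1) + (2 * t) ^ (μ - 1))
  have := hasDerivAt_tsum_of_isPreconnected (t := Set.Ioo (t / 2) (2 * t)) (y := t) (y₀ := t)
    (g := fun (j : ℕ) s => b j * s ^ (ρ * j + (μ + 1) - 1) / Real.Gamma (ρ * j + (μ + 1)))
    (g' := fun (j : ℕ) s => b j * s ^ (ρ * j + μ - 1) / Real.Gamma (ρ * j + μ))
    hs isOpen_Ioo isPreconnected_Ioo ?_ ?_ ⟨by linarith, by linarith⟩
    (hasSum_ptS hρ (by linarith) hb ht).summable ⟨by linarith, by linarith⟩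
  · rw [(hasSum_ptS hρ hμ hb ht).tsum_eq] at this
    refine this.congr_of_eventuallyEq ?_
    filter_upwards [lt_mem_nhds ht] with s hs
    rw [(hasSum_ptS hρ (by linarith) hb hs).tsum_eq]
  · intro j s hs
    have hs0 : 0 < s := by linarith [hs.1]
    have hp : 0 < ρ * j + μ := by positivity
    have h1 := (Real.hasDerivAt_rpow_const (x := s) (p := ρ * j + μ) (Or.inl hs0.ne'))
    have h2 := (h1.const_mul (b j)).div_const (Real.Gamma (ρ * j + (μ + 1)))
    have e : ρ * j + (μ + 1) - 1 = ρ * j + μ := by ring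
    rw [e]
    convert! h2 using 1
    rw [← add_assoc, Real.Gamma_add_one hp.ne']
    have := (Gpos hρ hμ j).ne'
    field_simp
  · intro j s hs
    have hs0 : 0 < s := by linarith [hs.1]
    have := Gpos hρ hμ j
    rw [norm_div, norm_mul, Real.norm_eq_abs, Real.norm_of_nonneg (by positivity),
        Real.norm_of_nonneg (Gpos hρ hμ j).le, term_eq hs0]
    have h1 : s ^ (μ - 1) ≤ (t / 2) ^ (μ - 1) + (2 * t) ^ (μ - 1) := by
      have p1 : 0 < (t / 2) ^ (μ - 1) := by positivity
      have p2 : 0 < (2 * t) ^ (μ - 1) := by positivity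
      rcases le_total 1 μ with h | h
      · have := Real.rpow_le_rpow hs0.le hs.2.le (z := μ - 1) (by linarith)
        linarith
      · have := Real.rpow_le_rpow_of_nonpos (z := μ - 1) (by linarith) hs.1.le (by linarith)
        linarith
    have h2 : (s ^ ρ) ≤ ((2 * t) ^ ρ) := Real.rpow_le_rpow hs0.le hs.2.le hρ.le
    calc _ = s ^ (μ - 1) * (|b j| * (s ^ ρ) ^ j / Real.Gamma (ρ * j + μ)) := by ring
      _ ≤ _ := by gcongr

lemma maxp {ρ : ℝ} (hρ : 0 < ρ) (hρ1 : ρ < 1) {b : ℕ → ℝ} (hb : GB b) {t0 : ℝ} (ht0 : 0 < t0)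
    (hmax : ∀ s ∈ Set.Ioc 0 t0, ptS ρ b (ρ + 1) s ≤ ptS ρ b (ρ + 1) t0)
    (hpos : 0 ≤ ptS ρ b (ρ + 1) t0) : 0 ≤ ptS ρ b 1 t0 := by
  set z := ptS ρ b (ρ + 1) with hz
  set M := z t0 with hM
  have hzc : Continuous z := by
    have h1 : Continuous fun t : ℝ => t ^ ρ := Real.continuous_rpow_const hρ.le
    have : z = fun t => t ^ ρ * pS ρ b (ρ + 1) (t ^ ρ) := by
      ext t; simp [hz, ptS]
    rw [this]
    exact h1.mul ((continuous_pS hρ (by linarith) hb).comp h1)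
  have hzd : HasDerivAt z (ptS ρ b ρ t0) t0 := deriv_ptS hρ hρ hb ht0
  have hFd : HasDerivAt (ptS ρ b 2) (ptS ρ b 1 t0) t0 := by
    have := deriv_ptS hρ one_pos hb ht0
    norm_num at this
    exact this
  have hG : 0 < Real.Gamma (1 - ρ) := Real.Gamma_pos_of_pos (by linarith)
  have hker : ∀ t : ℝ, ∀ a c : ℝ, IntervalIntegrable (fun ξ : ℝ => (t - ξ) ^ (-ρ)) volume a c := by
    intro t a c
    have := (intervalIntegral.intervalIntegrable_rpow' (a := t - a) (b := t - c) (r := -ρ)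
      (by linarith)).comp_sub_left t
    simpa using this
  have hF : ∀ t, 0 < t → ∫ ξ in (0:ℝ)..t, (t - ξ) ^ (-ρ) * z ξ
      = Real.Gamma (1 - ρ) * ptS ρ b 2 t := by
    intro t ht
    have := rl_ptS hρ (μ := ρ + 1) (σ := 1 - ρ) (by linarith) (by linarith) hb ht
    rw [show 1 - ρ - 1 = -ρ by ring, show ρ + 1 + (1 - ρ) = 2 by ring] at this
    exact this
  have hqi : ∀ t a c : ℝ,
      IntervalIntegrable (fun ξ : ℝ => (t - ξ) ^ (-ρ) * (M - z ξ)) volume a c := by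
    intro t a c
    exact (hker t a c).mul_continuousOn (by fun_prop)
  have hone : ∀ t, 0 < t → ∫ ξ in (0:ℝ)..t, (t - ξ) ^ (-ρ) = t ^ (1 - ρ) / (1 - ρ) := by
    intro t ht
    rw [intervalIntegral.integral_comp_sub_left (fun x => x ^ (-ρ)) t]
    rw [integral_rpow (Or.inl (by linarith))]
    rw [show -ρ + 1 = 1 - ρ by ring]
    simp [Real.zero_rpow (by linarith : 1 - ρ ≠ 0)]
  have hQ : ∀ t, 0 < t → ∫ ξ in (0:ℝ)..t, (t - ξ) ^ (-ρ) * (M - z ξ)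
      = M * (t ^ (1 - ρ) / (1 - ρ)) - Real.Gamma (1 - ρ) * ptS ρ b 2 t := by
    intro t ht
    rw [← hF t ht, ← hone t ht, ← intervalIntegral.integral_const_mul,
      ← intervalIntegral.integral_sub ((hker t 0 t).const_mul M)
        ((hker t 0 t).mul_continuousOn hzc.continuousOn)]
    congr 1; ext ξ; ring
  -- Lipschitz bound near t0
  obtain ⟨L, hL0, hL⟩ : ∃ L, 0 ≤ L ∧ ∀ᶠ s in nhds t0, M - z s ≤ L * |t0 - s| := by
    obtain ⟨L, hL0, hL⟩ := hzd.isBigO_sub.exists_nonneg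
    refine ⟨L, hL0, ?_⟩
    filter_upwards [hL.bound] with s hs
    rw [Real.norm_eq_abs, Real.norm_eq_abs, abs_sub_comm, abs_sub_comm s] at hs
    exact (le_abs_self _).trans hs
  obtain ⟨δ, hδ, hδL⟩ := Metric.eventually_nhds_iff.1 hL
  have main : ∀ h, 0 < h → h < δ → h < t0 →
      - (L * h ^ (1 - ρ) / Real.Gamma (1 - ρ)) ≤ (ptS ρ b 2 (t0 - h) - ptS ρ b 2 t0) / (-h) := by
    intro h hh hhδ hht
    have hs : 0 < t0 - h := by linarith
    have e1 := hQ t0 ht0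
    have e2 := hQ (t0 - h) hs
    have e3 := intervalIntegral.integral_add_adjacent_intervals (hqi t0 0 (t0 - h))
      (hqi t0 (t0 - h) t0)
    have i1 : ∫ ξ in (0:ℝ)..(t0 - h), (t0 - ξ) ^ (-ρ) * (M - z ξ) ≤
        ∫ ξ in (0:ℝ)..(t0 - h), (t0 - h - ξ) ^ (-ρ) * (M - z ξ) := by
      apply intervalIntegral.integral_mono_on_of_le_Ioo hs.le (hqi _ _ _) (hqi _ _ _)
      intro ξ hξ
      have q0 : 0 ≤ M - z ξ := by linarith [hmax ξ ⟨hξ.1, by linarith [hξ.2]⟩]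
      apply mul_le_mul_of_nonneg_right _ q0
      exact Real.rpow_le_rpow_of_nonpos (by linarith [hξ.2]) (by linarith) (by linarith)
    have i2 : ∫ ξ in (t0 - h)..t0, (t0 - ξ) ^ (-ρ) * (M - z ξ) ≤
        ∫ ξ in (t0 - h)..t0, L * h ^ (1 - ρ) := by
      apply intervalIntegral.integral_mono_on_of_le_Ioo (by linarith) (hqi _ _ _)
        intervalIntegrable_const
      intro ξ hξ
      have p : 0 < t0 - ξ := by linarith [hξ.2]
      have p2 : t0 - ξ ≤ h := by linarith [hξ.1]
      have := hδL (y := ξ) (by rw [Real.dist_eq, abs_sub_comm, abs_of_pos p]; linarith)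
      rw [abs_of_pos p] at this
      calc _ ≤ (t0 - ξ) ^ (-ρ) * (L * (t0 - ξ)) := by gcongr
        _ = L * (t0 - ξ) ^ (1 - ρ) := by
            rw [show 1 - ρ = -ρ + 1 by ring, Real.rpow_add_one p.ne']; ring
        _ ≤ _ := by
            have := Real.rpow_le_rpow p.le p2 (z := 1 - ρ) (by linarith)
            gcongr
    rw [intervalIntegral.integral_const, smul_eq_mul] at i2
    have i3 : (t0 - h) ^ (1 - ρ) / (1 - ρ) ≤ t0 ^ (1 - ρ) / (1 - ρ) := by
      have h1 : (0:ℝ) < 1 - ρ := by linarith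
      have := Real.rpow_le_rpow hs.le (by linarith : t0 - h ≤ t0) h1.le
      gcongr
    have i4 := mul_le_mul_of_nonneg_left i3 hpos
    have i5 : Real.Gamma (1 - ρ) * (ptS ρ b 2 (t0 - h) - ptS ρ b 2 t0) ≤ h * (L * h ^ (1 - ρ)) := by
      linarith
    rw [div_neg, neg_le_neg_iff, div_le_div_iff₀ hh hG]
    linarith
  have hlim1 : Tendsto (fun h : ℝ => (ptS ρ b 2 (t0 - h) - ptS ρ b 2 t0) / (-h))
      (nhdsWithin 0 (Set.Ioi 0)) (nhds (ptS ρ b 1 t0)) := by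
    have h1 := hFd.tendsto_slope_zero
    have h2 : Tendsto (fun h : ℝ => -h) (nhdsWithin 0 (Set.Ioi 0)) (nhdsWithin 0 {0}ᶜ) := by
      refine tendsto_nhdsWithin_iff.2 ⟨?_, ?_⟩
      · have : Tendsto (fun h : ℝ => -h) (nhds 0) (nhds (-0)) := (continuous_neg).tendsto 0
        rw [neg_zero] at this
        exact this.mono_left nhdsWithin_le_nhds
      · filter_upwards [self_mem_nhdsWithin] with h hh
        have : (0:ℝ) < h := hh
        simpa using this.ne'
    refine (h1.comp h2).congr ?_
    intro h
    simp only [Function.comp, smul_eq_mul, ← sub_eq_add_neg]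
    rw [div_eq_inv_mul]
  have hlim2 : Tendsto (fun h : ℝ => - (L * h ^ (1 - ρ) / Real.Gamma (1 - ρ)))
      (nhdsWithin 0 (Set.Ioi 0)) (nhds 0) := by
    have hc : Continuous (fun h : ℝ => - (L * h ^ (1 - ρ) / Real.Gamma (1 - ρ))) :=
      (((Real.continuous_rpow_const (by linarith)).const_mul L).div_const _).neg
    have := hc.tendsto 0
    rw [Real.zero_rpow (by linarith)] at this
    simp only [mul_zero, zero_div, neg_zero] at this
    exact this.mono_left nhdsWithin_le_nhds
  refine le_of_tendsto_of_tendsto hlim2 hlim1 ?_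
  filter_upwards [Ioo_mem_nhdsGT (lt_min hδ ht0)] with h hh
  exact main h hh.1 (hh.2.trans_le (min_le_left _ _)) (hh.2.trans_le (min_le_right _ _))

lemma continuous_z {ρ : ℝ} (hρ : 0 < ρ) {b : ℕ → ℝ} (hb : GB b) :
    Continuous (ptS ρ b (ρ + 1)) := by
  have h1 : Continuous fun t : ℝ => t ^ ρ := Real.continuous_rpow_const hρ.le
  have : ptS ρ b (ρ + 1) = fun t => t ^ ρ * pS ρ b (ρ + 1) (t ^ ρ) := by
    ext t; simp [ptS]
  rw [this]
  exact h1.mul ((continuous_pS hρ (by linarith) hb).comp h1)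

lemma boundP {ρ : ℝ} (hρ : 0 < ρ) (hρ1 : ρ < 1) {b : ℕ → ℝ} (hb : GB b) {K : ℝ} (hK : 0 ≤ K)
    (H : ∀ t, 0 < t → K < ptS ρ b (ρ + 1) t → ptS ρ b 1 t < 0) {t : ℝ} (ht : 0 < t) :
    ptS ρ b (ρ + 1) t ≤ K := by
  by_contra! hcon
  obtain ⟨t0, ht0, hm⟩ := isCompact_Icc.exists_isMaxOn (Set.nonempty_Icc.2 ht.le)
    (continuous_z hρ hb).continuousOn
  have h1 : K < ptS ρ b (ρ + 1) t0 := hcon.trans_le (hm ⟨ht.le, le_rfl⟩)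
  have h2 : 0 < t0 := by
    rcases ht0.1.eq_or_lt with h | h
    · rw [← h] at h1
      simp [ptS, Real.zero_rpow hρ.ne'] at h1
      linarith
    · exact h
  have := maxp hρ hρ1 hb h2 (fun s hs => hm ⟨hs.1.le, hs.2.trans ht0.2⟩) (hK.trans h1.le)
  linarith [H t0 h2 h1]

lemma GB_neg {b : ℕ → ℝ} (hb : GB b) : GB (fun j => - b j) := by
  obtain ⟨C, r, hC, hr, h⟩ := hb
  exact ⟨C, r, hC, hr, fun j => by rw [abs_neg]; exact h j⟩

lemma ptS_neg (ρ : ℝ) (b : ℕ → ℝ) (μ t : ℝ) : ptS ρ (fun j => - b j) μ t = - ptS ρ b μ t := by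
  simp [ptS, pS, neg_div, tsum_neg]

lemma GB_pow (l : ℝ) : GB (fun j => (-l) ^ j) :=
  ⟨1, |l|, by norm_num, abs_nonneg _, fun j => by simp [abs_pow]⟩

/-- `pS` recursion -/
lemma pS_rec {ρ : ℝ} (hρ : 0 < ρ) (l x : ℝ) :
    pS ρ (fun j => (-l) ^ j) 1 x = 1 - l * x * pS ρ (fun j => (-l) ^ j) (ρ + 1) x := by
  have h := (summable_pS hρ one_pos (GB_pow l) x).tsum_eq_zero_add
  unfold pS
  rw [h, ← tsum_mul_left, sub_eq_add_neg, ← tsum_neg]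
  congr 1
  · simp
  · congr 1; ext j
    rw [show ρ * ((j + 1 : ℕ) : ℝ) + 1 = ρ * j + (ρ + 1) by push_cast; ring]
    ring

noncomputable def b1 (ρ : ℝ) (j : ℕ) : ℝ := ρ * (j + 1) * (-1) ^ j

lemma GB_b1 {ρ : ℝ} (hρ : 0 < ρ) : GB (b1 ρ) := by
  refine ⟨ρ, 2, hρ.le, by norm_num, fun j => ?_⟩
  have h : (j:ℝ) + 1 ≤ 2 ^ j := by exact_mod_cast Nat.lt_two_pow_self
  rw [b1, abs_mul, abs_pow, abs_neg, abs_one, one_pow, mul_one, abs_of_nonneg (by positivity)]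
  gcongr

lemma pS_b1 {ρ : ℝ} (hρ : 0 < ρ) (x : ℝ) :
    pS ρ (b1 ρ) (ρ + 1) x = pS ρ (fun j => (-1) ^ j) ρ x := by
  unfold pS
  congr 1; ext j
  have hp : 0 < ρ * j + ρ := by positivity
  have := (Gpos hρ hρ j).ne'
  rw [← add_assoc, Real.Gamma_add_one hp.ne', b1]
  field_simp

lemma pS_b1' {ρ : ℝ} (hρ : 0 < ρ) (x : ℝ) :
    pS ρ (b1 ρ) 1 x = ρ * pS ρ (fun j => (-1) ^ j) 1 x - x * pS ρ (b1 ρ) (ρ + 1) x := by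
  have h1 := (summable_pS hρ one_pos (GB_b1 hρ) x)
  have h2 := ((summable_pS hρ one_pos (GB_pow 1) x).mul_left ρ)
  have h3 := (h1.sub h2).tsum_eq_zero_add
  rw [h1.tsum_sub h2, tsum_mul_left] at h3
  have : x * pS ρ (b1 ρ) (ρ + 1) x = - ∑' j : ℕ, (b1 ρ (j + 1) * x ^ (j + 1) /
      Real.Gamma (ρ * ((j + 1 : ℕ) : ℝ) + 1)
        - ρ * ((-1) ^ (j + 1) * x ^ (j + 1) / Real.Gamma (ρ * ((j + 1 : ℕ) : ℝ) + 1))) := by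
    unfold pS
    rw [← tsum_mul_left, ← tsum_neg]
    congr 1; ext j
    rw [show ρ * ((j + 1 : ℕ) : ℝ) + 1 = ρ * j + (ρ + 1) by push_cast; ring, b1, b1]
    push_cast
    ring
  rw [this]
  unfold pS
  simp only [b1] at h3 ⊢
  simp at h3 ⊢
  linarith

lemma w_bound {ρ : ℝ} (hρ : 0 < ρ) (hρ1 : ρ < 1) {x : ℝ} (hx : 0 < x) :
    0 ≤ pS ρ (fun j => (-1) ^ j) 1 x ∧ pS ρ (fun j => (-1) ^ j) 1 x ≤ 1 := by
  set t := x ^ (1 / ρ) with htd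
  have ht : 0 < t := by positivity
  have htx : t ^ ρ = x := by
    rw [htd, ← Real.rpow_mul hx.le]; field_simp; simp
  have rel : ∀ s, ptS ρ (fun j => (-1) ^ j) 1 s = 1 - ptS ρ (fun j => (-1) ^ j) (ρ + 1) s := by
    intro s
    simp only [ptS]
    rw [pS_rec hρ]; simp
  have e : ptS ρ (fun j => (-1) ^ j) 1 t = pS ρ (fun j => (-1) ^ j) 1 x := by
    simp [ptS, htx]
  rw [← e]
  constructor
  · have := boundP hρ hρ1 (GB_pow 1) zero_le_one (fun s hs h => by rw [rel]; linarith) ht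
    rw [rel]; linarith
  · have := boundP hρ hρ1 (GB_neg (GB_pow 1)) le_rfl (fun s hs h => by
      rw [ptS_neg] at h ⊢; rw [rel]; linarith) ht
    rw [ptS_neg] at this
    rw [rel]; linarith

lemma z_bound {ρ : ℝ} (hρ : 0 < ρ) (hρ1 : ρ < 1) {x : ℝ} (hx : 0 < x) :
    0 ≤ x * pS ρ (fun j => (-1) ^ j) ρ x ∧ x * pS ρ (fun j => (-1) ^ j) ρ x ≤ ρ := by
  set t := x ^ (1 / ρ) with htd
  have ht : 0 < t := by positivity
  have htx : t ^ ρ = x := by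
    rw [htd, ← Real.rpow_mul hx.le]; field_simp; simp
  have rel : ∀ s, ptS ρ (b1 ρ) 1 s
      = ρ * pS ρ (fun j => (-1) ^ j) 1 (s ^ ρ) - ptS ρ (b1 ρ) (ρ + 1) s := by
    intro s
    simp only [ptS]
    rw [pS_b1' hρ]; simp
  have e : ptS ρ (b1 ρ) (ρ + 1) t = x * pS ρ (fun j => (-1) ^ j) ρ x := by
    simp [ptS, htx, pS_b1 hρ]
  rw [← e]
  constructor
  · have := boundP hρ hρ1 (GB_neg (GB_b1 hρ)) le_rfl (fun s hs h => by
      rw [ptS_neg] at h ⊢; rw [rel]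
      have := mul_nonneg hρ.le (w_bound hρ hρ1 (x := s ^ ρ) (by positivity)).1
      linarith) ht
    rw [ptS_neg] at this
    linarith
  · exact boundP hρ hρ1 (GB_b1 hρ) hρ.le (fun s hs h => by
      rw [rel]
      have := mul_le_mul_of_nonneg_left (w_bound hρ hρ1 (x := s ^ ρ) (by positivity)).2 hρ.le
      linarith) ht

section Hil
variable {H : Type*} [NormedAddCommGroup H] [InnerProductSpace ℝ H] [CompleteSpace H]

noncomputable def BB (v : HilbertBasis ℕ ℝ H) (φ : H) (a : ℕ → ℝ) : H :=
  ∑' k : ℕ, (a k * ⟪φ, v k⟫) • v k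

lemma summable_sq (v : HilbertBasis ℕ ℝ H) (φ : H) : Summable (fun k => ⟪φ, v k⟫ ^ 2) := by
  refine (v.summable_inner_mul_inner φ φ).congr ?_
  intro k
  rw [real_inner_comm, sq]

lemma norm_sq_eq (v : HilbertBasis ℕ ℝ H) (φ : H) : ‖φ‖ ^ 2 = ∑' k, ⟪φ, v k⟫ ^ 2 := by
  rw [← real_inner_self_eq_norm_sq, ← v.tsum_inner_mul_inner]
  congr 1; ext k
  rw [sq, real_inner_comm (v k)]

lemma BB_aux (v : HilbertBasis ℕ ℝ H) (φ : H) {a : ℕ → ℝ} {C : ℝ} (ha : ∀ k, |a k| ≤ C) :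
    HasSum (fun k : ℕ => (a k * ⟪φ, v k⟫) • v k) (BB v φ a) ∧
      ∀ k, ⟪BB v φ a, v k⟫ = a k * ⟪φ, v k⟫ := by
  have hm : Memℓp (fun k => a k * ⟪φ, v k⟫) 2 := by
    apply memℓp_gen
    refine Summable.of_nonneg_of_le (fun k => by positivity) ?_
      ((summable_sq v φ).mul_left (C ^ 2))
    intro k
    have h := ha k
    simp only [ENNReal.toReal_ofNat, Real.rpow_ofNat, Real.norm_eq_abs, sq_abs, mul_pow]
    gcongr ?_ * _
    rw [← sq_abs]
    gcongr
  have hs := v.hasSum_repr_symm (⟨_, hm⟩ : lp (fun _ : ℕ => ℝ) 2)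
  have e : BB v φ a = v.repr.symm (⟨_, hm⟩ : lp (fun _ : ℕ => ℝ) 2) := hs.tsum_eq
  refine ⟨e ▸ hs, fun k => ?_⟩
  rw [e, real_inner_comm, ← v.repr_apply_apply, v.repr.apply_symm_apply]

lemma ext_basis (v : HilbertBasis ℕ ℝ H) {x y : H} (h : ∀ k, ⟪x, v k⟫ = ⟪y, v k⟫) : x = y := by
  apply v.repr.injective
  ext k
  rw [v.repr_apply_apply, v.repr_apply_apply, real_inner_comm, h k, real_inner_comm]

lemma BB_norm_le (v : HilbertBasis ℕ ℝ H) (φ : H) {a : ℕ → ℝ} {C : ℝ} (ha : ∀ k, |a k| ≤ C) :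
    ‖BB v φ a‖ ≤ C * ‖φ‖ := by
  have hC : 0 ≤ C := (abs_nonneg _).trans (ha 0)
  apply le_of_sq_le_sq _ (by positivity)
  rw [mul_pow, norm_sq_eq v, norm_sq_eq v φ, ← tsum_mul_left]
  refine Summable.tsum_le_tsum ?_ (summable_sq v _) ((summable_sq v φ).mul_left _)
  intro k
  rw [(BB_aux v φ ha).2, mul_pow]
  gcongr ?_ * _
  rw [← sq_abs]
  have := ha k
  gcongr

lemma BB_tendsto (v : HilbertBasis ℕ ℝ H) (φ : H) {α : Type*} {l : Filter α} {a : α → ℕ → ℝ}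
    {a0 : ℕ → ℝ} {C : ℝ} (ha : ∀ᶠ t in l, ∀ k, |a t k| ≤ C) (ha0 : ∀ k, |a0 k| ≤ C)
    (hlim : ∀ k, Tendsto (fun t => a t k) l (nhds (a0 k))) :
    Tendsto (fun t => BB v φ (a t)) l (nhds (BB v φ a0)) := by
  have key : Tendsto (fun t => ∑' k, ⟪BB v φ (a t) - BB v φ a0, v k⟫ ^ 2) l
      (nhds (∑' k : ℕ, (0:ℝ))) := by
    refine tendsto_tsum_of_dominated_convergence
      (bound := fun k => (2 * C) ^ 2 * ⟪φ, v k⟫ ^ 2) ((summable_sq v φ).mul_left _) ?_ ?_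
    · intro k
      have h1 : Tendsto (fun t => ((a t k - a0 k) * ⟪φ, v k⟫) ^ 2) l
          (nhds (((a0 k - a0 k) * ⟪φ, v k⟫) ^ 2)) :=
        (((hlim k).sub_const _).mul_const _).pow 2
      rw [sub_self, zero_mul, zero_pow two_ne_zero] at h1
      refine h1.congr' ?_
      filter_upwards [ha] with t ht
      rw [inner_sub_left, (BB_aux v φ ht).2, (BB_aux v φ ha0).2, sub_mul]
    · filter_upwards [ha] with t ht k
      rw [inner_sub_left, (BB_aux v φ ht).2, (BB_aux v φ ha0).2, ← sub_mul, Real.norm_eq_abs,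
        abs_of_nonneg (by positivity), mul_pow]
      gcongr ?_ * _
      rw [← sq_abs]
      have h1 := ht k
      have h2 := ha0 k
      have h3 := abs_sub (a t k) (a0 k)
      gcongr
      linarith
  simp only [← norm_sq_eq, tsum_zero] at key
  have k2 := key.sqrt
  simp only [Real.sqrt_sq (norm_nonneg _), Real.sqrt_zero] at k2
  exact tendsto_iff_norm_sub_tendsto_zero.2 k2

lemma BB_smul (v : HilbertBasis ℕ ℝ H) (φ : H) {a : ℕ → ℝ} (c : ℝ) :
    BB v φ (fun k => c * a k) = c • BB v φ a := by
  unfold BB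
  rw [← tsum_const_smul'']
  congr 1; ext k
  rw [smul_smul, mul_assoc]

lemma BB_sub (v : HilbertBasis ℕ ℝ H) (φ : H) {a b : ℕ → ℝ} {C D : ℝ} (ha : ∀ k, |a k| ≤ C)
    (hb : ∀ k, |b k| ≤ D) :
    BB v φ (fun k => a k - b k) = BB v φ a - BB v φ b := by
  refine ((((BB_aux v φ ha).1.sub (BB_aux v φ hb).1)).tsum_eq ▸ ?_)
  unfold BB
  congr 1; ext k
  rw [← sub_smul, sub_mul]

lemma BB_one (v : HilbertBasis ℕ ℝ H) (φ : H) : BB v φ (fun _ => 1) = φ := by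
  apply ext_basis v
  intro k
  rw [(BB_aux v φ (C := 1) (by simp)).2, one_mul]

/-- termwise differentiation -/
lemma BB_hasDerivAt (v : HilbertBasis ℕ ℝ H) (φ : H) {w w' : ℝ → ℕ → ℝ} {t C D δ : ℝ}
    (hδ : 0 < δ) (hw : ∀ s ∈ Metric.ball t δ, ∀ k, |w s k| ≤ D)
    (hd : ∀ s ∈ Metric.ball t δ, ∀ k, HasDerivAt (fun s => w s k) (w' s k) s)
    (hw' : ∀ s ∈ Metric.ball t δ, ∀ k, |w' s k| ≤ C) :
    HasDerivAt (fun s => BB v φ (w s)) (BB v φ (w' t)) t := by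
  rw [hasDerivAt_iff_tendsto_slope]
  have htm : t ∈ Metric.ball t δ := Metric.mem_ball_self hδ
  have h1 : Tendsto (fun s => BB v φ (fun k => (s - t)⁻¹ * (w s k - w t k)))
      (nhdsWithin t {t}ᶜ) (nhds (BB v φ (w' t))) := by
    refine BB_tendsto v φ (C := C) ?_ (hw' t htm) ?_
    · filter_upwards [self_mem_nhdsWithin,
        mem_nhdsWithin_of_mem_nhds (Metric.ball_mem_nhds t hδ)] with s hs1 hs k
      have := (convex_ball t δ).norm_image_sub_le_of_norm_hasDerivWithin_le
        (f := fun s => w s k) (f' := fun s => w' s k) (C := C)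
        (fun x hx => (hd x hx k).hasDerivWithinAt) (fun x hx => hw' x hx k) htm hs
      have hne : 0 < |s - t| := abs_pos.2 (sub_ne_zero.2 hs1)
      rw [abs_mul, abs_inv, inv_mul_le_iff₀ hne]
      simp only [Real.norm_eq_abs] at this
      linarith
    · intro k
      have := hasDerivAt_iff_tendsto_slope.1 (hd t htm k)
      exact this
  refine h1.congr' ?_
  filter_upwards [mem_nhdsWithin_of_mem_nhds (Metric.ball_mem_nhds t hδ)] with s hs
  rw [BB_smul, BB_sub v φ (hw s hs) (hw t htm), slope_def_module]

end Hil

lemma ml_eq (ρ μ x : ℝ) : mittagLeffler ρ μ (-x) = pS ρ (fun j => (-1) ^ j) μ x := by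
  unfold mittagLeffler pS
  congr 1; ext k
  rw [neg_pow]

lemma pS_scale (ρ μ l x : ℝ) :
    pS ρ (fun j => (-1) ^ j) μ (l * x) = pS ρ (fun j => (-l) ^ j) μ x := by
  unfold pS
  congr 1; ext k
  beta_reduce
  rw [neg_pow l, mul_pow]; ring

noncomputable def yy (ρ l t : ℝ) : ℝ := t ^ (ρ - 1) * mittagLeffler ρ ρ (-(l * t ^ ρ))

noncomputable def ww (ρ l t : ℝ) : ℝ := pS ρ (fun j => (-1) ^ j) 1 (l * t ^ ρ)

lemma yy_eq (ρ l t : ℝ) : yy ρ l t = ptS ρ (fun j => (-l) ^ j) ρ t := by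
  rw [yy, ml_eq, pS_scale, ptS]

lemma ww_eq (ρ l t : ℝ) : ww ρ l t = ptS ρ (fun j => (-l) ^ j) 1 t := by
  rw [ww, pS_scale, ptS]; simp

lemma ww_eq' {ρ : ℝ} (hρ : 0 < ρ) (l t : ℝ) :
    ww ρ l t = 1 - l * ptS ρ (fun j => (-l) ^ j) (ρ + 1) t := by
  rw [ww, pS_scale, ptS, pS_rec hρ]; simp; ring

lemma ww_deriv {ρ : ℝ} (hρ : 0 < ρ) (l : ℝ) {t : ℝ} (ht : 0 < t) :
    HasDerivAt (ww ρ l) (-(l * yy ρ l t)) t := by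
  have h := ((deriv_ptS hρ hρ (GB_pow l) ht).const_mul l).const_sub 1
  rw [yy_eq]
  have e : ww ρ l = fun t => 1 - l * ptS ρ (fun j => (-l) ^ j) (ρ + 1) t := by
    ext s; exact ww_eq' hρ l s
  rw [e]; exact h

lemma ww_int {ρ : ℝ} (hρ : 0 < ρ) (hρ1 : ρ < 1) (l : ℝ) {t : ℝ} (ht : 0 < t) :
    ∫ ξ in (0:ℝ)..t, (t - ξ) ^ (1 - ρ - 1) * yy ρ l ξ = Real.Gamma (1 - ρ) * ww ρ l t := by
  have := rl_ptS hρ hρ (σ := 1 - ρ) (by linarith) (GB_pow l) ht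
  rw [show ρ + (1 - ρ) = 1 by ring, ← ww_eq] at this
  simpa only [← yy_eq] using this

lemma ww_abs {ρ : ℝ} (hρ : 0 < ρ) (hρ1 : ρ < 1) {l : ℝ} (hl : 0 < l) {t : ℝ} (ht : 0 < t) :
    |ww ρ l t| ≤ 1 := by
  have := w_bound hρ hρ1 (x := l * t ^ ρ) (by positivity)
  rw [ww, abs_le]; constructor <;> linarith

lemma yy_abs {ρ : ℝ} (hρ : 0 < ρ) (hρ1 : ρ < 1) {l : ℝ} (hl : 0 < l) {t : ℝ} (ht : 0 < t) :
    |l * yy ρ l t| ≤ ρ / t := by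
  have := z_bound hρ hρ1 (x := l * t ^ ρ) (by positivity)
  have e : l * yy ρ l t = (l * t ^ ρ * pS ρ (fun j => (-1) ^ j) ρ (l * t ^ ρ)) / t := by
    rw [yy, ml_eq, Real.rpow_sub_one ht.ne']; ring
  rw [e, abs_div, abs_of_pos ht, abs_of_nonneg this.1]
  have := this.2
  gcongr

lemma yy_abs' {ρ : ℝ} (hρ : 0 < ρ) (hρ1 : ρ < 1) : ∃ C, 0 ≤ C ∧ ∀ l t : ℝ, 0 < l → 0 < t →
    |yy ρ l t| ≤ C * t ^ (ρ - 1) := by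
  obtain ⟨C, hC⟩ := isCompact_Icc.exists_bound_of_continuousOn (s := Set.Icc (0:ℝ) 1)
    (continuous_pS hρ hρ (GB_pow 1)).continuousOn
  refine ⟨max C 1, by positivity, fun l t hl ht => ?_⟩
  have hx : 0 < l * t ^ ρ := by positivity
  rw [yy, ml_eq, abs_mul, abs_of_pos (by positivity : 0 < t ^ (ρ - 1)), mul_comm]
  gcongr
  rcases le_total (l * t ^ ρ) 1 with h | h
  · exact (hC _ ⟨hx.le, h⟩).trans (le_max_left _ _)
  · refine le_trans ?_ (le_max_right _ _)
    have h2 := z_bound hρ hρ1 hx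
    have h3 : 0 ≤ pS ρ (fun j => (-1) ^ j) ρ (l * t ^ ρ) := by
      have := h2.1
      exact nonneg_of_mul_nonneg_right this hx
    rw [abs_of_nonneg h3]
    nlinarith [h2.2]

lemma yy_cont {ρ : ℝ} (hρ : 0 < ρ) (l : ℝ) {t : ℝ} (ht : 0 < t) : ContinuousAt (yy ρ l) t := by
  have e : yy ρ l = fun t => t ^ (ρ - 1) * pS ρ (fun j => (-l) ^ j) ρ (t ^ ρ) := by
    ext s; rw [yy_eq, ptS]
  rw [e]
  exact (Real.continuousAt_rpow_const _ _ (Or.inl ht.ne')).mul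
    (((continuous_pS hρ hρ (GB_pow l)).comp (Real.continuous_rpow_const hρ.le)).continuousAt)

lemma ww_zero {ρ : ℝ} (hρ : 0 < ρ) (l : ℝ) :
    Tendsto (ww ρ l) (nhdsWithin 0 (Set.Ioi 0)) (nhds 1) := by
  have e : ww ρ l = fun t => 1 - l * ptS ρ (fun j => (-l) ^ j) (ρ + 1) t := by
    ext s; exact ww_eq' hρ l s
  have hc : Continuous (ww ρ l) := by
    rw [e]; exact continuous_const.sub ((continuous_z hρ (GB_pow l)).const_mul l)
  have h := hc.tendsto 0
  have e0 : ww ρ l 0 = 1 := by rw [e]; simp [ptS, Real.zero_rpow hρ.ne']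
  rw [e0] at h
  exact h.mono_left nhdsWithin_le_nhds

/-- Existence of the solution of the forward problem
`∂_t^ρ u + Au = 0`, `lim_{t→0⁺} ∂_t^{ρ-1} u(t) = φ`:  the Fourier series
`u(t) = Σ_k t^{ρ-1} E_{ρ,ρ}(-λ_k t^ρ)(φ, v_k) v_k` converges in `H` for `t ∈ (0,T]`,
`u(t)` lies in the domain of `A`, the maps `t ↦ Au(t)` and `t ↦ ∂_t^ρ u(t)` are
continuous on `(0,T]`, the equation holds on `(0,T]`, and `∂_t^{ρ-1} u(t) → φ` as
`t → 0⁺`. -/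
theorem statement0
    {H : Type*} [NormedAddCommGroup H] [InnerProductSpace ℝ H] [CompleteSpace H]
    (v : HilbertBasis ℕ ℝ H) (lam : ℕ → ℝ) (hlam1 : 0 < lam 0) (hmono : Monotone lam)
    (ρ : ℝ) (hρ : ρ ∈ Set.Ioo (0 : ℝ) 1) (T : ℝ) (hT : 0 < T) (φ : H)
    (u : ℝ → H)
    (hu : u = fun t : ℝ => ∑' k : ℕ,
      (t ^ (ρ - 1) * mittagLeffler ρ ρ (-(lam k * t ^ ρ)) * ⟪φ, v k⟫) • v k)
    (Aop : H → H)
    (hA : Aop = fun h : H => ∑' k : ℕ, (lam k * ⟪h, v k⟫) • v k) :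
    (∀ t ∈ Set.Ioc (0 : ℝ) T, Summable (fun k : ℕ =>
      (t ^ (ρ - 1) * mittagLeffler ρ ρ (-(lam k * t ^ ρ)) * ⟪φ, v k⟫) • v k)) ∧
    (∀ t ∈ Set.Ioc (0 : ℝ) T, Summable (fun k : ℕ => (lam k) ^ 2 * ⟪u t, v k⟫ ^ 2)) ∧
    ContinuousOn (fun t : ℝ => Aop (u t)) (Set.Ioc (0 : ℝ) T) ∧
    ContinuousOn (fun t : ℝ => rlDeriv ρ u t) (Set.Ioc (0 : ℝ) T) ∧
    (∀ t ∈ Set.Ioc (0 : ℝ) T, rlDeriv ρ u t + Aop (u t) = 0) ∧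
    Tendsto (fun t : ℝ => rlIntegral (1 - ρ) u t) (nhdsWithin 0 (Set.Ioi 0)) (nhds φ) := by
  obtain ⟨hρ0, hρ1⟩ := hρ
  have hl : ∀ k, 0 < lam k := fun k => hlam1.trans_le (hmono (Nat.zero_le k))
  obtain ⟨C, hC0, hC⟩ := yy_abs' hρ0 hρ1
  have huB : ∀ t, u t = BB v φ (fun k => yy ρ (lam k) t) := fun t => by rw [hu]; rfl
  have hyb : ∀ t, 0 < t → ∀ k, |yy ρ (lam k) t| ≤ C * t ^ (ρ - 1) :=
    fun t ht k => hC _ _ (hl k) ht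
  have hlyb : ∀ t, 0 < t → ∀ k, |lam k * yy ρ (lam k) t| ≤ ρ / t :=
    fun t ht k => yy_abs hρ0 hρ1 (hl k) ht
  have hwb : ∀ t, 0 < t → ∀ k, |ww ρ (lam k) t| ≤ 1 :=
    fun t ht k => ww_abs hρ0 hρ1 (hl k) ht
  have huk : ∀ t, 0 < t → ∀ k, ⟪u t, v k⟫ = yy ρ (lam k) t * ⟪φ, v k⟫ := fun t ht k => by
    rw [huB, (BB_aux v φ (hyb t ht)).2]
  have hAu : ∀ t, 0 < t → Aop (u t) = BB v φ (fun k => lam k * yy ρ (lam k) t) := by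
    intro t ht
    rw [hA]
    simp only [huk t ht]
    unfold BB
    congr 1; ext k; rw [mul_assoc]
  -- continuity of u on (0,∞)
  have hucont : ∀ t, 0 < t → ContinuousAt u t := by
    intro t ht
    have : u = fun t => BB v φ (fun k => yy ρ (lam k) t) := funext huB
    rw [this]
    have hb : (C * t ^ (ρ - 1)) < C * t ^ (ρ - 1) + 1 := by linarith
    have hcc : ContinuousAt (fun s : ℝ => C * s ^ (ρ - 1)) t :=
      (Real.continuousAt_rpow_const _ _ (Or.inl ht.ne')).const_mul C
    refine BB_tendsto v φ (C := C * t ^ (ρ - 1) + 1) ?_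
      (fun k => (hyb t ht k).trans hb.le) (fun k => yy_cont hρ0 _ ht)
    filter_upwards [hcc.eventually_lt_const hb, lt_mem_nhds ht] with s hs hs0 k
    exact (hyb s hs0 k).trans hs.le
  have hAcont : ∀ t, 0 < t → ContinuousAt (fun t => BB v φ (fun k => lam k * yy ρ (lam k) t)) t := by
    intro t ht
    have hb : ρ / t < ρ / t + 1 := by linarith
    have hcc : ContinuousAt (fun s : ℝ => ρ / s) t :=
      continuousAt_const.div continuousAt_id ht.ne'
    refine BB_tendsto v φ (C := ρ / t + 1) ?_
      (fun k => (hlyb t ht k).trans hb.le) (fun k => (yy_cont hρ0 _ ht).const_mul _)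
    filter_upwards [hcc.eventually_lt_const hb, lt_mem_nhds ht] with s hs hs0 k
    exact (hlyb s hs0 k).trans hs.le
  -- the fractional integral
  have hG : 0 < Real.Gamma (1 - ρ) := Real.Gamma_pos_of_pos (by linarith)
  have hint : ∀ t, 0 < t → rlIntegral (1 - ρ) u t = BB v φ (fun k => ww ρ (lam k) t) := by
    intro t ht
    have hi : IntervalIntegrable (fun ξ => (t - ξ) ^ (1 - ρ - 1) • u ξ) volume 0 t := by
      have hd := (beta_int_integrable hρ0 (by linarith : 0 < 1 - ρ) ht).const_mul (C * ‖φ‖)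
      refine hd.mono_fun ?_ ?_
      · rw [Set.uIoc_of_le ht.le]
        refine AEStronglyMeasurable.smul ?_ ?_
        · exact (by fun_prop : Measurable fun ξ : ℝ => (t - ξ) ^ (1 - ρ - 1)).aestronglyMeasurable
        · refine ContinuousOn.aestronglyMeasurable ?_ measurableSet_Ioc
          exact fun ξ hξ => (hucont ξ hξ.1).continuousWithinAt
      · rw [Set.uIoc_of_le ht.le]
        filter_upwards [ae_restrict_mem measurableSet_Ioc] with ξ hξ
        have p1 : 0 ≤ t - ξ := by linarith [hξ.2]
        have p2 : 0 < ξ := hξ.1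
        have h1 := BB_norm_le v φ (hyb ξ hξ.1)
        rw [← huB] at h1
        rw [norm_smul, Real.norm_of_nonneg (by positivity), Real.norm_of_nonneg (by positivity)]
        calc _ ≤ (t - ξ) ^ (1 - ρ - 1) * (C * ξ ^ (ρ - 1) * ‖φ‖) := by gcongr
          _ = _ := by ring
    apply ext_basis v
    intro k
    rw [(BB_aux v φ (hwb t ht)).2, rlIntegral, real_inner_smul_left, real_inner_comm,
      ← innerSL_apply_apply ℝ, ← ContinuousLinearMap.intervalIntegral_comp_comm _ hi]
    have e : ∫ ξ in (0:ℝ)..t, (innerSL ℝ (v k)) ((t - ξ) ^ (1 - ρ - 1) • u ξ)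
        = ∫ ξ in (0:ℝ)..t, ((t - ξ) ^ (1 - ρ - 1) * yy ρ (lam k) ξ) * ⟪φ, v k⟫ := by
      rw [intervalIntegral.integral_of_le ht.le, intervalIntegral.integral_of_le ht.le]
      apply setIntegral_congr_fun measurableSet_Ioc
      intro ξ hξ
      simp only
      rw [innerSL_apply_apply, real_inner_comm, real_inner_smul_left, huk ξ hξ.1, mul_assoc]
    rw [e, intervalIntegral.integral_mul_const, ww_int hρ0 hρ1 _ ht]
    field_simp
  have hder : ∀ t, 0 < t →
      rlDeriv ρ u t = - BB v φ (fun k => lam k * yy ρ (lam k) t) := by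
    intro t ht
    have h1 : HasDerivAt (fun s => BB v φ (fun k => ww ρ (lam k) s))
        (BB v φ (fun k => -(lam k * yy ρ (lam k) t))) t := by
      have hs : ∀ s ∈ Metric.ball t (t / 2), t / 2 < s := by
        intro s hs
        rw [Metric.mem_ball, Real.dist_eq, abs_lt] at hs
        linarith [hs.1]
      have hs0 : ∀ s ∈ Metric.ball t (t / 2), 0 < s := fun s h => by linarith [hs s h]
      refine BB_hasDerivAt v φ (w := fun s k => ww ρ (lam k) s)
        (w' := fun s k => -(lam k * yy ρ (lam k) s)) (C := ρ / (t / 2)) (D := 1) (δ := t / 2)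
        (by linarith) (fun s h => hwb s (hs0 s h)) (fun s h k => ww_deriv hρ0 _ (hs0 s h)) ?_
      intro s h k
      rw [abs_neg]
      have := (hs s h).le
      exact (hlyb s (hs0 s h) k).trans (by gcongr)
    have h2 : rlIntegral (1 - ρ) u =ᶠ[nhds t] fun s => BB v φ (fun k => ww ρ (lam k) s) := by
      filter_upwards [lt_mem_nhds ht] with s hs
      exact hint s hs
    rw [rlDeriv, h2.deriv_eq, h1.deriv]
    have := BB_smul v φ (a := fun k => lam k * yy ρ (lam k) t) (-1)
    simpa using this
  refine ⟨?_, ?_, ?_, ?_, ?_, ?_⟩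
  · intro t ht
    exact (BB_aux v φ (hyb t ht.1)).1.summable
  · intro t ht
    have := summable_sq v (Aop (u t))
    refine this.congr fun k => ?_
    rw [hAu t ht.1, (BB_aux v φ (hlyb t ht.1)).2, huk t ht.1]; ring
  · intro t ht
    refine ((hAcont t ht.1).continuousWithinAt).congr (fun s hs => hAu s hs.1) (hAu t ht.1)
  · intro t ht
    refine ((hAcont t ht.1).neg.continuousWithinAt).congr (fun s hs => hder s hs.1) (hder t ht.1)
  · intro t ht
    rw [hder t ht.1, hAu t ht.1, neg_add_cancel]
  · have h1 : Tendsto (fun t => BB v φ (fun k => ww ρ (lam k) t)) (nhdsWithin 0 (Set.Ioi 0))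
        (nhds (BB v φ (fun _ => 1))) := by
      refine BB_tendsto v φ (C := 1) ?_ (by simp) (fun k => ww_zero hρ0 _)
      filter_upwards [self_mem_nhdsWithin] with t ht
      exact hwb t ht
    rw [BB_one] at h1
    refine h1.congr' ?_
    filter_upwards [self_mem_nhdsWithin] with t ht
    exact (hint t ht).symm
end

section
/- For every ρ_0 ∈ (0,1) and every λ_1 > 0 there exists T_0 = T_0(ρ_0, λ_1) > 0 such that for all t_0 ≥ T_0 and all λ ≥ λ_1, the function e_λ(ρ) = t_0^{ρ-1} E_{ρ,ρ}(-λ t_0^ρ) is strictly positive for every ρ ∈ [ρ_0, 1] and strictly decreasing as a function of ρ on [ρ_0, 1]. -/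
open Complex MeasureTheory Set Filter Topology

namespace ML4

lemma norm_exp_line (a y : ℝ) : ‖cexp (((a:ℂ) + y * I) ^ 2)‖ = Real.exp (a ^ 2 - y ^ 2) := by
  rw [Complex.norm_exp]
  congr 1
  simp [pow_two]

lemma line_re (a y : ℝ) : ((a:ℂ) + y * I).re = a := by simp

lemma line_ne (a y : ℝ) (ha : 0 < a) : ((a:ℂ) + y * I) ≠ 0 := by
  intro h
  have := congrArg Complex.re h
  simp at this
  linarith

lemma line_slit (a y : ℝ) (ha : 0 < a) : ((a:ℂ) + y * I) ∈ slitPlane := by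
  left; simpa using ha

lemma line_norm_ge (a y : ℝ) : a ≤ ‖(a:ℂ) + y * I‖ := by
  have := Complex.re_le_norm ((a:ℂ) + y * I)
  simpa using this

lemma line_norm_le (a y : ℝ) (ha : 0 < a) : ‖(a:ℂ) + y * I‖ ≤ a + |y| := by
  refine (norm_add_le _ _).trans ?_
  simp [abs_of_pos ha]

lemma continuous_line (a : ℝ) : Continuous (fun y : ℝ => (a:ℂ) + y * I) := by fun_prop

lemma integrable_base (a : ℝ) (ha : 0 < a) (n : ℕ) :
    Integrable (fun y : ℝ => ‖(a:ℂ) + y * I‖ ^ n * Real.exp (a ^ 2 - y ^ 2)) := by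
  have h1 : Integrable (fun y : ℝ => |y| ^ n * Real.exp (- 1 * y ^ 2)) := by
    have := (integrable_rpow_mul_exp_neg_mul_sq (b := 1) one_pos (s := n)
      (by have : (0:ℝ) ≤ n := n.cast_nonneg
          linarith)).norm
    refine this.congr (ae_of_all _ fun y => ?_)
    simp
  have h2 : Integrable (fun y : ℝ => Real.exp (- 1 * y ^ 2)) := integrable_exp_neg_mul_sq one_pos
  have h3 := ((h2.const_mul (a ^ n)).add h1).const_mul (2 ^ (n - 1) * Real.exp (a ^ 2))
  refine h3.mono' (by fun_prop) (ae_of_all _ fun y => ?_)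
  rw [Real.norm_of_nonneg (by positivity)]
  have e : Real.exp (a ^ 2 - y ^ 2) = Real.exp (a ^ 2) * Real.exp (- 1 * y ^ 2) := by
    rw [← Real.exp_add]; congr 1; ring
  have h4 : ‖(a:ℂ) + y * I‖ ^ n ≤ 2 ^ (n - 1) * (a ^ n + |y| ^ n) :=
    (pow_le_pow_left₀ (norm_nonneg _) (line_norm_le a y ha) n).trans
      (add_pow_le ha.le (abs_nonneg _) n)
  calc _ ≤ (2 ^ (n - 1) * (a ^ n + |y| ^ n)) * Real.exp (a ^ 2 - y ^ 2) := by gcongr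
    _ = _ := by rw [e]; simp only [Pi.add_apply]; ring

lemma integrable_line (a : ℝ) (ha : 0 < a) (n : ℕ) (C : ℝ) (f : ℝ → ℂ) (hf : Continuous f)
    (hb : ∀ y, ‖f y‖ ≤ C * ‖(a:ℂ) + y * I‖ ^ n) :
    Integrable (fun y : ℝ => cexp (((a:ℂ) + y * I) ^ 2) * f y) := by
  refine ((integrable_base a ha n).const_mul C).mono' (by fun_prop) (ae_of_all _ fun y => ?_)
  rw [norm_mul, norm_exp_line]
  calc _ ≤ Real.exp (a ^ 2 - y ^ 2) * (C * ‖(a:ℂ) + y * I‖ ^ n) := by gcongr; exact hb y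
    _ = _ := by ring

lemma norm_cpow_line (a y c : ℝ) (ha : 0 < a) :
    ‖((a:ℂ) + y * I) ^ (c:ℂ)‖ = ‖(a:ℂ) + y * I‖ ^ c := by
  simp

lemma continuous_cpow_line (a c : ℝ) (ha : 0 < a) :
    Continuous (fun y : ℝ => ((a:ℂ) + y * I) ^ (c:ℂ)) := by
  refine continuous_iff_continuousAt.2 fun y => ?_
  exact (continuous_line a).continuousAt.cpow continuousAt_const (line_slit a y ha)

/-- Gaussian line integrals of powers. -/
lemma integrable_J (a c : ℝ) (ha : 0 < a) :
    Integrable (fun y : ℝ => cexp (((a:ℂ) + y * I) ^ 2) * ((a:ℂ) + y * I) ^ (c:ℂ)) := by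
  obtain ⟨n, hn⟩ := exists_nat_ge c
  refine integrable_line a ha n (a ^ (c - n)) _ (continuous_cpow_line a c ha) fun y => ?_
  rw [norm_cpow_line a y c ha]
  have hp : 0 < ‖(a:ℂ) + y * I‖ := lt_of_lt_of_le ha (line_norm_ge a y)
  have : ‖(a:ℂ) + y * I‖ ^ c = ‖(a:ℂ) + y * I‖ ^ (c - n) * ‖(a:ℂ) + y * I‖ ^ n := by
    rw [← Real.rpow_natCast, ← Real.rpow_add hp]; congr 1; ring
  rw [this]
  gcongr ?_ * _
  exact Real.rpow_le_rpow_of_nonpos ha (line_norm_ge a y) (by linarith)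

lemma integrable_gamma (c r : ℝ) (hc : -1 < c) (hr : 0 < r) :
    IntegrableOn (fun u : ℝ => u ^ c * Real.exp (-r * u)) (Ioi 0) := by
  simpa using integrableOn_rpow_mul_exp_neg_mul_rpow (p := 1) hc one_pos hr

lemma cpow_gamma (b : ℝ) (hb : 0 < b) (w : ℂ) (hw : 0 < w.re) :
    ∫ u in Ioi (0:ℝ), ((u ^ (b - 1) : ℝ) : ℂ) * cexp (-(u * w)) = Real.Gamma b * w ^ (-b:ℂ) := by
  let U : Set ℂ := {z | 0 < z.re}
  have hU : IsOpen U := isOpen_lt continuous_const Complex.continuous_re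
  have hUc : IsPreconnected U := (convex_halfSpace_re_gt 0).isPreconnected
  let F : ℂ → ℂ := fun w => ∫ u in Ioi (0:ℝ), ((u ^ (b - 1) : ℝ) : ℂ) * cexp (-(u * w))
  have hmeas : ∀ c : ℝ, ∀ w : ℂ, AEStronglyMeasurable
      (fun u : ℝ => ((u ^ c : ℝ) : ℂ) * cexp (-(u * w))) (volume.restrict (Ioi 0)) := by
    intro c w
    apply Measurable.aestronglyMeasurable
    fun_prop
  have hnorm : ∀ (c : ℝ) (w : ℂ) (u : ℝ), 0 < u →
      ‖((u ^ c : ℝ) : ℂ) * cexp (-(u * w))‖ = u ^ c * Real.exp (-w.re * u) := by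
    intro c w u hu
    rw [norm_mul, Complex.norm_exp, Complex.norm_real, Real.norm_of_nonneg (by positivity)]
    congr 2
    simp; ring
  have hF : DifferentiableOn ℂ F U := by
    intro w hw
    have hw' : 0 < w.re := hw
    apply DifferentiableAt.differentiableWithinAt
    have key := hasDerivAt_integral_of_dominated_loc_of_deriv_le
      (μ := volume.restrict (Ioi (0:ℝ))) (x₀ := w) (s := {z : ℂ | w.re / 2 < z.re})
      (F := fun w (u : ℝ) => ((u ^ (b - 1) : ℝ) : ℂ) * cexp (-(u * w)))
      (F' := fun w (u : ℝ) => ((u ^ (b - 1) : ℝ) : ℂ) * (cexp (-(u * w)) * (-u)))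
      (bound := fun u : ℝ => u ^ b * Real.exp (- (w.re / 2) * u))
      ((isOpen_lt continuous_const Complex.continuous_re).mem_nhds
        (by change w.re / 2 < w.re; linarith))
      (Eventually.of_forall fun w => hmeas _ w) ?_ ?_ ?_ ?_ ?_
    · exact key.2.differentiableAt
    · refine (integrable_gamma (b - 1) w.re (by linarith) hw').mono' (hmeas _ w) ?_
      refine (ae_restrict_mem measurableSet_Ioi).mono fun u hu => ?_
      rw [hnorm _ _ _ hu]
    · apply Measurable.aestronglyMeasurable
      fun_prop
    · refine (ae_restrict_mem measurableSet_Ioi).mono fun u hu z hz => ?_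
      have hu' : 0 < u := hu
      rw [← mul_assoc, norm_mul, hnorm _ _ _ hu]
      have : u ^ b = u ^ (b - 1) * u := by
        rw [← Real.rpow_add_one hu'.ne']; congr 1; ring
      rw [this]
      have h2 : Real.exp (-z.re * u) ≤ Real.exp (-(w.re / 2) * u) := by
        apply Real.exp_le_exp.2
        have hz' : w.re / 2 < z.re := hz
        nlinarith
      have h3 : ‖(-u : ℂ)‖ = u := by simp [abs_of_pos hu']
      rw [h3]
      calc _ ≤ u ^ (b - 1) * Real.exp (-(w.re / 2) * u) * u := by gcongr
        _ = _ := by ring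
    · exact integrable_gamma b _ (by linarith) (by linarith)
    · refine ae_of_all _ fun u z _ => ?_
      refine HasDerivAt.const_mul _ ?_
      refine HasDerivAt.cexp ?_
      simpa using ((hasDerivAt_id z).const_mul (u:ℂ)).fun_neg
  have hG : DifferentiableOn ℂ (fun w : ℂ => (Real.Gamma b : ℂ) * w ^ (-b:ℂ)) U := by
    intro w hw
    apply DifferentiableAt.differentiableWithinAt
    exact (DifferentiableAt.cpow differentiableAt_id (by fun_prop) (Or.inl hw)).const_mul _
  have hreal : ∀ r : ℝ, 0 < r → F r = (Real.Gamma b : ℂ) * (r:ℂ) ^ (-b:ℂ) := by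
    intro r hr
    have := integral_cpow_mul_exp_neg_mul_Ioi (a := b) (r := r) (by simpa using hb) hr
    rw [Complex.Gamma_ofReal, one_div, inv_cpow _ _ (by
      rw [Complex.arg_ofReal_of_nonneg hr.le]; exact Real.pi_pos.ne), ← cpow_neg, mul_comm] at this
    rw [← this]
    refine setIntegral_congr_fun measurableSet_Ioi fun u hu => ?_
    have hu' : (0:ℝ) < u := hu
    rw [Complex.ofReal_cpow hu'.le]
    push_cast
    rw [mul_comm (u:ℂ) r]
  have heq : EqOn F (fun w : ℂ => (Real.Gamma b : ℂ) * w ^ (-b:ℂ)) U := by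
    refine (hF.analyticOnNhd hU).eqOn_of_preconnected_of_frequently_eq (hG.analyticOnNhd hU) hUc
      (z₀ := 1) (by simp [U]) ?_
    have hT : Tendsto (fun n : ℕ => ((1 + 1 / ((n:ℝ) + 1) : ℝ) : ℂ)) atTop (𝓝[≠] 1) := by
      refine tendsto_nhdsWithin_iff.2 ⟨?_, Eventually.of_forall fun n => ?_⟩
      · have := (tendsto_one_div_add_atTop_nhds_zero_nat (𝕜 := ℝ)).const_add 1
        rw [add_zero] at this
        exact (Complex.continuous_ofReal.tendsto 1).comp this
      · have : (0:ℝ) < 1 / ((n:ℝ) + 1) := by positivity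
        simp only [mem_compl_iff, mem_singleton_iff]
        intro h
        have h' : (1 + 1 / ((n:ℝ) + 1) : ℝ) = 1 := by exact_mod_cast h
        linarith
    refine hT.frequently (Frequently.of_forall fun n => ?_)
    exact hreal _ (by positivity)
  exact heq hw

end ML4

namespace ML4

/-- `∫ e^{w²} w^c dy` over the line `w = a + i y`. -/
noncomputable def J (a c : ℝ) : ℂ :=
  ∫ y : ℝ, cexp (((a:ℂ) + y * I) ^ 2) * ((a:ℂ) + y * I) ^ (c:ℂ)

lemma gauss_line (a u : ℝ) :
    ∫ y : ℝ, cexp (((a:ℂ) + y * I) ^ 2) * cexp (-(u * ((a:ℂ) + y * I)))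
      = ((√Real.pi * Real.exp (-(1/4) * u ^ 2) : ℝ) : ℂ) := by
  have := integral_cexp_quadratic (b := -1) (by simp) ((2 * a - u) * I) (a ^ 2 - u * a)
  calc _ = ∫ y : ℝ, cexp (-1 * y ^ 2 + (2 * a - u) * I * y + (a ^ 2 - u * a)) := by
        congr 1; ext y
        rw [← Complex.exp_add]; congr 1
        ring_nf
        rw [I_sq]; ring
    _ = _ := by
        rw [this]
        have h1 : ((Real.pi : ℂ) / - -1) ^ (1 / 2 : ℂ) = ((√Real.pi : ℝ) : ℂ) := by
          rw [Real.sqrt_eq_rpow, Complex.ofReal_cpow Real.pi_pos.le]; simp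
        rw [h1]
        push_cast
        congr 2
        rw [mul_pow, I_sq]; ring

lemma J_neg (a b : ℝ) (ha : 0 < a) (hb : 0 < b) :
    J a (-b) = Real.pi * (Real.Gamma ((1 + b) / 2) : ℂ)⁻¹ := by
  have hGb : (Real.Gamma b : ℂ) ≠ 0 := by
    exact_mod_cast (Real.Gamma_pos_of_pos hb).ne'
  have h1 : (Real.Gamma b : ℂ) * J a (-b) = ∫ y : ℝ, ∫ u in Ioi (0:ℝ),
      cexp (((a:ℂ) + y * I) ^ 2) *
        (((u ^ (b - 1) : ℝ) : ℂ) * cexp (-(u * ((a:ℂ) + y * I)))) := by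
    rw [J, ← integral_const_mul]
    congr 1; ext y
    rw [integral_const_mul, cpow_gamma b hb _ (by simpa using ha)]
    push_cast
    ring
  have h2 : ∫ y : ℝ, ∫ u in Ioi (0:ℝ), cexp (((a:ℂ) + y * I) ^ 2) *
        (((u ^ (b - 1) : ℝ) : ℂ) * cexp (-(u * ((a:ℂ) + y * I))))
      = ∫ u in Ioi (0:ℝ), ∫ y : ℝ, cexp (((a:ℂ) + y * I) ^ 2) *
        (((u ^ (b - 1) : ℝ) : ℂ) * cexp (-(u * ((a:ℂ) + y * I)))) := by
    apply integral_integral_swap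
    have hp := (integrable_base a ha 0).mul_prod
      (integrable_gamma (b - 1) a (by linarith) ha)
    refine hp.mono' ?_ ?_
    · apply Measurable.aestronglyMeasurable
      unfold Function.uncurry
      fun_prop
    · have : ∀ᵐ z : ℝ × ℝ ∂(volume.prod (volume.restrict (Ioi (0:ℝ)))), z.2 ∈ Ioi (0:ℝ) :=
        Measure.quasiMeasurePreserving_snd.ae (ae_restrict_mem measurableSet_Ioi)
      refine this.mono fun z hz => ?_
      have hz' : 0 < z.2 := hz
      simp only [Function.uncurry]
      rw [norm_mul, norm_mul, norm_exp_line, Complex.norm_exp, Complex.norm_real,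
        Real.norm_of_nonneg (by positivity)]
      apply le_of_eq
      simp
      exact Or.inl (mul_comm _ _)
  have h3 : ∫ u in Ioi (0:ℝ), ∫ y : ℝ, cexp (((a:ℂ) + y * I) ^ 2) *
        (((u ^ (b - 1) : ℝ) : ℂ) * cexp (-(u * ((a:ℂ) + y * I))))
      = ((√Real.pi * ∫ u in Ioi (0:ℝ), u ^ (b - 1) * Real.exp (-(1/4) * u ^ (2:ℝ)) : ℝ) : ℂ) := by
    rw [← integral_const_mul, ← integral_complex_ofReal]
    congr 1; ext u
    have : ∀ y : ℝ, cexp (((a:ℂ) + y * I) ^ 2) *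
        (((u ^ (b - 1) : ℝ) : ℂ) * cexp (-(u * ((a:ℂ) + y * I)))) =
        ((u ^ (b - 1) : ℝ) : ℂ) * (cexp (((a:ℂ) + y * I) ^ 2) *
          cexp (-(u * ((a:ℂ) + y * I)))) := fun y => by ring
    simp_rw [this]
    rw [integral_const_mul, gauss_line, Real.rpow_two]
    push_cast
    ring
  have h4 := integral_rpow_mul_exp_neg_mul_rpow (p := 2) (q := b - 1) (b := 1/4) two_pos
    (by linarith) (by norm_num)
  have h5 := Real.Gamma_mul_Gamma_add_half (b / 2)
  have h6 : 0 < Real.Gamma ((1 + b) / 2) := Real.Gamma_pos_of_pos (by linarith)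
  rw [h4] at h3
  rw [h3] at h2
  rw [h2] at h1
  have h7 : √Real.pi * ((1/4:ℝ) ^ (-(b - 1 + 1) / 2) * (1 / 2) * Real.Gamma ((b - 1 + 1) / 2))
      = Real.Gamma b * (Real.pi * (Real.Gamma ((1 + b) / 2))⁻¹) := by
    have e1 : (1/4:ℝ) ^ (-(b - 1 + 1) / 2) = 2 ^ b := by
      rw [show (1/4:ℝ) = 2 ^ (-2:ℝ) by norm_num [Real.rpow_neg], ← Real.rpow_mul (by norm_num)]
      congr 1; ring
    rw [e1]
    have e2 : b / 2 + 1 / 2 = (1 + b) / 2 := by ring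
    have e3 : 2 * (b / 2) = b := by ring
    rw [e2, e3, Real.rpow_sub two_pos, Real.rpow_one] at h5
    rw [show (b - 1 + 1) / 2 = b / 2 by ring]
    have h2b : (0:ℝ) < 2 ^ b := by positivity
    have hs : √Real.pi * √Real.pi = Real.pi := Real.mul_self_sqrt Real.pi_pos.le
    have h8 : Real.Gamma (b / 2) = Real.Gamma b * (2 / 2 ^ b) * √Real.pi
        / Real.Gamma ((1 + b) / 2) := by
      rw [eq_div_iff h6.ne', h5]
    rw [h8]
    field_simp
    nlinarith [hs]
  rw [h7] at h1
  apply mul_left_cancel₀ hGb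
  rw [h1]
  push_cast
  ring

lemma J_rec (a c : ℝ) (ha : 0 < a) : J a (c + 1) = -(c / 2) * J a (c - 1) := by
  have hd : ∀ y : ℝ, HasDerivAt
      (fun y : ℝ => cexp (((a:ℂ) + y * I) ^ 2) * ((a:ℂ) + y * I) ^ (c:ℂ))
      (2 * I * (cexp (((a:ℂ) + y * I) ^ 2) * ((a:ℂ) + y * I) ^ ((c + 1 : ℝ):ℂ)) +
        c * I * (cexp (((a:ℂ) + y * I) ^ 2) * ((a:ℂ) + y * I) ^ ((c - 1 : ℝ):ℂ))) y := by
    intro y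
    have hl : HasDerivAt (fun y : ℝ => (a:ℂ) + y * I) I y := by
      simpa using ((Complex.ofRealCLM.hasDerivAt (x := y)).mul_const I).const_add (a:ℂ)
    have hg : HasDerivAt (fun w : ℂ => cexp (w ^ 2) * w ^ (c:ℂ))
        (cexp (((a:ℂ) + y * I) ^ 2) * (2 * ((a:ℂ) + y * I)) * ((a:ℂ) + y * I) ^ (c:ℂ) +
          cexp (((a:ℂ) + y * I) ^ 2) * (c * ((a:ℂ) + y * I) ^ ((c:ℂ) - 1))) ((a:ℂ) + y * I) := by
      refine HasDerivAt.mul (HasDerivAt.cexp ?_) ?_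
      · simpa using (hasDerivAt_id ((a:ℂ) + y * I)).fun_pow 2
      · simpa using (hasDerivAt_id ((a:ℂ) + y * I)).cpow_const (c := (c:ℂ)) (line_slit a y ha)
    have := hg.comp y hl
    refine this.congr_deriv ?_
    push_cast
    rw [cpow_add _ _ (line_ne a y ha), cpow_one]
    ring
  have hi1 := (integrable_J a (c + 1) ha).const_mul (2 * I)
  have hi2 := (integrable_J a (c - 1) ha).const_mul (c * I)
  have := integral_eq_zero_of_hasDerivAt_of_integrable hd (hi1.add hi2) (integrable_J a c ha)
  rw [integral_add hi1 hi2, integral_const_mul, integral_const_mul] at this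
  change 2 * I * J a (c + 1) + c * I * J a (c - 1) = 0 at this
  have h2 : (2 * I) * (J a (c + 1) + (c / 2) * J a (c - 1)) = 0 := by
    rw [← this]; ring
  have h3 := (mul_eq_zero.1 h2).resolve_left (by simp)
  linear_combination h3

lemma J_eq_aux (a : ℝ) (ha : 0 < a) (n : ℕ) : ∀ c : ℝ, c < 2 * n →
    J a c = Real.pi * (Complex.Gamma (((1 - c) / 2 : ℝ) : ℂ))⁻¹ := by
  induction n with
  | zero =>
    intro c hc
    have := J_neg a (-c) ha (by simpa using hc)
    rw [neg_neg] at this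
    rw [this, Complex.Gamma_ofReal]
    rfl
  | succ n ih =>
    intro c hc
    push_cast at hc
    have h1 := J_rec a (c - 1) ha
    have h2 := ih (c - 1 - 1) (by linarith)
    rw [sub_add_cancel, h2] at h1
    rw [h1, Complex.one_div_Gamma_eq_self_mul_one_div_Gamma_add_one (((1 - c) / 2 : ℝ) : ℂ)]
    rw [show (((1 - (c - 1 - 1)) / 2 : ℝ) : ℂ) = (((1 - c) / 2 : ℝ) : ℂ) + 1 by push_cast; ring]
    push_cast
    ring

lemma J_eq (a c : ℝ) (ha : 0 < a) :
    J a c = Real.pi * (Complex.Gamma (((1 - c) / 2 : ℝ) : ℂ))⁻¹ := by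
  obtain ⟨n, hn⟩ := exists_nat_gt c
  exact J_eq_aux a ha n c (by have : (0:ℝ) ≤ n := n.cast_nonneg
                              linarith)

end ML4

namespace ML4

lemma den_lower (w : ℂ) (hw : 0 < w.re) (ρ : ℝ) (h0 : 0 < ρ) (h1 : ρ ≤ 1) (s x : ℝ)
    (hs : 0 < s) (hx : 0 < x) :
    (w.re / ‖w‖) * (s * ‖w‖ ^ (2 * ρ) + x) ≤ ‖(s:ℂ) * w ^ ((2 * ρ : ℝ) : ℂ) + x‖ := by
  have hw0 : w ≠ 0 := by rintro rfl; simp at hw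
  have hn : 0 < ‖w‖ := norm_pos_iff.2 hw0
  set φ := arg w with hφ
  have hφ2 : |φ| < Real.pi / 2 := abs_arg_lt_pi_div_two_iff.2 (Or.inl hw)
  have hcos : w.re / ‖w‖ = Real.cos φ := (Complex.cos_arg hw0).symm
  have hκ : Real.cos φ ≤ Real.cos (ρ * φ) := by
    rw [← Real.cos_abs φ, ← Real.cos_abs (ρ * φ)]
    apply Real.cos_le_cos_of_nonneg_of_le_pi (abs_nonneg _)
    · linarith [Real.pi_pos]
    · rw [abs_mul, abs_of_pos h0]
      nlinarith [abs_nonneg φ]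
  have hκ0 : 0 < Real.cos φ := by rw [← hcos]; positivity
  set κ := Real.cos (ρ * φ) with hκdef
  have hκ1 : κ ≤ 1 := Real.cos_le_one _
  set m := s * ‖w‖ ^ (2 * ρ) with hm
  have hm0 : 0 < m := by positivity
  have hz : (s:ℂ) * w ^ ((2 * ρ : ℝ) : ℂ) = m * (Real.cos (2 * (ρ * φ)) + Real.sin (2 * (ρ * φ)) * I) := by
    rw [hm]
    push_cast
    rw [← Complex.exp_mul_I]
    rw [cpow_def_of_ne_zero hw0, Complex.ofReal_cpow hn.le, 
      cpow_def_of_ne_zero (by exact_mod_cast hn.ne'), mul_assoc, ← Complex.exp_add]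
    congr 2
    rw [Complex.log, ← Complex.ofReal_log hn.le, ← hφ]
    push_cast
    ring
  rw [hcos, hz]
  have hsq : ‖(m:ℂ) * (Real.cos (2 * (ρ * φ)) + Real.sin (2 * (ρ * φ)) * I) + x‖ ^ 2
      = m ^ 2 + 2 * x * m * (2 * κ ^ 2 - 1) + x ^ 2 := by
    rw [← Complex.normSq_eq_norm_sq, Complex.normSq_apply]
    have hc2 : Real.cos (2 * (ρ * φ)) = 2 * κ ^ 2 - 1 := Real.cos_two_mul _
    have hsc := Real.sin_sq_add_cos_sq (2 * (ρ * φ))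
    simp only [add_re, mul_re, ofReal_re, ofReal_im, add_im, mul_im, I_re, I_im]
    rw [← hc2]
    linear_combination m ^ 2 * hsc
  have h3 : (κ * (m + x)) ^ 2 ≤
      ‖(m:ℂ) * (Real.cos (2 * (ρ * φ)) + Real.sin (2 * (ρ * φ)) * I) + x‖ ^ 2 := by
    rw [hsq]
    have : 0 ≤ (1 - κ ^ 2) * (m - x) ^ 2 := by
      apply mul_nonneg _ (sq_nonneg _)
      nlinarith
    nlinarith
  calc Real.cos φ * (m + x) ≤ κ * (m + x) := by gcongr
    _ ≤ _ := le_of_sq_le_sq h3 (norm_nonneg _)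
  
lemma den_lower' (w : ℂ) (hw : 1 ≤ w.re) (ρ : ℝ) (h0 : 0 < ρ) (h1 : ρ ≤ 1) (s x : ℝ)
    (hs : 0 < s) (hx : 0 < x) :
    s * ‖w‖ ^ (2 * ρ) + x ≤ ‖w‖ * ‖(s:ℂ) * w ^ ((2 * ρ : ℝ) : ℂ) + x‖ := by
  have := den_lower w (by linarith) ρ h0 h1 s x hs hx
  have hn : 0 < ‖w‖ := by linarith [Complex.re_le_norm w]
  have hm0 : 0 < s * ‖w‖ ^ (2 * ρ) := by positivity
  rw [div_mul_eq_mul_div, div_le_iff₀ hn] at this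
  nlinarith

lemma den_ne (w : ℂ) (hw : 0 < w.re) (ρ : ℝ) (h0 : 0 < ρ) (h1 : ρ ≤ 1) (s x : ℝ)
    (hs : 0 < s) (hx : 0 < x) : (s:ℂ) * w ^ ((2 * ρ : ℝ) : ℂ) + x ≠ 0 := by
  have := den_lower w hw ρ h0 h1 s x hs hx
  have hn : 0 < ‖w‖ := by linarith [Complex.re_le_norm w]
  have h2 : 0 < (w.re / ‖w‖) * (s * ‖w‖ ^ (2 * ρ) + x) := by positivity
  exact norm_pos_iff.1 (lt_of_lt_of_le h2 this)

noncomputable def g (ρ x : ℝ) (w : ℂ) : ℂ := cexp (w ^ 2) * (w / (w ^ ((2 * ρ : ℝ) : ℂ) + x))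

lemma g_norm (ρ x : ℝ) (h0 : 0 < ρ) (h1 : ρ ≤ 1) (hx : 0 < x) (w : ℂ) (hw : 1 ≤ w.re) :
    ‖w / (w ^ ((2 * ρ : ℝ) : ℂ) + x)‖ ≤ x⁻¹ * ‖w‖ ^ 2 := by
  have h := den_lower' w hw ρ h0 h1 1 x one_pos hx
  have hne := den_ne w (by linarith) ρ h0 h1 1 x one_pos hx
  simp only [ofReal_one, one_mul] at h hne
  have hp : 0 < ‖w ^ ((2 * ρ : ℝ) : ℂ) + x‖ := norm_pos_iff.2 hne
  have hn : 0 < ‖w‖ := by linarith [Complex.re_le_norm w]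
  have hm : 0 < ‖w‖ ^ (2 * ρ) := by positivity
  rw [norm_div, div_le_iff₀ hp]
  have : x⁻¹ * ‖w‖ ^ 2 * ‖w ^ ((2 * ρ : ℝ) : ℂ) + x‖
      = ‖w‖ * (x⁻¹ * (‖w‖ * ‖w ^ ((2 * ρ : ℝ) : ℂ) + x‖)) := by ring
  rw [this]
  have h2 : 1 ≤ x⁻¹ * (‖w‖ * ‖w ^ ((2 * ρ : ℝ) : ℂ) + x‖) := by
    rw [inv_mul_eq_div, le_div_iff₀ hx]; linarith
  nlinarith

lemma g_diff (ρ x : ℝ) (h0 : 0 < ρ) (h1 : ρ ≤ 1) (hx : 0 < x) (w : ℂ) (hw : 0 < w.re) :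
    DifferentiableAt ℂ (g ρ x) w := by
  have hne := den_ne w hw ρ h0 h1 1 x one_pos hx
  simp only [ofReal_one, one_mul] at hne
  unfold g
  refine DifferentiableAt.mul (by fun_prop) (DifferentiableAt.div (by fun_prop) ?_ hne)
  refine DifferentiableAt.add_const _ ?_
  exact DifferentiableAt.cpow differentiableAt_id (by fun_prop) (Or.inl hw)

lemma g_integrable (ρ x a : ℝ) (h0 : 0 < ρ) (h1 : ρ ≤ 1) (hx : 0 < x) (ha : 1 ≤ a) :
    Integrable (fun y : ℝ => g ρ x ((a:ℂ) + y * I)) := by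
  refine integrable_line a (by linarith) 2 x⁻¹ _ ?_ fun y => ?_
  · refine (continuous_line a).div
      ((continuous_cpow_line a (2 * ρ) (by linarith)).add continuous_const) fun y => ?_
    have := den_ne ((a:ℂ) + y * I) (by simp; linarith) ρ h0 h1 1 x one_pos hx
    simpa using this
  · exact g_norm ρ x h0 h1 hx _ (by simpa using ha)

lemma shift (ρ x a : ℝ) (h0 : 0 < ρ) (h1 : ρ ≤ 1) (hx : 0 < x) (ha : 1 ≤ a) :
    ∫ y : ℝ, g ρ x ((a:ℂ) + y * I) = ∫ y : ℝ, g ρ x (((1:ℝ):ℂ) + y * I) := by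
  have hb : ∀ T : ℝ, ∀ u ∈ Icc 1 a,
      ‖g ρ x ((u:ℂ) + T * I)‖ ≤ Real.exp (a ^ 2 - T ^ 2) * (x⁻¹ * (a + |T|) ^ 2) := by
    intro T u hu
    unfold g
    rw [norm_mul, norm_exp_line]
    have h2 := g_norm ρ x h0 h1 hx ((u:ℂ) + T * I) (by simpa using hu.1)
    have h3 := line_norm_le u T (by linarith [hu.1])
    have h4 : ‖(u:ℂ) + T * I‖ ≤ a + |T| := by linarith [hu.2]
    have h5 : u ^ 2 ≤ a ^ 2 := by nlinarith [hu.1, hu.2]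
    calc _ ≤ Real.exp (u ^ 2 - T ^ 2) * (x⁻¹ * ‖(u:ℂ) + T * I‖ ^ 2) := by gcongr
      _ ≤ _ := by gcongr
  have hrect : ∀ T : ℝ, 
      I • (∫ y : ℝ in (-T)..T, g ρ x ((a:ℂ) + y * I)) -
        I • (∫ y : ℝ in (-T)..T, g ρ x (((1:ℝ):ℂ) + y * I)) =
      (∫ u : ℝ in (1:ℝ)..a, g ρ x (u + T * I)) - (∫ u : ℝ in (1:ℝ)..a, g ρ x (u + (-T : ℝ) * I)) := by
    intro T
    have := Complex.integral_boundary_rect_eq_zero_of_differentiableOn (g ρ x)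
      (⟨1, -T⟩ : ℂ) (⟨a, T⟩ : ℂ) ?_
    · simp only at this
      linear_combination this
    · intro w hw
      apply (g_diff ρ x h0 h1 hx w ?_).differentiableWithinAt
      have h2 := hw.1
      simp only [mem_preimage, uIcc_of_le ha] at h2
      linarith [h2.1]
  have hlim0 : Tendsto (fun T : ℝ => Real.exp (a ^ 2 - T ^ 2) * (x⁻¹ * (a + |T|) ^ 2)) atTop (𝓝 0) := by
    have e1 : Tendsto (fun T : ℝ => T ^ 2 * Real.exp (-T)) atTop (𝓝 0) :=
      Real.tendsto_pow_mul_exp_neg_atTop_nhds_zero 2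
    have e2 := e1.const_mul (4 * x⁻¹ * Real.exp (a ^ 2))
    rw [mul_zero] at e2
    refine squeeze_zero' (Eventually.of_forall fun T => by positivity) ?_ e2
    filter_upwards [eventually_ge_atTop a] with T hT
    have hT0 : 1 ≤ T := ha.trans hT
    rw [abs_of_pos (by linarith)]
    have e3 : Real.exp (a ^ 2 - T ^ 2) ≤ Real.exp (a ^ 2) * Real.exp (-T) := by
      rw [← Real.exp_add]; apply Real.exp_le_exp.2; nlinarith
    have e4 : (a + T) ^ 2 ≤ 4 * T ^ 2 := by nlinarith
    calc _ ≤ (Real.exp (a ^ 2) * Real.exp (-T)) * (x⁻¹ * (4 * T ^ 2)) := by gcongr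
      _ = _ := by ring
  have hh : ∀ σ : ℝ, |σ| = 1 →
      Tendsto (fun T : ℝ => ∫ u : ℝ in (1:ℝ)..a, g ρ x (u + (σ * T : ℝ) * I)) atTop (𝓝 0) := by
    intro σ hσ
    have hl := hlim0.mul_const |a - 1|
    rw [zero_mul] at hl
    refine squeeze_zero_norm (fun T => ?_) hl
    refine intervalIntegral.norm_integral_le_of_norm_le_const fun u hu => ?_
    rw [uIoc_of_le ha] at hu
    have := hb (σ * T) u ⟨hu.1.le, hu.2⟩
    rw [abs_mul, hσ, one_mul, mul_pow, ← sq_abs σ, hσ, one_pow, one_mul] at this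
    exact this
  have hA := intervalIntegral_tendsto_integral (g_integrable ρ x a h0 h1 hx ha)
    tendsto_neg_atTop_atBot tendsto_id
  have hB := intervalIntegral_tendsto_integral (g_integrable ρ x 1 h0 h1 hx le_rfl)
    tendsto_neg_atTop_atBot tendsto_id
  have hL := (hA.const_smul I).sub (hB.const_smul I)
  have hR := (hh 1 (by simp)).sub (hh (-1) (by simp))
  have hLR := tendsto_nhds_unique hL (hR.congr fun T => by
    have := hrect T
    simp only [id, one_mul, neg_one_mul]
    exact this.symm)
  rw [sub_zero, ← smul_sub, smul_eq_mul] at hLR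
  exact sub_eq_zero.1 ((mul_eq_zero.1 hLR).resolve_left I_ne_zero)

lemma series (ρ x a : ℝ) (h0 : 0 < ρ) (hx : 0 < x) (ha : 0 < a) (hxa : x < a ^ (2 * ρ)) :
    ((mittagLeffler ρ ρ (-x) : ℝ) : ℂ) = (Real.pi : ℂ)⁻¹ * ∫ y : ℝ, g ρ x ((a:ℂ) + y * I) := by
  let F : ℕ → ℝ → ℂ := fun k y => (-(x:ℂ)) ^ k *
    (cexp (((a:ℂ) + y * I) ^ 2) * ((a:ℂ) + y * I) ^ ((1 - 2 * ρ * (k + 1) : ℝ) : ℂ))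
  have hFi : ∀ k, Integrable (F k) := fun k => (integrable_J a _ ha).const_mul _
  have hx' : 0 < a ^ (2 * ρ) := by positivity
  -- pointwise form
  have hF : ∀ k y, F k y = cexp (((a:ℂ) + y * I) ^ 2) *
      (((a:ℂ) + y * I) / ((a:ℂ) + y * I) ^ ((2 * ρ : ℝ):ℂ)) *
      (-(x:ℂ) / ((a:ℂ) + y * I) ^ ((2 * ρ : ℝ):ℂ)) ^ k := by
    intro k y
    have hne := line_ne a y ha
    have : ((a:ℂ) + y * I) ^ ((1 - 2 * ρ * (k + 1) : ℝ) : ℂ) = (((a:ℂ) + y * I) /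
        ((a:ℂ) + y * I) ^ ((2 * ρ : ℝ):ℂ)) * ((((a:ℂ) + y * I) ^ ((2 * ρ : ℝ):ℂ)) ^ k)⁻¹ := by
      rw [← cpow_nat_mul, ← cpow_neg, div_eq_mul_inv, ← cpow_neg]
      nth_rewrite 2 [← cpow_one ((a:ℂ) + y * I)]
      rw [← cpow_add _ _ hne, ← cpow_add _ _ hne]
      congr 1; push_cast; ring
    simp only [F]
    rw [this, div_pow, div_eq_mul_inv ((-(x:ℂ)) ^ k)]
    ring
  have hr : ∀ y : ℝ, ‖-(x:ℂ) / ((a:ℂ) + y * I) ^ ((2 * ρ : ℝ):ℂ)‖ ≤ x / a ^ (2 * ρ) := by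
    intro y
    rw [norm_div, norm_neg, Complex.norm_real, Real.norm_of_nonneg hx.le, norm_cpow_line a y _ ha]
    gcongr
    exact line_norm_ge a y
  have hr1 : x / a ^ (2 * ρ) < 1 := (div_lt_one hx').2 hxa
  have hsum : ∀ y, ∑' k, F k y = g ρ x ((a:ℂ) + y * I) := by
    intro y
    simp_rw [hF]
    rw [tsum_mul_left, tsum_geometric_of_norm_lt_one ((hr y).trans_lt hr1)]
    have hv : ((a:ℂ) + y * I) ^ ((2 * ρ : ℝ):ℂ) ≠ 0 := by
      rw [cpow_ne_zero_iff]; exact Or.inl (line_ne a y ha)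
    unfold g
    have h1 : 1 - -(x:ℂ) / ((a:ℂ) + y * I) ^ ((2 * ρ : ℝ):ℂ)
        = (((a:ℂ) + y * I) ^ ((2 * ρ : ℝ):ℂ) + x) / ((a:ℂ) + y * I) ^ ((2 * ρ : ℝ):ℂ) := by
      field_simp
      ring
    rw [h1, inv_div, mul_assoc, div_mul_div_cancel₀ hv]
  let G : ℝ → ℝ := fun y => ‖cexp (((a:ℂ) + y * I) ^ 2) *
      (((a:ℂ) + y * I) / ((a:ℂ) + y * I) ^ ((2 * ρ : ℝ):ℂ))‖
  have hGi : Integrable G := by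
    have := (hFi 0).norm
    refine this.congr (ae_of_all _ fun y => ?_)
    simp only [hF, pow_zero, mul_one, G]
  have hS : Summable fun k => ∫ y, ‖F k y‖ := by
    refine Summable.of_nonneg_of_le (fun k => integral_nonneg fun y => norm_nonneg _)
      (f := fun k => (∫ y, G y) * (x / a ^ (2 * ρ)) ^ k) (fun k => ?_)
      ((summable_geometric_of_lt_one (by positivity) hr1).mul_left _)
    rw [← integral_mul_const]
    refine integral_mono (hFi k).norm (hGi.mul_const _) fun y => ?_
    simp only [hF]
    rw [norm_mul, norm_pow]
    gcongr
    exact hr y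
  have key := hasSum_integral_of_summable_integral_norm hFi hS
  simp_rw [hsum] at key
  have hk : ∀ k, ∫ y, F k y = Real.pi * (((-x) ^ k / Real.Gamma (ρ * k + ρ) : ℝ) : ℂ) := by
    intro k
    simp only [F]
    rw [integral_const_mul]
    have := J_eq a (1 - 2 * ρ * (k + 1)) ha
    unfold J at this
    rw [this, show (1 - (1 - 2 * ρ * ((k:ℝ) + 1))) / 2 = ρ * k + ρ by ring, Complex.Gamma_ofReal]
    push_cast
    ring
  simp_rw [hk] at key
  have hpi : (Real.pi : ℂ) ≠ 0 := by exact_mod_cast Real.pi_ne_zero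
  rw [← key.tsum_eq, tsum_mul_left, inv_mul_cancel_left₀ hpi, ← Complex.ofReal_tsum]
  rfl

lemma repr (ρ x : ℝ) (h0 : 0 < ρ) (h1 : ρ ≤ 1) (hx : 0 < x) :
    ((mittagLeffler ρ ρ (-x) : ℝ) : ℂ) =
      (Real.pi : ℂ)⁻¹ * ∫ y : ℝ, g ρ x (((1:ℝ):ℂ) + y * I) := by
  have hT : Tendsto (fun a : ℝ => a ^ (2 * ρ)) atTop atTop := tendsto_rpow_atTop (by linarith)
  obtain ⟨a, ha1, ha2⟩ := ((hT.eventually_gt_atTop x).and (eventually_ge_atTop 1)).exists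
  rw [series ρ x a h0 hx (by linarith) ha1, shift ρ x a h0 h1 hx ha2]

end ML4

namespace ML4

/-- The scaled power `t^{-ρ} w^{2ρ}`. -/
noncomputable def q (t ρ : ℝ) (w : ℂ) : ℂ := cexp (ρ * (2 * Complex.log w - Real.log t))

lemma q_eq (t ρ : ℝ) (ht : 0 < t) (w : ℂ) (hw : w ≠ 0) :
    q t ρ w = ((t ^ (-ρ) : ℝ) : ℂ) * w ^ ((2 * ρ : ℝ) : ℂ) := by
  unfold q
  rw [cpow_def_of_ne_zero hw, Real.rpow_def_of_pos ht, Complex.ofReal_exp, ← Complex.exp_add]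
  congr 1
  push_cast; ring

lemma q_norm (t ρ : ℝ) (ht : 0 < t) (w : ℂ) (hw : w ≠ 0) :
    ‖q t ρ w‖ = t ^ (-ρ) * ‖w‖ ^ (2 * ρ) := by
  rw [q_eq t ρ ht w hw, norm_mul, Complex.norm_real, Real.norm_of_nonneg (by positivity),
    Complex.norm_cpow_real]

lemma q_norm_le (t ρ : ℝ) (ht : 0 < t) (w : ℂ) (hw : 1 ≤ w.re) (h1 : ρ ≤ 1) :
    ‖q t ρ w‖ ≤ t ^ (-ρ) * ‖w‖ ^ 2 := by
  have hn : 1 ≤ ‖w‖ := hw.trans (Complex.re_le_norm w)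
  rw [q_norm t ρ ht w (norm_pos_iff.1 (by linarith)), ← Real.rpow_two]
  gcongr
  linarith

lemma q_den (t ρ lam : ℝ) (ht : 0 < t) (w : ℂ) (hw : 1 ≤ w.re) (h0 : 0 < ρ) (h1 : ρ ≤ 1)
    (hl : 0 < lam) : ‖q t ρ w‖ + lam ≤ ‖w‖ * ‖q t ρ w + lam‖ := by
  have hn : 1 ≤ ‖w‖ := hw.trans (Complex.re_le_norm w)
  have hw0 : w ≠ 0 := norm_pos_iff.1 (by linarith)
  rw [q_norm t ρ ht w hw0, q_eq t ρ ht w hw0]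
  exact den_lower' w hw ρ h0 h1 _ lam (by positivity) hl

lemma q_den_pos (t ρ lam : ℝ) (ht : 0 < t) (w : ℂ) (hw : 1 ≤ w.re) (h0 : 0 < ρ) (h1 : ρ ≤ 1)
    (hl : 0 < lam) : 0 < ‖q t ρ w + lam‖ := by
  have h := q_den t ρ lam ht w hw h0 h1 hl
  have hq := norm_nonneg (q t ρ w)
  by_contra hc
  have : ‖q t ρ w + lam‖ = 0 := le_antisymm (not_lt.1 hc) (norm_nonneg _)
  rw [this] at h
  linarith

lemma q_inv (t ρ lam : ℝ) (ht : 0 < t) (w : ℂ) (hw : 1 ≤ w.re) (h0 : 0 < ρ) (h1 : ρ ≤ 1)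
    (hl : 0 < lam) : ‖q t ρ w + lam‖⁻¹ ≤ ‖w‖ / lam := by
  have h := q_den t ρ lam ht w hw h0 h1 hl
  have hp := q_den_pos t ρ lam ht w hw h0 h1 hl
  rw [inv_eq_one_div, div_le_div_iff₀ hp hl]
  linarith [norm_nonneg (q t ρ w)]

/-- Remainder integrand. -/
noncomputable def p (t lam ρ : ℝ) (w : ℂ) : ℂ := w * (q t ρ w ^ 2 / (q t ρ w + lam))

/-- Its derivative in `ρ`. -/
noncomputable def p' (t lam ρ : ℝ) (w : ℂ) : ℂ :=
  w * ((2 * Complex.log w - Real.log t) * q t ρ w ^ 2 * (q t ρ w + 2 * lam) / (q t ρ w + lam) ^ 2)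

lemma p_norm (t lam ρ : ℝ) (ht : 1 ≤ t) (w : ℂ) (hw : 1 ≤ w.re) (h0 : 0 < ρ) (h1 : ρ ≤ 1)
    (hl : 0 < lam) : ‖p t lam ρ w‖ ≤ lam⁻¹ * ‖w‖ ^ 6 := by
  have hn : 1 ≤ ‖w‖ := hw.trans (Complex.re_le_norm w)
  have hq := q_norm_le t ρ (by linarith) w hw h1
  have hi := q_inv t ρ lam (by linarith) w hw h0 h1 hl
  have ht1 : t ^ (-ρ) ≤ 1 := Real.rpow_le_one_of_one_le_of_nonpos ht (by linarith)
  have hq' : ‖q t ρ w‖ ≤ ‖w‖ ^ 2 := hq.trans (by nlinarith [sq_nonneg ‖w‖])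
  unfold p
  rw [norm_mul, norm_div, norm_pow, div_eq_mul_inv]
  calc _ ≤ ‖w‖ * ((‖w‖ ^ 2) ^ 2 * (‖w‖ / lam)) := by gcongr
    _ = _ := by ring

lemma log_norm (w : ℂ) (hw : 1 ≤ ‖w‖) (L : ℝ) (hL : 0 ≤ L) :
    ‖2 * Complex.log w - L‖ ≤ (L + 10) * ‖w‖ := by
  have h1 : ‖Complex.log w‖ ≤ Real.log ‖w‖ + Real.pi := by
    refine (Complex.norm_le_abs_re_add_abs_im _).trans ?_
    rw [Complex.log_re, Complex.log_im, abs_of_nonneg (Real.log_nonneg hw)]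
    gcongr
    exact abs_arg_le_pi w
  have h2 : Real.log ‖w‖ ≤ ‖w‖ - 1 := Real.log_le_sub_one_of_pos (by linarith)
  have h3 := Real.pi_le_four
  have h4 : ‖2 * Complex.log w - L‖ ≤ 2 * ‖Complex.log w‖ + L := by
    refine (norm_sub_le _ _).trans ?_
    simp [abs_of_nonneg hL]
  nlinarith

lemma p'_norm (t lam ρ : ℝ) (ht : 1 ≤ t) (w : ℂ) (hw : 1 ≤ w.re) (h0 : 0 < ρ) (h1 : ρ ≤ 1)
    (hl : 0 < lam) :
    ‖p' t lam ρ w‖ ≤ (2 * (Real.log t + 10) * (t ^ (-ρ)) ^ 2 / lam) * ‖w‖ ^ 8 := by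
  have hn : 1 ≤ ‖w‖ := hw.trans (Complex.re_le_norm w)
  have hq := q_norm_le t ρ (by linarith) w hw h1
  have hi := q_inv t ρ lam (by linarith) w hw h0 h1 hl
  have hd := q_den t ρ lam (by linarith) w hw h0 h1 hl
  have hp := q_den_pos t ρ lam (by linarith) w hw h0 h1 hl
  have hlog := log_norm w hn (Real.log t) (Real.log_nonneg ht)
  have hlt : 0 ≤ Real.log t := Real.log_nonneg ht
  have h2 : ‖q t ρ w + 2 * lam‖ * ‖q t ρ w + lam‖⁻¹ ≤ 2 * ‖w‖ := by
    rw [← div_eq_mul_inv, div_le_iff₀ hp]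
    have : ‖q t ρ w + 2 * lam‖ ≤ ‖q t ρ w‖ + 2 * lam := by
      refine (norm_add_le _ _).trans ?_
      simp [abs_of_pos hl]
    nlinarith [norm_nonneg (q t ρ w)]
  have e : ‖p' t lam ρ w‖ = ‖w‖ * (‖2 * Complex.log w - Real.log t‖ * ‖q t ρ w‖ ^ 2 *
      (‖q t ρ w + 2 * lam‖ * ‖q t ρ w + lam‖⁻¹) * ‖q t ρ w + lam‖⁻¹) := by
    unfold p'
    rw [norm_mul, norm_div, norm_mul, norm_mul, norm_pow, norm_pow, div_eq_mul_inv]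
    ring
  rw [e]
  calc _ ≤ ‖w‖ * (((Real.log t + 10) * ‖w‖) * (t ^ (-ρ) * ‖w‖ ^ 2) ^ 2 *
      (2 * ‖w‖) * (‖w‖ / lam)) := by gcongr
    _ = _ := by ring

lemma q_deriv (t ρ : ℝ) (w : ℂ) :
    HasDerivAt (fun r : ℝ => q t r w) ((2 * Complex.log w - Real.log t) * q t ρ w) ρ := by
  unfold q
  have h : HasDerivAt (fun r : ℝ => (r:ℂ) * (2 * Complex.log w - Real.log t))
      (1 * (2 * Complex.log w - Real.log t)) ρ :=
    (Complex.ofRealCLM.hasDerivAt (x := ρ)).mul_const _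
  have := h.cexp
  refine this.congr_deriv ?_
  ring

lemma p_deriv (t lam ρ : ℝ) (ht : 1 ≤ t) (w : ℂ) (hw : 1 ≤ w.re) (h0 : 0 < ρ) (h1 : ρ ≤ 1)
    (hl : 0 < lam) : HasDerivAt (fun r : ℝ => p t lam r w) (p' t lam ρ w) ρ := by
  have hp := q_den_pos t ρ lam (by linarith) w hw h0 h1 hl
  have hne : q t ρ w + lam ≠ 0 := norm_pos_iff.1 hp
  have hq := q_deriv t ρ w
  have := ((hq.fun_pow 2).fun_div (hq.add_const (lam:ℂ)) hne).const_mul w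
  refine this.congr_deriv ?_
  unfold p'
  congr 2
  push_cast
  ring

lemma q_cont_line (t ρ : ℝ) : Continuous (fun y : ℝ => q t ρ (((1:ℝ):ℂ) + y * I)) := by
  have : Continuous (fun y : ℝ => Complex.log (((1:ℝ):ℂ) + y * I)) :=
    (continuous_line 1).clog fun y => line_slit 1 y one_pos
  unfold q
  fun_prop

lemma p_cont_line (t lam ρ : ℝ) (ht : 1 ≤ t) (h0 : 0 < ρ) (h1 : ρ ≤ 1) (hl : 0 < lam) :
    Continuous (fun y : ℝ => p t lam ρ (((1:ℝ):ℂ) + y * I)) := by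
  have hq := q_cont_line t ρ
  refine (continuous_line 1).mul ((hq.pow 2).div (hq.add continuous_const) fun y => ?_)
  exact norm_pos_iff.1 (q_den_pos t ρ lam (by linarith) _ (by simp) h0 h1 hl)

lemma p'_cont_line (t lam ρ : ℝ) (ht : 1 ≤ t) (h0 : 0 < ρ) (h1 : ρ ≤ 1) (hl : 0 < lam) :
    Continuous (fun y : ℝ => p' t lam ρ (((1:ℝ):ℂ) + y * I)) := by
  have hq := q_cont_line t ρ
  have hlog : Continuous (fun y : ℝ => Complex.log (((1:ℝ):ℂ) + y * I)) :=
    (continuous_line 1).clog fun y => line_slit 1 y one_pos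
  refine (continuous_line 1).mul (Continuous.div (by fun_prop) (by fun_prop) fun y => ?_)
  exact pow_ne_zero _ (norm_pos_iff.1 (q_den_pos t ρ lam (by linarith) _ (by simp) h0 h1 hl))

/-- Remainder integral. -/
noncomputable def P (t lam ρ : ℝ) : ℂ :=
  ∫ y : ℝ, cexp ((((1:ℝ):ℂ) + y * I) ^ 2) * p t lam ρ (((1:ℝ):ℂ) + y * I)

/-- Universal constant. -/
noncomputable def C0 : ℝ := ∫ y : ℝ, ‖((1:ℝ):ℂ) + y * I‖ ^ 8 * Real.exp ((1:ℝ) ^ 2 - y ^ 2)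

lemma P_integrable (t lam ρ : ℝ) (ht : 1 ≤ t) (h0 : 0 < ρ) (h1 : ρ ≤ 1) (hl : 0 < lam) :
    Integrable (fun y : ℝ => cexp ((((1:ℝ):ℂ) + y * I) ^ 2) * p t lam ρ (((1:ℝ):ℂ) + y * I)) :=
  integrable_line 1 one_pos 6 lam⁻¹ _ (p_cont_line t lam ρ ht h0 h1 hl)
    fun y => p_norm t lam ρ ht _ (by simp) h0 h1 hl

lemma P_cont (t lam : ℝ) (ht : 1 ≤ t) (hl : 0 < lam) : ContinuousOn (P t lam) (Ioc 0 1) := by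
  unfold P
  refine continuousOn_of_dominated (bound := fun y : ℝ => lam⁻¹ *
    (‖((1:ℝ):ℂ) + y * I‖ ^ 6 * Real.exp ((1:ℝ) ^ 2 - y ^ 2))) ?_ ?_ ?_ ?_
  · intro ρ hρ
    exact (P_integrable t lam ρ ht hρ.1 hρ.2 hl).1
  · intro ρ hρ
    refine ae_of_all _ fun y => ?_
    rw [norm_mul, norm_exp_line]
    have := p_norm t lam ρ ht (((1:ℝ):ℂ) + y * I) (by simp) hρ.1 hρ.2 hl
    calc _ ≤ Real.exp ((1:ℝ) ^ 2 - y ^ 2) * (lam⁻¹ * ‖((1:ℝ):ℂ) + y * I‖ ^ 6) := by gcongr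
      _ = _ := by ring
  · exact (integrable_base 1 one_pos 6).const_mul _
  · refine ae_of_all _ fun y => ?_
    refine continuousOn_const.mul fun ρ hρ => ?_
    exact (p_deriv t lam ρ ht _ (by simp) hρ.1 hρ.2 hl).continuousAt.continuousWithinAt

lemma P_deriv (t lam ρ : ℝ) (ht : 1 ≤ t) (h0 : 0 < ρ) (h1 : ρ < 1) (hl : 0 < lam) :
    ∃ D : ℂ, HasDerivAt (P t lam) D ρ ∧
      ‖D‖ ≤ (2 * (Real.log t + 10) * (t ^ (-ρ)) ^ 2 / lam) * C0 := by
  have hlt : 0 ≤ Real.log t := Real.log_nonneg ht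
  have hbd : ∀ y : ℝ, ∀ r ∈ Ioo (0:ℝ) 1,
      ‖cexp ((((1:ℝ):ℂ) + y * I) ^ 2) * p' t lam r (((1:ℝ):ℂ) + y * I)‖ ≤
      (2 * (Real.log t + 10) * (t ^ (-r)) ^ 2 / lam) *
        (‖((1:ℝ):ℂ) + y * I‖ ^ 8 * Real.exp ((1:ℝ) ^ 2 - y ^ 2)) := by
    intro y r hr
    rw [norm_mul, norm_exp_line]
    have := p'_norm t lam r ht (((1:ℝ):ℂ) + y * I) (by simp) hr.1 hr.2.le hl
    calc _ ≤ Real.exp ((1:ℝ) ^ 2 - y ^ 2) * ((2 * (Real.log t + 10) * (t ^ (-r)) ^ 2 / lam) *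
          ‖((1:ℝ):ℂ) + y * I‖ ^ 8) := by gcongr
      _ = _ := by ring
  have key := hasDerivAt_integral_of_dominated_loc_of_deriv_le
    (μ := (volume : Measure ℝ)) (x₀ := ρ) (s := Ioo (0:ℝ) 1)
    (F := fun r y => cexp ((((1:ℝ):ℂ) + y * I) ^ 2) * p t lam r (((1:ℝ):ℂ) + y * I))
    (F' := fun r y => cexp ((((1:ℝ):ℂ) + y * I) ^ 2) * p' t lam r (((1:ℝ):ℂ) + y * I))
    (bound := fun y : ℝ => (2 * (Real.log t + 10) / lam) *
        (‖((1:ℝ):ℂ) + y * I‖ ^ 8 * Real.exp ((1:ℝ) ^ 2 - y ^ 2)))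
    (Ioo_mem_nhds h0 h1) ?_ ?_ ?_ ?_ ?_ ?_
  · refine ⟨_, key.2, ?_⟩
    unfold C0
    rw [← integral_const_mul]
    exact norm_integral_le_of_norm_le ((integrable_base 1 one_pos 8).const_mul _)
      (ae_of_all _ fun y => hbd y ρ ⟨h0, h1⟩)
  · filter_upwards [Ioo_mem_nhds h0 h1] with r hr
    exact (P_integrable t lam r ht hr.1 hr.2.le hl).1
  · exact P_integrable t lam ρ ht h0 h1.le hl
  · have := p'_cont_line t lam ρ ht h0 h1.le hl
    exact Continuous.aestronglyMeasurable (by fun_prop)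
  · refine ae_of_all _ fun y r hr => (hbd y r hr).trans ?_
    have ht1 : t ^ (-r) ≤ 1 := Real.rpow_le_one_of_one_le_of_nonpos ht (by linarith [hr.1])
    have ht0 : 0 ≤ t ^ (-r) := by positivity
    have ht2 : (t ^ (-r)) ^ 2 ≤ 1 := by nlinarith
    gcongr ?_ / _ * _
    nlinarith
  · exact (integrable_base 1 one_pos 8).const_mul _
  · refine ae_of_all _ fun y r hr => ?_
    exact (p_deriv t lam r ht _ (by simp) hr.1 hr.2.le hl).const_mul _

lemma e_eq (t lam ρ : ℝ) (ht : 1 ≤ t) (h0 : 0 < ρ) (h1 : ρ ≤ 1) (hl : 0 < lam) :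
    t ^ (ρ - 1) * mittagLeffler ρ ρ (-(lam * t ^ ρ)) =
      (lam ^ 2 * t)⁻¹ * (t ^ (-ρ) * (ρ * (1 - ρ) * (Complex.Gamma ((2 - ρ : ℝ) : ℂ))⁻¹.re)
        + Real.pi⁻¹ * (P t lam ρ).re) := by
  have ht0 : 0 < t := by linarith
  have hpi : (Real.pi : ℂ) ≠ 0 := by exact_mod_cast Real.pi_ne_zero
  set s := t ^ ρ with hs
  have hs0 : 0 < s := by positivity
  have hsinv : t ^ (-ρ) = s⁻¹ := Real.rpow_neg ht0.le ρ
  have hrep := repr ρ (lam * s) h0 h1 (by positivity)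
  have hJ1 := J_eq 1 1 one_pos
  have hJ2 := J_eq 1 (1 + 2 * ρ) one_pos
  have hg : ∀ y : ℝ, g ρ (lam * s) (((1:ℝ):ℂ) + y * I) =
      ((lam * s : ℂ)⁻¹ * (cexp ((((1:ℝ):ℂ) + y * I) ^ 2) * (((1:ℝ):ℂ) + y * I) ^ ((1:ℝ):ℂ)) -
      (lam * s : ℂ)⁻¹ ^ 2 * (cexp ((((1:ℝ):ℂ) + y * I) ^ 2) *
        (((1:ℝ):ℂ) + y * I) ^ ((1 + 2 * ρ : ℝ):ℂ))) +
      ((lam:ℂ) ^ 2 * s)⁻¹ *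
        (cexp ((((1:ℝ):ℂ) + y * I) ^ 2) * p t lam ρ (((1:ℝ):ℂ) + y * I)) := by
    intro y
    have hw0 := line_ne 1 y one_pos
    have hne := den_ne (((1:ℝ):ℂ) + y * I) (by simp) ρ h0 h1 1 (lam * s) one_pos (by positivity)
    unfold g p
    rw [q_eq t ρ ht0 _ hw0, hsinv]
    generalize hw : ((1:ℝ):ℂ) + y * I = w at *
    have e1 : w ^ ((1 + 2 * ρ : ℝ) : ℂ) = w * w ^ ((2 * ρ : ℝ) : ℂ) := by
      rw [Complex.ofReal_add, cpow_add _ _ hw0, Complex.ofReal_one, cpow_one]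
    rw [e1, Complex.ofReal_one, cpow_one]
    generalize w ^ ((2 * ρ : ℝ) : ℂ) = v at *
    have hlc : (lam:ℂ) ≠ 0 := by exact_mod_cast hl.ne'
    have hsc : (s:ℂ) ≠ 0 := by exact_mod_cast hs0.ne'
    push_cast at hne ⊢
    rw [one_mul] at hne
    have e2 : (s:ℂ)⁻¹ * v + lam = (v + lam * s) / s := by field_simp
    rw [e2]
    field_simp
    ring
  have hi1 := (integrable_J 1 1 one_pos).const_mul (lam * s : ℂ)⁻¹
  have hi2 := (integrable_J 1 (1 + 2 * ρ) one_pos).const_mul ((lam * s : ℂ)⁻¹ ^ 2)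
  have hi3 := (P_integrable t lam ρ ht h0 h1 hl).const_mul ((lam:ℂ) ^ 2 * s)⁻¹
  simp_rw [hg] at hrep
  have hi12 : Integrable (fun y : ℝ =>
      (lam * s : ℂ)⁻¹ * (cexp ((((1:ℝ):ℂ) + y * I) ^ 2) * (((1:ℝ):ℂ) + y * I) ^ ((1:ℝ):ℂ)) -
      (lam * s : ℂ)⁻¹ ^ 2 * (cexp ((((1:ℝ):ℂ) + y * I) ^ 2) *
        (((1:ℝ):ℂ) + y * I) ^ ((1 + 2 * ρ : ℝ):ℂ))) := hi1.sub hi2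
  rw [integral_add hi12 hi3, integral_sub hi1 hi2, integral_const_mul,
    integral_const_mul, integral_const_mul] at hrep
  change _ = (Real.pi : ℂ)⁻¹ * ((lam * s : ℂ)⁻¹ * J 1 1 - (lam * s : ℂ)⁻¹ ^ 2 * J 1 (1 + 2 * ρ)
    + ((lam:ℂ) ^ 2 * s)⁻¹ * P t lam ρ) at hrep
  have hG : (Complex.Gamma (((1 - (1 + 2 * ρ)) / 2 : ℝ) : ℂ))⁻¹ =
      ((-(ρ * (1 - ρ)) : ℝ) : ℂ) * (Complex.Gamma ((2 - ρ : ℝ) : ℂ))⁻¹ := by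
    rw [Complex.one_div_Gamma_eq_self_mul_one_div_Gamma_add_one,
      Complex.one_div_Gamma_eq_self_mul_one_div_Gamma_add_one (_ + 1)]
    rw [show (((1 - (1 + 2 * ρ)) / 2 : ℝ) : ℂ) + 1 + 1 = ((2 - ρ : ℝ) : ℂ) by push_cast; ring]
    push_cast
    ring
  rw [hJ1, hJ2, hG] at hrep
  rw [show ((1 - 1) / 2 : ℝ) = 0 by norm_num, Complex.ofReal_zero, Complex.Gamma_zero, inv_zero,
    mul_zero, mul_zero, zero_sub] at hrep
  have hre := congrArg Complex.re hrep
  rw [Complex.ofReal_re] at hre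
  have h5 : (Real.pi : ℂ)⁻¹ * (-((lam * s : ℂ)⁻¹ ^ 2 * (Real.pi * (((-(ρ * (1 - ρ)) : ℝ) : ℂ) *
      (Complex.Gamma ((2 - ρ : ℝ) : ℂ))⁻¹))) + ((lam:ℂ) ^ 2 * s)⁻¹ * P t lam ρ)
      = (((lam * s)⁻¹ ^ 2 * (ρ * (1 - ρ)) : ℝ) : ℂ) * (Complex.Gamma ((2 - ρ : ℝ) : ℂ))⁻¹
        + (((lam ^ 2 * s)⁻¹ * Real.pi⁻¹ : ℝ) : ℂ) * P t lam ρ := by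
    push_cast
    field_simp
  rw [h5, Complex.add_re, Complex.re_ofReal_mul, Complex.re_ofReal_mul] at hre
  rw [hre, hsinv, Real.rpow_sub_one ht0.ne', ← hs]
  field_simp

/-- The reciprocal Gamma factor. -/
noncomputable def K (ρ : ℝ) : ℝ := (Complex.Gamma ((2 - ρ : ℝ) : ℂ))⁻¹.re

lemma K_facts : ∃ (K' : ℝ → ℝ) (k0 M : ℝ), 0 < k0 ∧ 0 ≤ M ∧ (∀ ρ, HasDerivAt K (K' ρ) ρ) ∧
    ∀ ρ ∈ Icc (0:ℝ) 1, k0 ≤ K ρ ∧ |K' ρ| ≤ M := by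
  have hd := Complex.differentiable_one_div_Gamma
  have hcd : Continuous (deriv fun s : ℂ => (Complex.Gamma s)⁻¹) :=
    (hd.contDiff (n := 1)).continuous_deriv (by norm_num)
  have hK : ∀ ρ, HasDerivAt K
      (-(deriv (fun s : ℂ => (Complex.Gamma s)⁻¹) ((2 - ρ : ℝ) : ℂ)).re) ρ := by
    intro ρ
    have h1 := (hd ((2 - ρ : ℝ) : ℂ)).hasDerivAt.real_of_complex
    have h2 : HasDerivAt (fun r : ℝ => 2 - r) (-1) ρ := by
      simpa using (hasDerivAt_id ρ).const_sub 2
    have := h1.comp ρ h2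
    refine this.congr_deriv ?_
    ring
  have hc : Continuous K := continuous_iff_continuousAt.2 fun ρ => (hK ρ).continuousAt
  obtain ⟨ρm, hm, hmin⟩ := isCompact_Icc.exists_isMinOn (s := Icc (0:ℝ) 1) ⟨0, by simp⟩
    hc.continuousOn
  have hcK' : Continuous fun ρ : ℝ =>
      -(deriv (fun s : ℂ => (Complex.Gamma s)⁻¹) ((2 - ρ : ℝ) : ℂ)).re := by fun_prop
  obtain ⟨M, hM⟩ := isCompact_Icc.exists_bound_of_continuousOn (s := Icc (0:ℝ) 1)
    hcK'.continuousOn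
  refine ⟨_, K ρm, M, ?_, ?_, hK, fun ρ hρ => ⟨hmin hρ, hM ρ hρ⟩⟩
  · unfold K
    rw [Complex.Gamma_ofReal, ← Complex.ofReal_inv, Complex.ofReal_re]
    exact inv_pos.2 (Real.Gamma_pos_of_pos (by linarith [hm.2]))
  · exact (norm_nonneg _).trans (hM 0 (by simp))

lemma C0_nonneg : 0 ≤ C0 := by
  unfold C0
  exact integral_nonneg fun y => by positivity

lemma small (ρ₀ C c : ℝ) (h : 0 < ρ₀) (hc : 0 < c) :
    ∀ᶠ t : ℝ in atTop, C * (Real.log t + 10) * t ^ (-ρ₀) < c := by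
  have h1 : Tendsto (fun t : ℝ => Real.log t / t ^ ρ₀) atTop (𝓝 0) :=
    (isLittleO_log_rpow_atTop h).tendsto_div_nhds_zero
  have h2 := tendsto_rpow_neg_atTop h
  have h3 := (h1.add (h2.const_mul 10)).const_mul C
  simp only [mul_zero, add_zero] at h3
  filter_upwards [h3.eventually_lt_const hc, eventually_gt_atTop 0] with t ht ht0
  rw [Real.rpow_neg ht0.le] at ht ⊢
  calc _ = _ := by ring
    _ < c := ht

end ML4

open ML4

theorem statement4 (ρ₀ : ℝ) (hρ₀ : ρ₀ ∈ Set.Ioo (0 : ℝ) 1) (lam₁ : ℝ) (hlam₁ : 0 < lam₁) :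
    ∃ T₀ : ℝ, 0 < T₀ ∧ ∀ t₀ : ℝ, T₀ ≤ t₀ → ∀ lam : ℝ, lam₁ ≤ lam →
      (∀ ρ ∈ Set.Icc ρ₀ 1, 0 < t₀ ^ (ρ - 1) * mittagLeffler ρ ρ (-(lam * t₀ ^ ρ))) ∧
      StrictAntiOn (fun ρ : ℝ => t₀ ^ (ρ - 1) * mittagLeffler ρ ρ (-(lam * t₀ ^ ρ)))
        (Set.Icc ρ₀ 1) := by
  obtain ⟨hr0, hr1⟩ := hρ₀
  obtain ⟨K', k0, M, hk0, hM0, hKd, hKb⟩ := K_facts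
  have hev := ((small ρ₀ (Real.pi⁻¹ * (2 / lam₁) * C0) (ρ₀ ^ 2 * k0) hr0 (by positivity)).and
    (Real.tendsto_log_atTop.eventually_ge_atTop ((1 + M / k0) / ρ₀))).and (eventually_ge_atTop 1)
  obtain ⟨T, hT⟩ := eventually_atTop.1 hev
  refine ⟨max T 1, by positivity, fun t ht lam hlam => ?_⟩
  obtain ⟨⟨hsm, hlog⟩, ht1⟩ := hT t ((le_max_left _ _).trans ht)
  have hl : 0 < lam := by linarith
  have ht0 : 0 < t := by linarith
  set L := Real.log t with hL
  have hL0 : 0 ≤ L := Real.log_nonneg ht1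
  have hC0 := C0_nonneg
  rw [div_le_iff₀ hr0] at hlog
  have hLM : M ≤ (L * ρ₀ - 1) * k0 := by
    have : M / k0 ≤ L * ρ₀ - 1 := by linarith
    rwa [div_le_iff₀ hk0] at this
  let H : ℝ → ℝ := fun ρ => t ^ (-ρ) * (ρ * (1 - ρ) * K ρ) + Real.pi⁻¹ * (P t lam ρ).re
  have heq : ∀ ρ ∈ Icc ρ₀ 1, t ^ (ρ - 1) * mittagLeffler ρ ρ (-(lam * t ^ ρ)) =
      (lam ^ 2 * t)⁻¹ * H ρ := fun ρ hρ => e_eq t lam ρ ht1 (by linarith [hρ.1]) hρ.2 hl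
  have hmder : ∀ ρ : ℝ, HasDerivAt (fun ρ => t ^ (-ρ) * (ρ * (1 - ρ) * K ρ))
      (t ^ (-ρ) * (-L * (ρ * (1 - ρ) * K ρ) + ((1 - 2 * ρ) * K ρ + ρ * (1 - ρ) * K' ρ))) ρ := by
    intro ρ
    have h1 : HasDerivAt (fun r : ℝ => t ^ (-r)) (Real.log t * (-1) * t ^ (-ρ)) ρ :=
      (hasDerivAt_neg ρ).const_rpow ht0
    have h2 : HasDerivAt (fun r : ℝ => r * (1 - r)) (1 * (1 - ρ) + ρ * (-1)) ρ :=
      (hasDerivAt_id ρ).fun_mul ((hasDerivAt_id ρ).const_sub 1)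
    refine (h1.fun_mul (h2.fun_mul (hKd ρ))).congr_deriv ?_
    rw [← hL]
    ring
  have hcont : ContinuousOn H (Icc ρ₀ 1) := by
    refine ContinuousOn.add (fun ρ _ => (hmder ρ).continuousAt.continuousWithinAt)
      (continuousOn_const.mul ?_)
    exact Complex.continuous_re.comp_continuousOn
      ((P_cont t lam ht1 hl).mono fun ρ hρ => ⟨by linarith [hρ.1], hρ.2⟩)
  have hHanti : StrictAntiOn H (Icc ρ₀ 1) := by
    refine strictAntiOn_of_deriv_neg (convex_Icc _ _) hcont fun ρ hρ => ?_
    rw [interior_Icc] at hρ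
    have hρ0 : 0 < ρ := by linarith [hρ.1]
    obtain ⟨D, hD, hDn⟩ := P_deriv t lam ρ ht1 hρ0 hρ.2 hl
    have hDre : HasDerivAt (fun r => (P t lam r).re) D.re ρ :=
      (Complex.reCLM.hasFDerivAt.comp_hasDerivAt ρ hD)
    have hH := (hmder ρ).add (hDre.const_mul Real.pi⁻¹)
    have hH' : deriv H ρ = _ := hH.deriv
    rw [hH']
    obtain ⟨hK1, hK2⟩ := hKb ρ ⟨hρ0.le, hρ.2.le⟩
    set s := t ^ (-ρ) with hs
    have hs0 : 0 < s := by positivity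
    have hsle : s ≤ t ^ (-ρ₀) := Real.rpow_le_rpow_of_exponent_le ht1 (by linarith [hρ.1])
    -- main term
    have hmain : -L * (ρ * (1 - ρ) * K ρ) + ((1 - 2 * ρ) * K ρ + ρ * (1 - ρ) * K' ρ)
        ≤ -(ρ₀ ^ 2 * k0) := by
      have hK'le : K' ρ ≤ M := (le_abs_self _).trans hK2
      have hLr : 0 ≤ L * ρ₀ - 1 := by
        by_contra hcon
        push Not at hcon
        nlinarith
      have hLKM : (1 - ρ) * K ρ ≤ ρ * (L * K ρ - K' ρ) := by
        have a1 : M ≤ (L * ρ₀ - 1) * K ρ := hLM.trans (by gcongr)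
        have hKp : 0 < K ρ := by linarith
        have a2 : ρ * K' ρ ≤ M := by nlinarith [hρ.2]
        have a3 : L * ρ₀ * K ρ ≤ L * ρ * K ρ := by
          gcongr
          exact hρ.1.le
        nlinarith
      have a4 : ρ₀ ^ 2 * k0 ≤ ρ ^ 2 * K ρ := by
        gcongr
        exact hρ.1.le
      nlinarith [mul_nonneg (sub_nonneg.2 hρ.2.le) (sub_nonneg.2 hLKM)]
    have hrem : Real.pi⁻¹ * D.re < s * (ρ₀ ^ 2 * k0) := by
      have b1 : D.re ≤ (2 * (L + 10) * s ^ 2 / lam) * C0 := (Complex.re_le_norm D).trans hDn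
      calc Real.pi⁻¹ * D.re ≤ Real.pi⁻¹ * ((2 * (L + 10) * s ^ 2 / lam) * C0) := by
            gcongr
        _ ≤ Real.pi⁻¹ * ((2 * (L + 10) * (s * t ^ (-ρ₀)) / lam₁) * C0) := by
            have : s ^ 2 ≤ s * t ^ (-ρ₀) := by rw [pow_two]; gcongr
            have := Real.pi_pos
            gcongr
        _ = s * (Real.pi⁻¹ * (2 / lam₁) * C0 * (L + 10) * t ^ (-ρ₀)) := by ring
        _ < _ := by gcongr
    nlinarith [mul_le_mul_of_nonneg_left hmain hs0.le]
  have hanti : StrictAntiOn (fun ρ : ℝ => t ^ (ρ - 1) * mittagLeffler ρ ρ (-(lam * t ^ ρ)))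
      (Icc ρ₀ 1) := by
    intro a ha b hb hab
    simp only
    rw [heq a ha, heq b hb]
    have := hHanti ha hb hab
    gcongr
  refine ⟨fun ρ hρ => ?_, hanti⟩
  have h1 : 0 < t ^ ((1:ℝ) - 1) * mittagLeffler 1 1 (-(lam * t ^ (1:ℝ))) := by
    have : mittagLeffler 1 1 (-(lam * t ^ (1:ℝ))) = Real.exp (-(lam * t ^ (1:ℝ))) := by
      unfold mittagLeffler
      rw [Real.exp_eq_exp_ℝ, NormedSpace.exp_eq_tsum_div]
      congr 1; ext k
      rw [one_mul, Real.Gamma_nat_eq_factorial]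
    rw [this]
    positivity
  rcases eq_or_lt_of_le hρ.2 with h | h
  · rw [h]; exact h1
  · exact h1.trans (hanti hρ ⟨hr1.le, le_rfl⟩ h)
end

section
/- Let H be a separable Hilbert space with Hilbert basis (v_k)_{k∈ℕ} and let 0 < λ_1 ≤ λ_2 ≤ ⋯ be a nondecreasing sequence of positive reals. For every ρ_0 ∈ (0,1), with t_0 ≥ T_0 and T_0 = T_0(ρ_0, λ_1) as in the monotonicity lemma, the function ρ ↦ W(t_0, ρ) = Σ_{k=1}^∞ |(φ, v_k)|² (t_0^{ρ-1} E_{ρ,ρ}(-λ_k t_0^ρ))² is continuous on [ρ_0, 1] for every φ ∈ H. -/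
open scoped RealInnerProductSpace

section MLHelpers

open Real Set MeasureTheory Filter Topology

noncomputable def mlTh : ℝ := 2 * π / 3

lemma mlTh_pos : 0 < mlTh := by unfold mlTh; positivity
lemma mlTh_lt : mlTh < π := by unfold mlTh; linarith [pi_pos]
lemma mlTh_cos : cos mlTh = -(1/2) := by
  have : mlTh = π - π/3 := by unfold mlTh; ring
  rw [this, cos_pi_sub, cos_pi_div_three]

lemma ml_integrable_exp {a : ℝ} (ha : 0 < a) :
    Integrable (fun x : ℝ => rexp (-(rexp x)/2) * rexp (a * x)) := by
  have h1 := integrableOn_rpow_mul_exp_neg_mul_rpow (p := 1) (s := a - 1) (b := 1/2)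
    (by linarith) one_pos (by norm_num)
  have h2 : Ioi (0:ℝ) = rexp '' univ := by rw [Set.image_univ, Real.range_exp]
  rw [h2, integrableOn_image_iff_integrableOn_abs_deriv_smul MeasurableSet.univ
    (fun x _ => (Real.hasDerivAt_exp x).hasDerivWithinAt) Real.exp_injective.injOn,
    integrableOn_univ] at h1
  refine h1.congr (Eventually.of_forall fun x => ?_)
  simp only [abs_exp, smul_eq_mul, rpow_one]
  rw [← Real.exp_mul, ← mul_assoc, ← Real.exp_add, mul_comm]
  congr 2 <;> ring

lemma ml_abs_le (x : ℝ) {e : ℝ} (he : 0 < e) : |x| ≤ (rexp (e * x) + rexp (-e * x)) / e := by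
  rw [le_div_iff₀ he]
  have h1 := Real.add_one_le_exp (e * x)
  have h2 := Real.add_one_le_exp (-e * x)
  have := Real.exp_pos (e * x)
  have := Real.exp_pos (-e * x)
  rcases abs_cases x with ⟨h, _⟩ | ⟨h, _⟩ <;> rw [h] <;> nlinarith

lemma ml_integrable_abs_exp {a : ℝ} (ha : 0 < a) :
    Integrable (fun x : ℝ => |x| * (rexp (-(rexp x)/2) * rexp (a * x))) := by
  have h1 := ml_integrable_exp (a := a + a/2) (by linarith)
  have h2 := ml_integrable_exp (a := a - a/2) (by linarith)
  refine ((h1.add h2).div_const (a/2)).mono' (by fun_prop) (Eventually.of_forall fun x => ?_)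
  have h := ml_abs_le x (half_pos ha)
  rw [Real.norm_of_nonneg (by positivity)]
  refine (mul_le_mul_of_nonneg_right h (by positivity)).trans (le_of_eq ?_)
  simp only [Pi.add_apply, add_mul, neg_mul, sub_eq_add_neg, Real.exp_add]
  ring

lemma ml_norm_exp_exp (w : ℂ) : ‖Complex.exp (Complex.exp w)‖ = rexp (rexp w.re * cos w.im) := by
  rw [Complex.norm_exp, Complex.exp_re]

lemma ml_norm_exp_exp_th (x : ℝ) :
    ‖Complex.exp (Complex.exp (x + mlTh * Complex.I))‖ = rexp (-(rexp x)/2) := by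
  rw [ml_norm_exp_exp]; simp [mlTh_cos]; ring

lemma ml_decay (a : ℝ) : Tendsto (fun x : ℝ => rexp (-(rexp x)/2) * rexp (a * x)) atTop (𝓝 0) := by
  have h := (tendsto_rpow_mul_exp_neg_mul_atTop_nhds_zero a (1/2) (by norm_num)).comp
    Real.tendsto_exp_atTop
  refine h.congr fun x => ?_
  simp only [Function.comp]
  rw [← Real.exp_mul, mul_comm]
  congr 2 <;> ring

lemma ml_norm_integrand (a : ℝ) (w : ℂ) : ‖Complex.exp (Complex.exp w) * Complex.exp (a * w)‖ =
    rexp (rexp w.re * cos w.im) * rexp (a * w.re) := by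
  rw [norm_mul, ml_norm_exp_exp, Complex.norm_exp]; simp

lemma ml_cos_le {y : ℝ} (hy : y ∈ Icc mlTh π) : cos y ≤ -(1/2) := by
  rw [← mlTh_cos]
  exact Real.cos_le_cos_of_nonneg_of_le_pi mlTh_pos.le hy.2 hy.1

lemma ml_integrable_line {a y : ℝ} (ha : 0 < a) (hy : y ∈ Icc mlTh π) :
    Integrable (fun x : ℝ => Complex.exp (Complex.exp (x + y * Complex.I)) *
      Complex.exp (a * (x + y * Complex.I))) := by
  refine (ml_integrable_exp ha).mono' (by fun_prop) (Eventually.of_forall fun x => ?_)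
  rw [ml_norm_integrand]
  simp only [Complex.add_re, Complex.ofReal_re, Complex.mul_re, Complex.I_re, Complex.ofReal_im,
    Complex.I_im, Complex.add_im, Complex.mul_im]
  have := ml_cos_le hy
  have := Real.exp_pos x
  simp only [mul_zero, sub_zero, add_zero, mul_one, zero_add]
  gcongr
  nlinarith

lemma ml_gamma_integral_pi {a : ℝ} (ha : 0 < a) :
    ∫ x : ℝ, Complex.exp (Complex.exp (x + π * Complex.I)) *
      Complex.exp (a * (x + π * Complex.I)) =
    (Real.Gamma a : ℂ) * Complex.exp (π * a * Complex.I) := by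
  have h1 := Real.Gamma_eq_integral ha
  have h2 : Ioi (0:ℝ) = rexp '' univ := by rw [Set.image_univ, Real.range_exp]
  rw [h2, integral_image_eq_integral_abs_deriv_smul MeasurableSet.univ
    (fun x _ => (Real.hasDerivAt_exp x).hasDerivWithinAt) Real.exp_injective.injOn,
    setIntegral_univ] at h1
  rw [h1, ← integral_complex_ofReal, ← integral_mul_const]
  congr 1
  ext x
  rw [abs_exp, ← Real.exp_mul, Complex.exp_add_pi_mul_I, smul_eq_mul, mul_left_comm, ← Real.exp_add]
  push_cast
  simp only [← Complex.exp_add]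
  congr 1; ring

lemma ml_vert_bound (a : ℝ) (T : ℝ) : ‖∫ y : ℝ in mlTh..π,
    Complex.exp (Complex.exp (T + y * Complex.I)) * Complex.exp (a * (T + y * Complex.I))‖ ≤
    rexp (-(rexp T)/2) * rexp (a * T) * |π - mlTh| := by
  apply intervalIntegral.norm_integral_le_of_norm_le_const
  intro y hy
  rw [uIoc_of_le mlTh_lt.le] at hy
  rw [ml_norm_integrand]
  simp only [Complex.add_re, Complex.ofReal_re, Complex.mul_re, Complex.I_re, Complex.ofReal_im,
    Complex.I_im, Complex.add_im, Complex.mul_im]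
  have := ml_cos_le (Ioc_subset_Icc_self hy)
  have := Real.exp_pos T
  simp only [mul_zero, sub_zero, add_zero, mul_one, zero_add]
  gcongr
  nlinarith

lemma ml_gamma_integral {a : ℝ} (ha : 0 < a) :
    ∫ x : ℝ, Complex.exp (Complex.exp (x + mlTh * Complex.I)) *
      Complex.exp (a * (x + mlTh * Complex.I)) =
    (Real.Gamma a : ℂ) * Complex.exp (π * a * Complex.I) := by
  rw [← ml_gamma_integral_pi ha]
  have t1 := intervalIntegral_tendsto_integral
    (ml_integrable_line ha (y := mlTh) ⟨le_rfl, mlTh_lt.le⟩)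
    (tendsto_neg_atTop_atBot (G := ℝ)) tendsto_id
  have t2 := intervalIntegral_tendsto_integral (ml_integrable_line ha (y := π) ⟨mlTh_lt.le, le_rfl⟩)
    (tendsto_neg_atTop_atBot (G := ℝ)) tendsto_id
  have t3 : Tendsto (fun T : ℝ => ∫ y : ℝ in mlTh..π,
    Complex.exp (Complex.exp (T + y * Complex.I)) * Complex.exp (a * (T + y * Complex.I)))
    atTop (𝓝 0) :=
    squeeze_zero_norm (ml_vert_bound a) (by simpa using (ml_decay a).mul_const |π - mlTh|)
  have t4 : Tendsto (fun T : ℝ => ∫ y : ℝ in mlTh..π,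
    Complex.exp (Complex.exp ((-T:ℝ) + y * Complex.I)) * Complex.exp (a * ((-T:ℝ) + y * Complex.I)))
    atTop (𝓝 0) := by
    refine squeeze_zero_norm (a := fun T => rexp (-(a * T)) * |π - mlTh|)
      (fun T => (ml_vert_bound a (-T)).trans ?_) ?_
    · have h1 : rexp (-(rexp (-T))/2) ≤ 1 := by
        rw [Real.exp_le_one_iff]; have := Real.exp_pos (-T); linarith
      have h2 : a * -T = -(a * T) := by ring
      rw [h2]
      have h3 : 0 ≤ rexp (-(a*T)) := (Real.exp_pos _).le
      gcongr
      nlinarith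
    · have : Tendsto (fun T : ℝ => rexp (-(a * T))) atTop (𝓝 0) :=
        Real.tendsto_exp_neg_atTop_nhds_zero.comp (tendsto_id.const_mul_atTop ha)
      simpa using this.mul_const |π - mlTh|
  have key : ∀ T : ℝ, _ := fun T => Complex.integral_boundary_rect_eq_zero_of_differentiableOn
    (fun w => Complex.exp (Complex.exp w) * Complex.exp (a * w)) (⟨-T, mlTh⟩ : ℂ) (⟨T, π⟩ : ℂ)
    (by fun_prop)
  have lim := ((t1.sub t2).add (t3.const_smul Complex.I)).sub (t4.const_smul Complex.I)
  have := tendsto_nhds_unique lim (tendsto_const_nhds.congr fun T => (key T).symm)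
  simp only [smul_zero, add_zero, sub_zero] at this
  exact sub_eq_zero.mp this

noncomputable def mlJ (h : ℂ → ℂ) (L : ℝ) : ℂ :=
  (∫ x : ℝ in Ioi L, h (x + mlTh * Complex.I)) -
  (∫ x : ℝ in Ioi L, h (x + (-mlTh : ℝ) * Complex.I)) +
  Complex.I * ∫ y : ℝ in (-mlTh)..mlTh, h (L + y * Complex.I)

lemma mlJ_indep {h : ℂ → ℂ} (hd : DifferentiableOn ℂ h {w | |w.im| ≤ mlTh}) {L L' : ℝ}
    (hL : L ≤ L') (h1 : IntegrableOn (fun x : ℝ => h (x + mlTh * Complex.I)) (Ioi L))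
    (h2 : IntegrableOn (fun x : ℝ => h (x + (-mlTh : ℝ) * Complex.I)) (Ioi L)) :
    mlJ h L = mlJ h L' := by
  have key := Complex.integral_boundary_rect_eq_zero_of_differentiableOn h (⟨L, -mlTh⟩ : ℂ)
    (⟨L', mlTh⟩ : ℂ) (hd.mono (by
      intro w hw
      have := hw.2
      simp only [mem_preimage] at this
      rw [uIcc_of_le (by linarith [mlTh_pos])] at this
      exact abs_le.mpr this))
  have s : Ioi L' ⊆ Ioi L := Ioi_subset_Ioi hL
  have e1 := intervalIntegral.integral_interval_add_Ioi h1 (h1.mono_set s)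
  have e2 := intervalIntegral.integral_interval_add_Ioi h2 (h2.mono_set s)
  simp only [smul_eq_mul] at key
  unfold mlJ
  rw [← e1, ← e2]
  linear_combination -key

lemma mlJ_lim {h : ℂ → ℂ} (hd : DifferentiableOn ℂ h {w | |w.im| ≤ mlTh}) (L : ℝ)
    (h1 : Integrable (fun x : ℝ => h (x + mlTh * Complex.I)))
    (h2 : Integrable (fun x : ℝ => h (x + (-mlTh : ℝ) * Complex.I)))
    (h3 : Tendsto (fun L : ℝ => ∫ y : ℝ in (-mlTh)..mlTh, h (L + y * Complex.I)) atBot (𝓝 0)) :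
    mlJ h L = (∫ x : ℝ, h (x + mlTh * Complex.I)) -
      (∫ x : ℝ, h (x + (-mlTh : ℝ) * Complex.I)) := by
  have t1 := (aecover_Ioi (μ := volume) (tendsto_id (α := ℝ) (x := atBot))).integral_tendsto_of_countably_generated h1
  have t2 := (aecover_Ioi (μ := volume) (tendsto_id (α := ℝ) (x := atBot))).integral_tendsto_of_countably_generated h2
  have t := (t1.sub t2).add (h3.const_mul Complex.I)
  rw [mul_zero, add_zero] at t
  refine tendsto_nhds_unique (tendsto_const_nhds.congr' ?_) t
  filter_upwards [eventually_le_atBot L] with L' hL'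
  exact (mlJ_indep hd hL' h1.integrableOn h2.integrableOn).symm

lemma ml_conj_int {h : ℂ → ℂ} (hc : ∀ w, h ((starRingEnd ℂ) w) = (starRingEnd ℂ) (h w)) :
    (∫ x : ℝ, h (x + (-mlTh : ℝ) * Complex.I)) =
    (starRingEnd ℂ) (∫ x : ℝ, h (x + mlTh * Complex.I)) := by
  rw [← integral_conj]
  congr 1; ext x
  rw [← hc]; simp

noncomputable def mlh (a : ℝ) (w : ℂ) : ℂ := Complex.exp (Complex.exp w) * Complex.exp (a * w)

lemma mlh_conj (a : ℝ) (w : ℂ) : mlh a ((starRingEnd ℂ) w) = (starRingEnd ℂ) (mlh a w) := by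
  simp [mlh, ← Complex.exp_conj]

@[fun_prop] lemma mlh_diff (a : ℝ) : Differentiable ℂ (mlh a) := by unfold mlh; fun_prop
@[fun_prop] lemma mlh_cont (a : ℝ) : Continuous (mlh a) := by unfold mlh; fun_prop

lemma mlh_norm (a x y : ℝ) : ‖mlh a (x + y * Complex.I)‖ = rexp (rexp x * cos y) * rexp (a * x) := by
  rw [mlh, ml_norm_integrand]; simp

lemma mlh_norm_th (a x : ℝ) : ‖mlh a (x + mlTh * Complex.I)‖ = rexp (-(rexp x)/2) * rexp (a * x) := by
  rw [mlh_norm, mlTh_cos]; congr 2; ring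

lemma mlh_norm_th' (a x : ℝ) :
    ‖mlh a (x + (-mlTh : ℝ) * Complex.I)‖ = rexp (-(rexp x)/2) * rexp (a * x) := by
  rw [mlh_norm, Real.cos_neg, mlTh_cos]; congr 2; ring

lemma mlh_norm_le (a x y : ℝ) : ‖mlh a (x + y * Complex.I)‖ ≤ rexp (rexp x) * rexp (a * x) := by
  rw [mlh_norm]; gcongr
  nlinarith [Real.exp_pos x, Real.cos_le_one y]

lemma ml_integrableOn_exp (a L : ℝ) :
    IntegrableOn (fun x : ℝ => rexp (-(rexp x)/2) * rexp (a * x)) (Ioi L) := by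
  have h := (ml_integrable_exp (a := |a| + 1) (by positivity)).integrableOn (s := Ioi L)
  refine (h.const_mul (rexp ((a - (|a|+1)) * L))).mono' (by fun_prop) ?_
  refine (ae_restrict_iff' measurableSet_Ioi).mpr (Eventually.of_forall fun x hx => ?_)
  rw [Real.norm_of_nonneg (by positivity), mul_left_comm]
  refine mul_le_mul_of_nonneg_left ?_ (Real.exp_pos _).le
  rw [← Real.exp_add, Real.exp_le_exp]
  have := le_abs_self a
  nlinarith [mem_Ioi.mp hx]

lemma mlh_intOn (a L : ℝ) : IntegrableOn (fun x : ℝ => mlh a (x + mlTh * Complex.I)) (Ioi L) :=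
  (ml_integrableOn_exp a L).mono' (by fun_prop)
    (Eventually.of_forall fun x => (mlh_norm_th a x).le)

lemma mlh_intOn' (a L : ℝ) :
    IntegrableOn (fun x : ℝ => mlh a (x + (-mlTh : ℝ) * Complex.I)) (Ioi L) :=
  (ml_integrableOn_exp a L).mono' (by fun_prop)
    (Eventually.of_forall fun x => (mlh_norm_th' a x).le)

lemma ml_arc_zero {h : ℂ → ℂ} {a C : ℝ} (ha : 0 < a)
    (hb : ∀ L y : ℝ, |y| ≤ mlTh → ‖h (L + y * Complex.I)‖ ≤ C * (rexp (rexp L) * rexp (a * L))) :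
    Tendsto (fun L : ℝ => ∫ y : ℝ in (-mlTh)..mlTh, h (L + y * Complex.I)) atBot (𝓝 0) := by
  have t : Tendsto (fun L : ℝ => C * (rexp (rexp L) * rexp (a * L)) * |mlTh - -mlTh|) atBot (𝓝 0) := by
    have t1 : Tendsto (fun L : ℝ => rexp (rexp L)) atBot (𝓝 (rexp 0)) :=
      (Real.continuous_exp.tendsto 0).comp Real.tendsto_exp_atBot
    have t2 : Tendsto (fun L : ℝ => rexp (a * L)) atBot (𝓝 0) :=
      Real.tendsto_exp_atBot.comp (tendsto_id.const_mul_atBot ha)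
    simpa using ((t1.mul t2).const_mul C).mul_const |mlTh - -mlTh|
  refine squeeze_zero_norm (fun L => ?_) t
  apply intervalIntegral.norm_integral_le_of_norm_le_const
  intro y hy
  rw [uIoc_of_le (by linarith [mlTh_pos])] at hy
  exact hb L y (abs_le.mpr ⟨hy.1.le, hy.2⟩)

lemma mlJ_pos {a : ℝ} (ha : 0 < a) (L : ℝ) :
    mlJ (mlh a) L = 2 * Complex.I * (Real.Gamma a * sin (π * a) : ℝ) := by
  have hi := (ml_integrable_exp ha)
  rw [mlJ_lim (by fun_prop) L
    (hi.mono' (by fun_prop) (Eventually.of_forall fun x => (mlh_norm_th a x).le))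
    (hi.mono' (by fun_prop) (Eventually.of_forall fun x => (mlh_norm_th' a x).le))
    (ml_arc_zero (C := 1) ha fun L y _ => by rw [one_mul]; exact mlh_norm_le a L y),
    ml_conj_int (mlh_conj a)]
  unfold mlh
  rw [ml_gamma_integral ha, Complex.sub_conj]
  have e : ((π:ℂ) * a * Complex.I) = ((π * a : ℝ) : ℂ) * Complex.I := by push_cast; ring
  rw [e, Complex.im_ofReal_mul, Complex.exp_ofReal_mul_I_im]
  push_cast; ring

lemma mlJ_lt_one {z : ℝ} (hz : 0 < z) (hz1 : z < 1) (L : ℝ) :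
    mlJ (mlh (1 - z)) L = 2 * π * Complex.I * ((1 / Real.Gamma z : ℝ) : ℂ) := by
  rw [mlJ_pos (by linarith) L]
  have h := Real.Gamma_mul_Gamma_one_sub z
  have hs : 0 < sin (π * z) := Real.sin_pos_of_pos_of_lt_pi (by positivity)
    (by nlinarith [pi_pos])
  have hG := Real.Gamma_pos_of_pos hz
  have e : Real.Gamma (1 - z) * sin (π * (1 - z)) = π * (1 / Real.Gamma z) := by
    have : π * (1 - z) = π - π * z := by ring
    rw [this, Real.sin_pi_sub]
    field_simp
    rw [eq_div_iff hs.ne'] at h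
    rw [mul_comm z π]
    linarith
  rw [e]; push_cast; ring

lemma mlh_deriv (b : ℝ) (w : ℂ) : HasDerivAt (mlh b) (mlh (b + 1) w + b * mlh b w) w := by
  unfold mlh
  have h := ((Complex.hasDerivAt_exp w).cexp).mul (((hasDerivAt_id w).const_mul (b:ℂ)).cexp)
  refine h.congr_deriv ?_
  have : Complex.exp (((b + 1 : ℝ) : ℂ) * w) = Complex.exp (b * w) * Complex.exp w := by
    rw [← Complex.exp_add]; congr 1; push_cast; ring
  rw [this]; simp only [id]; ring

lemma mlh_tendsto (b : ℝ) :
    Tendsto (fun x : ℝ => mlh b (x + mlTh * Complex.I)) atTop (𝓝 0) :=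
  squeeze_zero_norm (fun x => (mlh_norm_th b x).le) (ml_decay b)

lemma mlh_tendsto' (b : ℝ) :
    Tendsto (fun x : ℝ => mlh b (x + (-mlTh : ℝ) * Complex.I)) atTop (𝓝 0) :=
  squeeze_zero_norm (fun x => (mlh_norm_th' b x).le) (ml_decay b)

lemma mlJ_rec (b L : ℝ) : mlJ (mlh (b + 1)) L = - b * mlJ (mlh b) L := by
  have dl : ∀ c x : ℝ, HasDerivAt (fun x : ℝ => mlh b (x + c * Complex.I))
      (mlh (b + 1) (x + c * Complex.I) + b * mlh b (x + c * Complex.I)) x := fun c x => by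
    have h1 : HasDerivAt (fun x : ℝ => (x:ℂ) + c * Complex.I) 1 x := by
      simpa using (Complex.ofRealCLM.hasDerivAt (x := x)).add_const ((c:ℂ) * Complex.I)
    have h2 := (mlh_deriv b (x + c * Complex.I)).comp x h1
    rw [mul_one] at h2
    exact h2
  have e1 := integral_Ioi_of_hasDerivAt_of_tendsto' (a := L) (fun x _ => dl mlTh x)
    ((mlh_intOn (b+1) L).add ((mlh_intOn b L).const_mul b)) (mlh_tendsto b)
  have e2 := integral_Ioi_of_hasDerivAt_of_tendsto' (a := L) (fun x _ => dl (-mlTh) x)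
    ((mlh_intOn' (b+1) L).add ((mlh_intOn' b L).const_mul b)) (mlh_tendsto' b)
  have e3 := intervalIntegral.integral_eq_sub_of_hasDerivAt (a := -mlTh) (b := mlTh)
    (f := fun y : ℝ => mlh b (L + y * Complex.I))
    (f' := fun y : ℝ => (mlh (b + 1) (L + y * Complex.I) + b * mlh b (L + y * Complex.I)) * Complex.I)
    (fun y _ => by
      have h1 : HasDerivAt (fun y : ℝ => (L:ℂ) + y * Complex.I) Complex.I y := by
        simpa using ((Complex.ofRealCLM.hasDerivAt (x := y)).mul_const Complex.I).const_add (L:ℂ)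
      exact (mlh_deriv b (L + y * Complex.I)).comp y h1)
    (Continuous.intervalIntegrable (by fun_prop) _ _)
  rw [integral_add (mlh_intOn (b+1) L) ((mlh_intOn b L).const_mul b), integral_const_mul] at e1
  rw [integral_add (mlh_intOn' (b+1) L) ((mlh_intOn' b L).const_mul b), integral_const_mul] at e2
  rw [intervalIntegral.integral_mul_const, intervalIntegral.integral_add
    (Continuous.intervalIntegrable (by fun_prop) _ _)
    (Continuous.intervalIntegrable (by fun_prop) _ _), intervalIntegral.integral_const_mul] at e3
  unfold mlJ
  linear_combination e1 - e2 + e3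

lemma mlJ_one (L : ℝ) : mlJ (mlh 0) L = 2 * π * Complex.I := by
  have hm : mlJ (mlh 0) L = mlJ (mlh 0) 0 := by
    rcases le_total L 0 with h | h
    · exact mlJ_indep (by fun_prop) h (mlh_intOn 0 L) (mlh_intOn' 0 L)
    · exact (mlJ_indep (by fun_prop) h (mlh_intOn 0 0) (mlh_intOn' 0 0)).symm
  rw [hm]
  have hc : ContinuousAt (fun a : ℝ => mlJ (mlh a) 0) 0 := by
    have hev : ∀ᶠ a : ℝ in 𝓝 0, a ≤ 1 := eventually_le_nhds one_pos
    have hcont : ∀ c : ℂ, Continuous fun a : ℝ => mlh a c := fun c => by unfold mlh; fun_prop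
    have c1 : ContinuousAt (fun a : ℝ => ∫ x : ℝ in Ioi 0, mlh a (x + mlTh * Complex.I)) 0 := by
      refine continuousAt_of_dominated (bound := fun x : ℝ => rexp (-(rexp x)/2) * rexp (1 * x))
        (Eventually.of_forall fun a => by fun_prop) ?_ (ml_integrableOn_exp 1 0)
        (Eventually.of_forall fun x => (hcont _).continuousAt)
      filter_upwards [hev] with a ha
      refine (ae_restrict_iff' measurableSet_Ioi).mpr (Eventually.of_forall fun x hx => ?_)
      rw [mlh_norm_th]
      have : 0 < x := hx
      gcongr
    have c2 : ContinuousAt (fun a : ℝ => ∫ x : ℝ in Ioi 0, mlh a (x + (-mlTh:ℝ) * Complex.I)) 0 := by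
      refine continuousAt_of_dominated (bound := fun x : ℝ => rexp (-(rexp x)/2) * rexp (1 * x))
        (Eventually.of_forall fun a => by fun_prop) ?_ (ml_integrableOn_exp 1 0)
        (Eventually.of_forall fun x => (hcont _).continuousAt)
      filter_upwards [hev] with a ha
      refine (ae_restrict_iff' measurableSet_Ioi).mpr (Eventually.of_forall fun x hx => ?_)
      rw [mlh_norm_th']
      have : 0 < x := hx
      gcongr
    have c3 : Continuous (fun a : ℝ => ∫ y : ℝ in (-mlTh)..mlTh, mlh a ((0:ℝ) + y * Complex.I)) := by
      apply intervalIntegral.continuous_parametric_intervalIntegral_of_continuous'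
      unfold mlh Function.uncurry
      fun_prop
    exact (c1.sub c2).add (c3.continuousAt.const_mul Complex.I)
  have t1 : Tendsto (fun a : ℝ => mlJ (mlh a) 0) (𝓝[>] 0) (𝓝 (mlJ (mlh 0) 0)) :=
    hc.tendsto.mono_left nhdsWithin_le_nhds
  have t2 : Tendsto (fun a : ℝ => 2 * π * Complex.I * ((1 / Real.Gamma (1 - a) : ℝ) : ℂ)) (𝓝[>] 0)
      (𝓝 (2 * π * Complex.I * ((1 / Real.Gamma (1 - 0) : ℝ) : ℂ))) := by
    have hG : ContinuousAt Real.Gamma (1 - 0) := (Real.differentiableAt_Gamma (fun m => by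
      have : (0:ℝ) ≤ m := m.cast_nonneg
      linarith)).continuousAt
    have : ContinuousAt (fun a : ℝ => 1 / Real.Gamma (1 - a)) 0 := by
      refine ContinuousAt.div continuousAt_const ?_ (by simp)
      exact ContinuousAt.comp (f := fun a : ℝ => 1 - a) hG (by fun_prop)
    exact ((Complex.continuous_ofReal.continuousAt.comp this).const_mul _).tendsto.mono_left
      nhdsWithin_le_nhds
  have := tendsto_nhds_unique t1 (t2.congr' (by
    filter_upwards [Ioo_mem_nhdsGT one_pos] with a ha
    rw [← mlJ_lt_one (z := 1 - a) (by linarith [ha.2]) (by linarith [ha.1]) 0]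
    congr 2; ring))
  rw [this]; simp

lemma mlJ_hankel {z : ℝ} (hz : 0 < z) (L : ℝ) :
    mlJ (mlh (1 - z)) L = 2 * π * Complex.I * ((1 / Real.Gamma z : ℝ) : ℂ) := by
  have : ∀ n : ℕ, ∀ z : ℝ, 0 < z → z ≤ n + 1 →
      mlJ (mlh (1 - z)) L = 2 * π * Complex.I * ((1 / Real.Gamma z : ℝ) : ℂ) := by
    intro n
    induction n with
    | zero =>
      intro z hz hz1
      rcases eq_or_lt_of_le hz1 with h | h
      · simp only [Nat.cast_zero, zero_add] at h
        rw [h]; simp [mlJ_one]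
      · exact mlJ_lt_one hz (by simpa using h) L
    | succ n ih =>
      intro z hz hz1
      by_cases h : z ≤ n + 1
      · exact ih z hz h
      · have hz' : 0 < z - 1 := by have : (0:ℝ) ≤ n := n.cast_nonneg
                                   linarith
        have h1 := ih (z - 1) hz' (by push_cast at hz1; linarith)
        have h2 := mlJ_rec (1 - z) L
        have e : 1 - (z - 1) = 1 - z + 1 := by ring
        rw [e, h2] at h1
        have h3 := Real.Gamma_add_one hz'.ne'
        rw [sub_add_cancel] at h3
        rw [h3]
        have hG := (Real.Gamma_pos_of_pos hz').ne'
        have hGc : (Real.Gamma (z - 1) : ℂ) ≠ 0 := by exact_mod_cast hG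
        have hzc : ((z : ℂ) - 1) ≠ 0 := by exact_mod_cast hz'.ne'
        push_cast at h1 ⊢
        have h4 : ((z:ℂ) - 1) * mlJ (mlh (1 - z)) L = 2 * π * Complex.I * (1 / Real.Gamma (z - 1)) := by
          rw [← h1]; ring
        apply mul_left_cancel₀ hzc
        rw [h4]; field_simp
  obtain ⟨n, hn⟩ := exists_nat_ge z
  exact this n z hz (by linarith)

lemma mlJ_hasSum {F : ℕ → ℂ → ℂ} {f : ℂ → ℂ} {L M : ℝ} {B : ℝ → ℝ} (hF : ∀ k, Continuous (F k))
    (hB : IntegrableOn B (Ioi L))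
    (h1 : ∀ k, ∀ x : ℝ, L < x → ‖F k (x + mlTh * Complex.I)‖ ≤ B x * (1/2)^k)
    (h2 : ∀ k, ∀ x : ℝ, L < x → ‖F k (x + (-mlTh:ℝ) * Complex.I)‖ ≤ B x * (1/2)^k)
    (h3 : ∀ k, ∀ y : ℝ, ‖F k (L + y * Complex.I)‖ ≤ M * (1/2)^k)
    (hs : ∀ w : ℂ, L ≤ w.re → HasSum (fun k => F k w) (f w)) :
    HasSum (fun k => mlJ (F k) L) (mlJ f L) := by
  have hg : Summable (fun k : ℕ => (1/2:ℝ)^k) := summable_geometric_two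
  have hbs : ∀ x : ℝ, Summable (fun k : ℕ => B x * (1/2:ℝ)^k) := fun x => hg.mul_left _
  have hbi : IntegrableOn (fun x => ∑' k : ℕ, B x * (1/2:ℝ)^k) (Ioi L) := by
    simp_rw [tsum_mul_left]; exact hB.mul_const _
  refine HasSum.add (HasSum.sub ?_ ?_) (HasSum.mul_left _ ?_)
  · refine hasSum_integral_of_dominated_convergence (fun k x => B x * (1/2)^k)
      (fun k => by have := hF k; fun_prop)
      (fun k => (ae_restrict_iff' measurableSet_Ioi).mpr (Eventually.of_forall fun x hx => h1 k x hx))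
      (Eventually.of_forall hbs) hbi
      ((ae_restrict_iff' measurableSet_Ioi).mpr (Eventually.of_forall fun x hx => hs _ ?_))
    simpa using (mem_Ioi.mp hx).le
  · refine hasSum_integral_of_dominated_convergence (fun k x => B x * (1/2)^k)
      (fun k => by have := hF k; fun_prop)
      (fun k => (ae_restrict_iff' measurableSet_Ioi).mpr (Eventually.of_forall fun x hx => h2 k x hx))
      (Eventually.of_forall hbs) hbi
      ((ae_restrict_iff' measurableSet_Ioi).mpr (Eventually.of_forall fun x hx => hs _ ?_))
    simpa using (mem_Ioi.mp hx).le
  · refine intervalIntegral.hasSum_integral_of_dominated_convergence (fun k _ => M * (1/2)^k)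
      (fun k => by have := hF k; fun_prop)
      (fun k => Eventually.of_forall fun y _ => h3 k y)
      (Eventually.of_forall fun _ _ => hg.mul_left _) ?_
      (Eventually.of_forall fun y _ => hs _ (by simp))
    exact continuous_const.intervalIntegrable _ _

lemma ml_denom {ρ x y lam : ℝ} (h0 : 0 ≤ ρ) (hρ : ρ ≤ 5/4) (hy : |y| ≤ mlTh) (hl : 0 < lam) :
    lam / 2 ≤ ‖Complex.exp (ρ * (x + y * Complex.I)) + lam‖ := by
  have hc : -(√3/2) ≤ cos (ρ * y) := by
    rw [← Real.cos_abs (ρ * y), abs_mul, abs_of_nonneg h0]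
    have e : -(√3/2) = cos (π - π/6) := by rw [Real.cos_pi_sub, Real.cos_pi_div_six]
    rw [e]
    have hb : ρ * |y| ≤ 5/4 * (2 * π / 3) := by
      have : |y| ≤ 2 * π / 3 := hy
      gcongr
    apply Real.cos_le_cos_of_nonneg_of_le_pi (by positivity)
    · linarith [pi_pos]
    · linarith
  set r := rexp (ρ * x) with hr
  have hrp : 0 < r := Real.exp_pos _
  have e : Complex.exp (ρ * (x + y * Complex.I)) = r * Complex.exp ((ρ * y : ℝ) * Complex.I) := by
    rw [hr, Complex.ofReal_exp, ← Complex.exp_add]; congr 1; push_cast; ring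
  rw [e]
  refine (sq_le_sq₀ (by positivity) (norm_nonneg _)).mp ?_
  rw [← Complex.normSq_eq_norm_sq, Complex.normSq_apply]
  simp only [Complex.add_re, Complex.add_im, Complex.re_ofReal_mul, Complex.im_ofReal_mul,
    Complex.exp_ofReal_mul_I_re, Complex.exp_ofReal_mul_I_im, Complex.ofReal_re, Complex.ofReal_im]
  have h3 : √3 ^ 2 = 3 := Real.sq_sqrt (by norm_num)
  have hsc := Real.sin_sq_add_cos_sq (ρ * y)
  have : 0 ≤ r * lam * (cos (ρ * y) + √3/2) := by
    apply mul_nonneg (by positivity); linarith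
  have h5 : (√3 / 2 * lam) ^ 2 = 3/4 * lam^2 := by rw [mul_pow, div_pow, h3]; ring
  have h6 : r^2 * (sin (ρ * y) ^ 2 + cos (ρ * y) ^ 2) = r^2 := by rw [hsc, mul_one]
  have h7 := sq_nonneg (r - √3/2 * lam)
  have h8 : (r - √3/2 * lam)^2 = r^2 - √3 * r * lam + (√3 / 2 * lam) ^ 2 := by ring
  rw [h8, h5] at h7
  linarith [h6, h7, this]

noncomputable def mlg (ρ lam : ℝ) (w : ℂ) : ℂ := mlh 1 w / (Complex.exp (ρ * w) + lam)

lemma mlg_conj (ρ lam : ℝ) (w : ℂ) :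
    mlg ρ lam ((starRingEnd ℂ) w) = (starRingEnd ℂ) (mlg ρ lam w) := by
  rw [mlg, mlg, mlh_conj]; simp [← Complex.exp_conj]

lemma mlg_norm_le {ρ x y lam : ℝ} (h0 : 0 ≤ ρ) (hρ : ρ ≤ 5/4) (hy : |y| ≤ mlTh) (hl : 0 < lam) :
    ‖mlg ρ lam (x + y * Complex.I)‖ ≤ (2 / lam) * ‖mlh 1 (x + y * Complex.I)‖ := by
  have h := ml_denom (x := x) h0 hρ hy hl
  rw [mlg, norm_div]
  have e : (2 / lam) * ‖mlh 1 (x + y * Complex.I)‖ = ‖mlh 1 (x + y * Complex.I)‖ / (lam / 2) := by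
    field_simp
  rw [e]; gcongr

lemma mlg_diffOn {ρ lam : ℝ} (h0 : 0 ≤ ρ) (hρ : ρ ≤ 5/4) (hl : 0 < lam) :
    DifferentiableOn ℂ (mlg ρ lam) {w | |w.im| ≤ mlTh} := by
  unfold mlg
  refine DifferentiableOn.div (by fun_prop) (by fun_prop) fun w hw => ?_
  have h := ml_denom (x := w.re) (y := w.im) h0 hρ hw hl
  rw [Complex.re_add_im] at h
  exact norm_pos_iff.mp (by linarith)

lemma mlg_meas (ρ lam y : ℝ) : AEStronglyMeasurable (fun x : ℝ => mlg ρ lam (x + y * Complex.I)) := by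
  apply Measurable.aestronglyMeasurable
  unfold mlg mlh
  fun_prop

lemma mlg_int {ρ lam : ℝ} (h0 : 0 ≤ ρ) (hρ : ρ ≤ 5/4) (hl : 0 < lam) :
    Integrable (fun x : ℝ => mlg ρ lam (x + mlTh * Complex.I)) := by
  refine ((ml_integrable_exp one_pos).const_mul (2/lam)).mono' (mlg_meas _ _ _)
    (Eventually.of_forall fun x => ?_)
  rw [← mlh_norm_th]
  exact mlg_norm_le h0 hρ (abs_of_pos mlTh_pos).le hl

lemma mlg_int' {ρ lam : ℝ} (h0 : 0 ≤ ρ) (hρ : ρ ≤ 5/4) (hl : 0 < lam) :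
    Integrable (fun x : ℝ => mlg ρ lam (x + (-mlTh:ℝ) * Complex.I)) := by
  refine ((ml_integrable_exp one_pos).const_mul (2/lam)).mono' (mlg_meas _ _ _)
    (Eventually.of_forall fun x => ?_)
  rw [← mlh_norm_th']
  exact mlg_norm_le h0 hρ (by rw [abs_neg, abs_of_pos mlTh_pos]) hl

lemma mlJ_const_mul (c : ℂ) (h : ℂ → ℂ) (L : ℝ) : mlJ (fun w => c * h w) L = c * mlJ h L := by
  unfold mlJ
  simp only [integral_const_mul, intervalIntegral.integral_const_mul]
  ring

lemma ml_repr {ρ lam : ℝ} (h0 : 0 < ρ) (hρ : ρ ≤ 5/4) (hl : 0 < lam) :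
    mittagLeffler ρ ρ (-lam) = (1 / π) * (∫ x : ℝ, mlg ρ lam (x + mlTh * Complex.I)).im := by
  obtain ⟨L, hL⟩ : ∃ L : ℝ, lam * rexp (-ρ * L) ≤ 1/2 := by
    refine ⟨Real.log (2 * lam) / ρ, ?_⟩
    have : -ρ * (Real.log (2 * lam) / ρ) = - Real.log (2 * lam) := by field_simp
    rw [this, Real.exp_neg, Real.exp_log (by positivity)]
    apply le_of_eq; field_simp
  have hx : ∀ x : ℝ, L ≤ x → lam * rexp (-ρ * x) ≤ 1/2 := fun x hx =>
    le_trans (by gcongr lam * rexp ?_; nlinarith) hL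
  have hfac : ∀ (k : ℕ) (w : ℂ), (-lam : ℂ)^k * mlh (1 - (ρ * k + ρ)) w =
      mlh (1 - ρ) w * (-(lam * Complex.exp (-ρ * w)))^k := by
    intro k w
    rw [neg_pow, neg_pow (lam * Complex.exp (-ρ * w)), mul_pow, ← Complex.exp_nat_mul, mlh, mlh]
    have : Complex.exp (((1 - (ρ * k + ρ) : ℝ):ℂ) * w) =
        Complex.exp (((1 - ρ : ℝ) : ℂ) * w) * Complex.exp (k * (-ρ * w)) := by
      rw [← Complex.exp_add]; congr 1; push_cast; ring
    rw [this]; ring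
  have hn : ∀ w : ℂ, ‖-(lam * Complex.exp (-ρ * w))‖ = lam * rexp (-ρ * w.re) := by
    intro w
    rw [norm_neg, norm_mul, Complex.norm_exp, Complex.norm_real, Real.norm_of_nonneg hl.le]
    simp
  have hnF : ∀ (k : ℕ) (w : ℂ), L ≤ w.re → ‖(-lam : ℂ)^k * mlh (1 - (ρ * k + ρ)) w‖ ≤
      ‖mlh (1 - ρ) w‖ * (1/2)^k := by
    intro k w hw
    rw [hfac, norm_mul, norm_pow, hn]
    have := hx _ hw
    gcongr
  have key : HasSum (fun k : ℕ => mlJ (fun w => (-lam : ℂ)^k * mlh (1 - (ρ * k + ρ)) w) L)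
      (mlJ (mlg ρ lam) L) := by
    refine mlJ_hasSum (B := fun x => rexp (-(rexp x)/2) * rexp ((1 - ρ) * x))
      (M := rexp (rexp L) * rexp ((1 - ρ) * L)) (fun k => by fun_prop) (ml_integrableOn_exp _ _)
      ?_ ?_ ?_ ?_
    · intro k x hx
      rw [← mlh_norm_th]
      exact hnF k _ (by simpa using hx.le)
    · intro k x hx
      rw [← mlh_norm_th']
      exact hnF k _ (by simpa using hx.le)
    · intro k y
      refine (hnF k _ (by simp)).trans ?_
      gcongr
      exact mlh_norm_le _ _ _
    · intro w hw
      simp_rw [hfac]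
      have hlt : ‖-(lam * Complex.exp (-ρ * w))‖ < 1 := by
        rw [hn]; linarith [hx _ hw]
      have := (hasSum_geometric_of_norm_lt_one hlt).mul_left (mlh (1 - ρ) w)
      have e0 : Complex.exp (ρ * w) * Complex.exp (-ρ * w) = 1 := by
        rw [← Complex.exp_add]; simp
      have e1 : mlh 1 w = mlh (1 - ρ) w * Complex.exp (ρ * w) := by
        simp only [mlh, ← Complex.exp_add]; congr 1; push_cast; ring
      have e2 : Complex.exp (ρ * w) + lam = Complex.exp (ρ * w) * (1 - -(lam * Complex.exp (-ρ * w))) := by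
        linear_combination -lam * e0
      have e3 : mlg ρ lam w = mlh (1 - ρ) w * (1 - -(lam * Complex.exp (-ρ * w)))⁻¹ := by
        unfold mlg
        rw [e1, e2, mul_comm (mlh _ _), mul_div_mul_left _ _ (Complex.exp_ne_zero _), div_eq_mul_inv]
      rw [e3]; exact this
  rw [mlJ_lim (mlg_diffOn h0.le hρ hl) L (mlg_int h0.le hρ hl) (mlg_int' h0.le hρ hl)
    (ml_arc_zero (a := 1) (C := 2 / lam) one_pos fun L y hy =>
      (mlg_norm_le h0.le hρ hy hl).trans (by gcongr; exact mlh_norm_le 1 L y)),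
    ml_conj_int (mlg_conj ρ lam), Complex.sub_conj] at key
  have key2 := key.mul_left (1 / (2 * π * Complex.I))
  have hpi : (π : ℂ) ≠ 0 := by exact_mod_cast pi_ne_zero
  have key3 : HasSum (fun k : ℕ => (((-lam) ^ k / Real.Gamma (ρ * k + ρ) : ℝ) : ℂ))
      (((1 / π) * (∫ x : ℝ, mlg ρ lam (x + mlTh * Complex.I)).im : ℝ) : ℂ) := by
    have ea : (fun k : ℕ => (((-lam) ^ k / Real.Gamma (ρ * k + ρ) : ℝ) : ℂ)) = fun k : ℕ =>
        1 / (2 * π * Complex.I) * mlJ (fun w => (-lam : ℂ)^k * mlh (1 - (ρ * k + ρ)) w) L := by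
      ext k
      have hz : 0 < ρ * k + ρ := by positivity
      rw [mlJ_const_mul, mlJ_hankel hz]
      push_cast
      field_simp
    have eb : (((1 / π) * (∫ x : ℝ, mlg ρ lam (x + mlTh * Complex.I)).im : ℝ) : ℂ) =
        1 / (2 * π * Complex.I) *
          (((2 * (∫ x : ℝ, mlg ρ lam (x + mlTh * Complex.I)).im : ℝ) : ℂ) * Complex.I) := by
      generalize (∫ x : ℝ, mlg ρ lam (x + mlTh * Complex.I)).im = q
      push_cast
      field_simp
    rw [ea, eb]
    exact key2
  rw [mittagLeffler]
  exact (Complex.hasSum_ofReal.mp key3).tsum_eq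

noncomputable def mlKap (x : ℝ) : ℝ := rexp (-(rexp x)/2) * rexp (1 * x) + rexp (-(rexp x)/2) * rexp (4 * x)

lemma mlKap_nonneg (x : ℝ) : 0 ≤ mlKap x := by unfold mlKap; positivity

lemma mlKap_int : Integrable mlKap :=
  (ml_integrable_exp one_pos).add (ml_integrable_exp (by norm_num))

lemma mlKap_int_abs : Integrable (fun x => |x| * mlKap x) := by
  refine ((ml_integrable_abs_exp one_pos).add (ml_integrable_abs_exp (a := 4) (by norm_num))).congr
    (Eventually.of_forall fun x => ?_)
  simp only [Pi.add_apply, mlKap]; ring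

/-- the variable `log s` shifted -/
noncomputable def mlEll (s x : ℝ) : ℂ := ((x - s : ℝ) : ℂ) + mlTh * Complex.I

lemma mlEll_norm (s x : ℝ) (hs : 0 ≤ s) : ‖mlEll s x‖ ≤ |x| + (s + 3) := by
  unfold mlEll
  refine (norm_add_le _ _).trans ?_
  rw [norm_mul, Complex.norm_I, Complex.norm_real, Complex.norm_real, Real.norm_eq_abs, Real.norm_eq_abs,
    abs_of_pos mlTh_pos, mul_one]
  have h1 : |x - s| ≤ |x| + s := (abs_sub x s).trans (by rw [abs_of_nonneg hs])
  have h2 : mlTh ≤ 3 := by unfold mlTh; linarith [pi_lt_d2]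
  linarith

lemma mlY_norm (ρ s x : ℝ) : ‖Complex.exp (ρ * mlEll s x)‖ = rexp (ρ * (x - s)) := by
  rw [Complex.norm_exp]; simp [mlEll]

lemma mlY_denom {ρ s x lam : ℝ} (h0 : 0 ≤ ρ) (hρ : ρ ≤ 5/4) (hl : 0 < lam) :
    lam / 2 ≤ ‖Complex.exp (ρ * mlEll s x) + lam‖ :=
  ml_denom h0 hρ (abs_of_pos mlTh_pos).le hl

noncomputable def mlN (lam s ρ x : ℝ) : ℂ := mlh 1 (x + mlTh * Complex.I) *
  (Complex.exp (ρ * mlEll s x) ^ 2 / (Complex.exp (ρ * mlEll s x) + lam))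

noncomputable def mlN' (lam s ρ x : ℝ) : ℂ := mlh 1 (x + mlTh * Complex.I) *
  (mlEll s x * Complex.exp (ρ * mlEll s x) ^ 2 * (Complex.exp (ρ * mlEll s x) + 2 * lam) /
    (Complex.exp (ρ * mlEll s x) + lam) ^ 2)

lemma mlN_meas (lam s ρ : ℝ) : AEStronglyMeasurable (mlN lam s ρ) := by
  apply Measurable.aestronglyMeasurable
  unfold mlN mlh mlEll
  fun_prop

lemma mlN'_meas (lam s ρ : ℝ) : AEStronglyMeasurable (mlN' lam s ρ) := by
  apply Measurable.aestronglyMeasurable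
  unfold mlN' mlh mlEll
  fun_prop

lemma mlY_sq {ρ s x : ℝ} (h0 : 0 ≤ ρ) (hρ : ρ ≤ 5/4) :
    ‖mlh 1 (x + mlTh * Complex.I)‖ * rexp (ρ * (x - s)) ^ 2 ≤ rexp (-2 * ρ * s) * mlKap x := by
  rw [mlh_norm_th, ← Real.exp_nat_mul]
  have e : rexp ((2:ℕ) * (ρ * (x - s))) = rexp (-2 * ρ * s) * rexp (2 * ρ * x) := by
    rw [← Real.exp_add]; congr 1; push_cast; ring
  have h : rexp (2 * ρ * x) ≤ 1 + rexp (3 * x) := by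
    rcases le_total x 0 with hx | hx
    · have : rexp (2 * ρ * x) ≤ 1 := Real.exp_le_one_iff.mpr (by nlinarith)
      linarith [Real.exp_pos (3 * x)]
    · have : rexp (2 * ρ * x) ≤ rexp (3 * x) := Real.exp_le_exp.mpr (by nlinarith)
      linarith
  have e2 : mlKap x = rexp (-(rexp x)/2) * rexp (1 * x) * (1 + rexp (3 * x)) := by
    have : rexp (4 * x) = rexp (1 * x) * rexp (3 * x) := by rw [← Real.exp_add]; congr 1; ring
    rw [mlKap, this]; ring
  rw [e, e2]
  calc _ = rexp (-2 * ρ * s) * (rexp (-(rexp x)/2) * rexp (1 * x) * rexp (2 * ρ * x)) := by ring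
    _ ≤ _ := by gcongr

lemma mlN_bound {lam s ρ : ℝ} (h0 : 0 ≤ ρ) (hρ : ρ ≤ 5/4) (hl : 0 < lam) (x : ℝ) :
    ‖mlN lam s ρ x‖ ≤ rexp (-2 * ρ * s) * (2 / lam) * mlKap x := by
  have hd := mlY_denom (s := s) (x := x) h0 hρ hl
  have h := mlY_sq (s := s) (x := x) h0 hρ
  rw [mlN, norm_mul, norm_div, norm_pow, mlY_norm]
  calc _ ≤ ‖mlh 1 (x + mlTh * Complex.I)‖ * (rexp (ρ * (x - s)) ^ 2 / (lam / 2)) := by gcongr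
    _ = (‖mlh 1 (x + mlTh * Complex.I)‖ * rexp (ρ * (x - s)) ^ 2) * (2 / lam) := by field_simp
    _ ≤ (rexp (-2 * ρ * s) * mlKap x) * (2 / lam) := by gcongr
    _ = _ := by ring

lemma mlN'_bound {lam s ρ : ℝ} (h0 : 0 ≤ ρ) (hρ : ρ ≤ 5/4) (hl : 0 < lam) (hs : 0 ≤ s) (x : ℝ) :
    ‖mlN' lam s ρ x‖ ≤ rexp (-2 * ρ * s) * (6 / lam) * (|x| * mlKap x + (s + 3) * mlKap x) := by
  have hd := mlY_denom (s := s) (x := x) h0 hρ hl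
  have h := mlY_sq (s := s) (x := x) h0 hρ
  have hL := mlEll_norm s x hs
  rw [mlN', norm_mul, norm_div, norm_mul, norm_mul, norm_pow, norm_pow, mlY_norm]
  set D := ‖Complex.exp (ρ * mlEll s x) + lam‖ with hD
  have hDp : 0 < D := by linarith
  have h1 : ‖Complex.exp (ρ * mlEll s x) + 2 * lam‖ ≤ 3 * D := by
    have : Complex.exp (ρ * mlEll s x) + 2 * lam = (Complex.exp (ρ * mlEll s x) + lam) + lam := by ring
    rw [this]
    refine (norm_add_le _ _).trans ?_
    rw [Complex.norm_real, Real.norm_of_nonneg hl.le]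
    linarith
  have hk := mlKap_nonneg x
  calc _ ≤ ‖mlh 1 (x + mlTh * Complex.I)‖ *
        ((|x| + (s + 3)) * rexp (ρ * (x - s)) ^ 2 * (3 * D) / D ^ 2) := by gcongr
    _ = (‖mlh 1 (x + mlTh * Complex.I)‖ * rexp (ρ * (x - s)) ^ 2) * (|x| + (s + 3)) * (3 / D) := by
        field_simp
    _ ≤ (rexp (-2 * ρ * s) * mlKap x) * (|x| + (s + 3)) * (3 / (lam / 2)) := by gcongr
    _ = _ := by field_simp; ring

lemma mlN_deriv {lam s ρ : ℝ} (h0 : 0 ≤ ρ) (hρ : ρ ≤ 5/4) (hl : 0 < lam) (x : ℝ) :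
    HasDerivAt (fun ρ => mlN lam s ρ x) (mlN' lam s ρ x) ρ := by
  have hd := mlY_denom (s := s) (x := x) h0 hρ hl
  have hne : Complex.exp (ρ * mlEll s x) + lam ≠ 0 := norm_pos_iff.mp (by linarith)
  have h1 : HasDerivAt (fun ρ : ℝ => Complex.exp (ρ * mlEll s x))
      (Complex.exp (ρ * mlEll s x) * mlEll s x) ρ := by
    have := ((Complex.ofRealCLM.hasDerivAt (x := ρ)).mul_const (mlEll s x)).cexp
    simpa using this
  have h2 := ((h1.pow 2).div (h1.add_const (lam:ℂ)) hne).const_mul (mlh 1 (x + mlTh * Complex.I))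
  refine h2.congr_deriv ?_
  unfold mlN'
  congr 1
  simp only [Pi.pow_apply]
  push_cast
  congr 1
  ring

lemma mlR_deriv : ∃ K : ℝ, 0 ≤ K ∧ ∀ lam s ρ : ℝ, 0 < lam → 0 ≤ s → ρ ∈ Ioo (0:ℝ) (5/4) →
    ∃ R' : ℝ, HasDerivAt (fun ρ => (1 / π) * (∫ x, mlN lam s ρ x).im) R' ρ ∧
      |R'| ≤ K * (1 + s) * rexp (-2 * ρ * s) / lam := by
  set K1 := ∫ x, |x| * mlKap x with hK1
  set K0 := ∫ x, mlKap x with hK0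
  have hK1n : 0 ≤ K1 := integral_nonneg fun x => mul_nonneg (abs_nonneg _) (mlKap_nonneg x)
  have hK0n : 0 ≤ K0 := integral_nonneg fun x => mlKap_nonneg x
  refine ⟨6 * (K1 + 3 * K0), by positivity, fun lam s ρ hl hs hρ => ?_⟩
  have hbi : ∀ c : ℝ, Integrable (fun x => c * (|x| * mlKap x + (s + 3) * mlKap x)) := fun c =>
    (mlKap_int_abs.add (mlKap_int.const_mul _)).const_mul c
  have hmain := hasDerivAt_integral_of_dominated_loc_of_deriv_le (μ := volume)
    (F := fun ρ x => mlN lam s ρ x)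
    (F' := fun ρ x => mlN' lam s ρ x) (x₀ := ρ)
    (s := Ioo 0 (5/4)) (bound := fun x => (6 / lam) * (|x| * mlKap x + (s + 3) * mlKap x))
    (Ioo_mem_nhds hρ.1 hρ.2) (Eventually.of_forall fun r => mlN_meas lam s r)
    ((mlKap_int.const_mul _).mono' (mlN_meas lam s ρ)
      (Eventually.of_forall (mlN_bound hρ.1.le hρ.2.le hl)))
    (mlN'_meas lam s ρ)
    (Eventually.of_forall fun x r hr => (mlN'_bound hr.1.le hr.2.le hl hs x).trans (by
      have : rexp (-2 * r * s) ≤ 1 := Real.exp_le_one_iff.mpr (by nlinarith [mul_nonneg hr.1.le hs])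
      have hk := mlKap_nonneg x
      have : rexp (-2 * r * s) * (6 / lam) ≤ 1 * (6 / lam) := by gcongr
      rw [one_mul] at this
      gcongr))
    (hbi _)
    (Eventually.of_forall fun x r hr => mlN_deriv hr.1.le hr.2.le hl x)
  have him : HasDerivAt (fun ρ => (∫ x, mlN lam s ρ x).im) (∫ x, mlN' lam s ρ x).im ρ :=
    (Complex.imCLM.hasFDerivAt.comp_hasDerivAt ρ hmain.2)
  refine ⟨_, him.const_mul (1 / π), ?_⟩
  have hb : ‖∫ x, mlN' lam s ρ x‖ ≤ rexp (-2 * ρ * s) * (6 / lam) * (K1 + (s + 3) * K0) := by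
    refine (norm_integral_le_of_norm_le (hbi _)
      (Eventually.of_forall (mlN'_bound hρ.1.le hρ.2.le hl hs))).trans (le_of_eq ?_)
    rw [integral_const_mul, integral_add mlKap_int_abs (mlKap_int.const_mul _), integral_const_mul]
  have hpi : 1 / π ≤ 1 := by
    rw [div_le_one pi_pos]; linarith [pi_gt_three]
  rw [abs_mul, abs_of_pos (by positivity)]
  calc 1 / π * |(∫ x, mlN' lam s ρ x).im| ≤ 1 * (rexp (-2 * ρ * s) * (6 / lam) * (K1 + (s + 3) * K0)) := by
        gcongr
        exact (Complex.abs_im_le_norm _).trans hb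
    _ ≤ 1 * (rexp (-2 * ρ * s) * (6 / lam) * ((K1 + 3 * K0) * (1 + s))) := by
        gcongr; nlinarith [mul_nonneg hK1n hs, mul_nonneg hK0n hs]
    _ = _ := by ring

noncomputable def mlGam (ρ : ℝ) : ℝ := Real.Gamma (1 + ρ) * sin (π * ρ) / π

noncomputable def mlF (lam t ρ : ℝ) : ℝ := t ^ (ρ - 1) * mittagLeffler ρ ρ (-(lam * t ^ ρ))

lemma mlF_split {lam t ρ : ℝ} (hl : 0 < lam) (ht : 0 < t) (hρ : ρ ∈ Ioo (0:ℝ) (5/4)) :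
    mlF lam t ρ = 1 / (t * lam ^ 2) * (rexp (-ρ * log t) * mlGam ρ +
      (1 / π) * (∫ x, mlN lam (log t) ρ x).im) := by
  have htp : 0 < t ^ ρ := rpow_pos_of_pos ht ρ
  have hlc : (lam : ℂ) ≠ 0 := by exact_mod_cast hl.ne'
  have hpt : ∀ x : ℝ, mlg ρ (lam * t ^ ρ) (x + mlTh * Complex.I) =
      ((rexp (-ρ * log t) / lam ^ 2 : ℝ) : ℂ) * (lam * mlh 1 (x + mlTh * Complex.I) -
        ((rexp (-ρ * log t) : ℝ) : ℂ) * mlh (1 + ρ) (x + mlTh * Complex.I) + mlN lam (log t) ρ x) := by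
    intro x
    have hd := mlY_denom (s := log t) (x := x) hρ.1.le hρ.2.le hl
    have hne : Complex.exp (ρ * mlEll (log t) x) + lam ≠ 0 := norm_pos_iff.mp (by linarith)
    set Y := Complex.exp (ρ * mlEll (log t) x) with hY
    have e1 : ((rexp (-ρ * log t) : ℝ) : ℂ) * Complex.exp (ρ * (x + mlTh * Complex.I)) = Y := by
      rw [hY, Complex.ofReal_exp, ← Complex.exp_add, mlEll]; congr 1; push_cast; ring
    have e2 : ((rexp (-ρ * log t) : ℝ) : ℂ) * (t ^ ρ : ℝ) = 1 := by
      rw [← Complex.ofReal_mul, Real.rpow_def_of_pos ht, ← Real.exp_add]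
      have : -ρ * log t + log t * ρ = 0 := by ring
      rw [this]; simp
    have e3 : mlh (1 + ρ) (x + mlTh * Complex.I) =
        mlh 1 (x + mlTh * Complex.I) * Complex.exp (ρ * (x + mlTh * Complex.I)) := by
      simp only [mlh, ← Complex.exp_add]; congr 1; push_cast; ring
    set q : ℂ := ((rexp (-ρ * log t) : ℝ) : ℂ) with hq
    have hq0 : q ≠ 0 := by rw [hq]; exact_mod_cast (Real.exp_pos _).ne'
    have e4 : Complex.exp (ρ * (x + mlTh * Complex.I)) + ((lam * t ^ ρ : ℝ) : ℂ) = (Y + lam) / q := by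
      rw [eq_div_iff hq0, Complex.ofReal_mul]
      linear_combination e1 + lam * e2
    rw [mlg, e4, mlN, ← hY, Complex.ofReal_div, ← hq, Complex.ofReal_pow, e3]
    generalize mlh 1 (x + mlTh * Complex.I) = m
    have e5 : q * (m * Complex.exp (ρ * (x + mlTh * Complex.I))) = m * Y := by
      rw [← e1]; ring
    rw [e5]
    field_simp
    ring
  have i1 : Integrable (fun x : ℝ => mlh 1 (x + mlTh * Complex.I)) :=
    (ml_integrable_exp one_pos).mono' (by fun_prop) (Eventually.of_forall fun x => (mlh_norm_th 1 x).le)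
  have h1ρ : 0 < 1 + ρ := by linarith [hρ.1]
  have i2 : Integrable (fun x : ℝ => mlh (1+ρ) (x + mlTh * Complex.I)) :=
    (ml_integrable_exp h1ρ).mono' (by fun_prop)
      (Eventually.of_forall fun x => (mlh_norm_th (1+ρ) x).le)
  have i3 : Integrable (mlN lam (log t) ρ) := (mlKap_int.const_mul _).mono' (mlN_meas lam (log t) ρ)
      (Eventually.of_forall (mlN_bound hρ.1.le hρ.2.le hl))
  have g1 : (∫ x : ℝ, mlh 1 (x + mlTh * Complex.I)).im = 0 := by
    have := ml_gamma_integral one_pos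
    unfold mlh
    rw [this]; simp
  have g2 : (∫ x : ℝ, mlh (1+ρ) (x + mlTh * Complex.I)).im = - (π * mlGam ρ) := by
    have := ml_gamma_integral h1ρ
    unfold mlh
    have e : ((π:ℂ) * (1 + ρ : ℝ) * Complex.I) = ((π * (1 + ρ) : ℝ) : ℂ) * Complex.I := by
      push_cast; ring
    rw [this, e, Complex.im_ofReal_mul, Complex.exp_ofReal_mul_I_im, mlGam]
    have : π * (1 + ρ) = π * ρ + π := by ring
    rw [this, Real.sin_add_pi]
    field_simp
  have i12 : Integrable (fun x : ℝ => (lam:ℂ) * mlh 1 (x + mlTh * Complex.I) -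
      ((rexp (-ρ * log t) : ℝ) : ℂ) * mlh (1 + ρ) (x + mlTh * Complex.I)) :=
    (i1.const_mul _).sub (i2.const_mul _)
  rw [mlF, ml_repr hρ.1 hρ.2.le (by positivity)]
  simp_rw [hpt]
  rw [integral_const_mul, integral_add i12 i3,
    integral_sub (i1.const_mul _) (i2.const_mul _), integral_const_mul, integral_const_mul,
    Complex.im_ofReal_mul, Complex.add_im, Complex.sub_im, Complex.im_ofReal_mul,
    Complex.im_ofReal_mul, g1, g2]
  have e6 : t ^ (ρ - 1) * rexp (-ρ * log t) = 1 / t := by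
    rw [Real.rpow_def_of_pos ht, ← Real.exp_add]
    have : log t * (ρ - 1) + -ρ * log t = - log t := by ring
    rw [this, Real.exp_neg, Real.exp_log ht, one_div]
  calc _ = (t ^ (ρ - 1) * rexp (-ρ * log t)) * (1 / π * (1 / lam ^ 2 * (lam * 0 -
          rexp (-ρ * log t) * -(π * mlGam ρ) + (∫ x, mlN lam (log t) ρ x).im))) := by ring
    _ = _ := by rw [e6]; field_simp; ring

lemma ml_Gamma_hasDeriv {x : ℝ} (hx : 0 < x) :
    HasDerivAt Real.Gamma (deriv Complex.Gamma x).re x := by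
  have h : DifferentiableAt ℂ Complex.Gamma x := by
    apply Complex.differentiableAt_Gamma
    intro m hm
    have := congrArg Complex.re hm
    simp at this
    have : (0:ℝ) ≤ m := Nat.cast_nonneg m
    linarith
  have := h.hasDerivAt.real_of_complex
  refine this.congr_of_eventuallyEq (Eventually.of_forall fun y => ?_)
  show Real.Gamma y = (Complex.Gamma y).re
  rw [Complex.Gamma_ofReal, Complex.ofReal_re]

lemma ml_Gamma_deriv_cont : ContinuousOn (fun x : ℝ => (deriv Complex.Gamma x).re) (Ioi 0) := by
  have ho : IsOpen {z : ℂ | 0 < z.re} := isOpen_lt continuous_const Complex.continuous_re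
  have hd : DifferentiableOn ℂ Complex.Gamma {z : ℂ | 0 < z.re} := by
    intro z hz
    refine (Complex.differentiableAt_Gamma z ?_).differentiableWithinAt
    intro m hm
    have h2 := congrArg Complex.re hm
    simp at h2
    have : (0:ℝ) ≤ m := Nat.cast_nonneg m
    have hz' : 0 < z.re := hz
    linarith
  have hc := (hd.deriv ho).continuousOn
  exact Complex.continuous_re.comp_continuousOn
    (hc.comp Complex.continuous_ofReal.continuousOn (fun x hx => by simpa using hx))

noncomputable def mlGam' (ρ : ℝ) : ℝ :=
  ((deriv Complex.Gamma ((1 + ρ : ℝ) : ℂ)).re * sin (π * ρ)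
    + Real.Gamma (1 + ρ) * (cos (π * ρ) * π)) / π

lemma mlGam_deriv {ρ : ℝ} (h : 0 < ρ) : HasDerivAt mlGam (mlGam' ρ) ρ := by
  have h1 : HasDerivAt (fun r : ℝ => Real.Gamma (1 + r)) (deriv Complex.Gamma ((1 + ρ : ℝ) : ℂ)).re ρ := by
    have := (ml_Gamma_hasDeriv (x := 1 + ρ) (by linarith)).comp_const_add 1 ρ
    exact this
  have h2 : HasDerivAt (fun r : ℝ => sin (π * r)) (cos (π * ρ) * π) ρ := by
    have := ((hasDerivAt_id ρ).const_mul π).sin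
    simpa using this
  exact (h1.mul h2).div_const π

lemma mlGam'_cont : ContinuousOn mlGam' (Ioi 0) := by
  have hm : MapsTo (fun r : ℝ => 1 + r) (Ioi 0) (Ioi 0) := fun x hx => by
    simp only [mem_Ioi] at *; linarith
  have h1 : ContinuousOn (fun r : ℝ => (deriv Complex.Gamma ((1 + r : ℝ) : ℂ)).re) (Ioi 0) :=
    ml_Gamma_deriv_cont.comp (by fun_prop) hm
  have h2 : ContinuousOn (fun r : ℝ => Real.Gamma (1 + r)) (Ioi 0) := fun r hr =>
    ((ml_Gamma_hasDeriv (x := 1 + r) (hm hr)).comp_const_add 1 r).continuousAt.continuousWithinAt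
  unfold mlGam'
  refine ((h1.mul (by fun_prop)).add (h2.mul (by fun_prop))).div_const π

lemma mlGam_key {ρ₀ : ℝ} (h0 : 0 < ρ₀) (h1 : ρ₀ < 1) : ∃ A : ℝ, ∀ ρ ∈ Icc ρ₀ 1, ∀ s ≥ A,
    1 / 2 ≤ s * mlGam ρ - mlGam' ρ := by
  have hone : mlGam' 1 = -1 := by
    have : Real.Gamma (1 + 1) = 1 := by
      rw [Real.Gamma_add_one one_ne_zero]; simp
    rw [mlGam', mul_one, sin_pi, cos_pi, this]
    field_simp; ring
  have hca : ContinuousAt mlGam' 1 := mlGam'_cont.continuousAt (Ioi_mem_nhds one_pos)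
  have hev : ∀ᶠ r in 𝓝 (1:ℝ), mlGam' r < -(1/2) :=
    hca.eventually_lt_const (by rw [hone]; norm_num)
  obtain ⟨ε, hε, hb⟩ := Metric.eventually_nhds_iff.mp hev
  have hsub : Icc ρ₀ (1 - ε / 2) ⊆ Ioi (0:ℝ) := fun r hr => h0.trans_le hr.1
  obtain ⟨B, hB⟩ := isCompact_Icc.bddAbove_image (mlGam'_cont.mono hsub)
  have hgc : ContinuousOn mlGam (Icc ρ₀ (1 - ε / 2)) := fun r hr =>
    (mlGam_deriv (hsub hr)).continuousAt.continuousWithinAt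
  have hpos : ∀ r ∈ Icc ρ₀ (1 - ε / 2), 0 < mlGam r := by
    intro r hr
    have hr0 : 0 < r := hsub hr
    have : r < 1 := by linarith [hr.2]
    have : 0 < sin (π * r) := sin_pos_of_pos_of_lt_pi (by positivity) (by nlinarith [pi_pos])
    have : 0 < Real.Gamma (1 + r) := Real.Gamma_pos_of_pos (by linarith)
    unfold mlGam; positivity
  have hm : ∃ m > 0, ∀ r ∈ Icc ρ₀ (1 - ε / 2), m ≤ mlGam r := by
    rcases (Icc ρ₀ (1 - ε / 2)).eq_empty_or_nonempty with he | hne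
    · exact ⟨1, one_pos, by simp [he]⟩
    · obtain ⟨x, hx, hmin⟩ := isCompact_Icc.exists_isMinOn hne hgc
      exact ⟨mlGam x, hpos x hx, fun r hr => hmin hr⟩
  obtain ⟨m, hm0, hm⟩ := hm
  refine ⟨max 0 ((B + 1/2) / m), fun ρ hρ s hs => ?_⟩
  have hs0 : 0 ≤ s := (le_max_left _ _).trans hs
  have hs1 : (B + 1/2) / m ≤ s := (le_max_right _ _).trans hs
  rw [div_le_iff₀ hm0] at hs1
  have hρ0 : 0 < ρ := h0.trans_le hρ.1
  rcases le_or_gt ρ (1 - ε / 2) with hc | hc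
  · have hr : ρ ∈ Icc ρ₀ (1 - ε / 2) := ⟨hρ.1, hc⟩
    have := hB (mem_image_of_mem _ hr)
    have := mul_le_mul_of_nonneg_left (hm ρ hr) hs0
    linarith
  · have := hb (y := ρ) (by rw [Real.dist_eq, abs_lt]; constructor <;> linarith [hρ.2])
    have h3 : 0 ≤ mlGam ρ := by
      have : 0 ≤ sin (π * ρ) := sin_nonneg_of_nonneg_of_le_pi (by positivity) (by nlinarith [pi_pos, hρ.2])
      have : 0 < Real.Gamma (1 + ρ) := Real.Gamma_pos_of_pos (by linarith)
      unfold mlGam; positivity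
    have := mul_nonneg hs0 h3
    linarith

lemma ml_one (x : ℝ) : mittagLeffler 1 1 x = rexp x := by
  rw [mittagLeffler, Real.exp_eq_exp_ℝ, NormedSpace.exp_eq_tsum_div]
  refine tsum_congr fun k => ?_
  rw [one_mul, Real.Gamma_nat_eq_factorial]

lemma mlF_one_pos (lam t : ℝ) : 0 < mlF lam t 1 := by
  rw [mlF, ml_one, sub_self, rpow_zero, one_mul]; exact Real.exp_pos _

lemma mlF_anti {ρ₀ lam0 : ℝ} (h0 : 0 < ρ₀) (h1 : ρ₀ < 1) (hl0 : 0 < lam0) :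
    ∃ T₀ > 0, ∀ t ≥ T₀, ∀ lam ≥ lam0,
      AntitoneOn (mlF lam t) (Icc ρ₀ 1) ∧ ContinuousOn (mlF lam t) (Icc ρ₀ 1) := by
  obtain ⟨K, hK, hR⟩ := mlR_deriv
  obtain ⟨A, hA⟩ := mlGam_key h0 h1
  have hlim : Tendsto (fun s : ℝ => K * (1 + s) * rexp (-ρ₀ * s)) atTop (𝓝 0) := by
    have a1 : Tendsto (fun s : ℝ => s * rexp (-ρ₀ * s)) atTop (𝓝 0) := by
      simpa using tendsto_rpow_mul_exp_neg_mul_atTop_nhds_zero 1 ρ₀ h0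
    have a2 : Tendsto (fun s : ℝ => rexp (-ρ₀ * s)) atTop (𝓝 0) := by
      apply Real.tendsto_exp_atBot.comp
      exact tendsto_id.const_mul_atTop_of_neg (by linarith)
    have := (a2.add a1).const_mul K
    simp only [add_zero, mul_zero] at this
    refine this.congr fun s => by ring
  have hev : ∀ᶠ s : ℝ in atTop, K * (1 + s) * rexp (-ρ₀ * s) < 1 / 2 * lam0 :=
    hlim.eventually_lt_const (by positivity)
  obtain ⟨S, hS⟩ := eventually_atTop.mp (hev.and ((eventually_ge_atTop 0).and (eventually_ge_atTop A)))
  refine ⟨rexp S, Real.exp_pos S, fun t ht lam hl => ?_⟩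
  have ht0 : 0 < t := (Real.exp_pos S).trans_le ht
  have hlp : 0 < lam := hl0.trans_le hl
  obtain ⟨b1, b2, b3⟩ := hS (log t) ((Real.le_log_iff_exp_le ht0).mpr ht)
  set s := log t with hs
  have hD : ∀ ρ ∈ Icc ρ₀ 1, ∃ D ≤ 0, HasDerivAt (mlF lam t) D ρ := by
    intro ρ hρ
    have hρ0 : 0 < ρ := h0.trans_le hρ.1
    have hρm : ρ ∈ Ioo (0:ℝ) (5/4) := ⟨hρ0, by linarith [hρ.2]⟩
    obtain ⟨R', hR1, hR2⟩ := hR lam s ρ hlp b2 hρm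
    have he : HasDerivAt (fun r : ℝ => rexp (-r * s)) (rexp (-ρ * s) * (-1 * s)) ρ :=
      ((hasDerivAt_id ρ).neg.mul_const s).exp
    have hd := ((he.mul (mlGam_deriv hρ0)).add hR1).const_mul (1 / (t * lam ^ 2))
    refine ⟨_, ?_, hd.congr_of_eventuallyEq ?_⟩
    · apply mul_nonpos_of_nonneg_of_nonpos (by positivity)
      have k1 := hA ρ hρ s b3
      have k2 : K * (1 + s) * rexp (-2 * ρ * s) / lam ≤ rexp (-ρ * s) * (1/2) := by
        rw [div_le_iff₀ hlp]
        have : rexp (-2 * ρ * s) = rexp (-ρ * s) * rexp (-ρ * s) := by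
          rw [← Real.exp_add]; congr 1; ring
        have k3 : rexp (-ρ * s) ≤ rexp (-ρ₀ * s) := Real.exp_le_exp.mpr (by nlinarith [hρ.1])
        calc K * (1 + s) * rexp (-2 * ρ * s) = rexp (-ρ * s) * (K * (1 + s) * rexp (-ρ * s)) := by
              rw [this]; ring
          _ ≤ rexp (-ρ * s) * (K * (1 + s) * rexp (-ρ₀ * s)) := by gcongr
          _ ≤ rexp (-ρ * s) * (1 / 2 * lam) := by
              exact mul_le_mul_of_nonneg_left (by linarith) (Real.exp_pos _).le
          _ = _ := by ring
      have k4 := (le_abs_self R').trans (hR2.trans k2)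
      have k5 := mul_le_mul_of_nonneg_left k1 (Real.exp_pos (-ρ * s)).le
      linarith
    · filter_upwards [Ioo_mem_nhds hρm.1 hρm.2] with r hr
      exact mlF_split hlp ht0 hr
  have hcont : ContinuousOn (mlF lam t) (Icc ρ₀ 1) := fun ρ hρ => by
    obtain ⟨D, _, h⟩ := hD ρ hρ
    exact h.continuousAt.continuousWithinAt
  refine ⟨antitoneOn_of_deriv_nonpos (convex_Icc _ _) hcont ?_ ?_, hcont⟩
  · intro ρ hρ
    obtain ⟨D, _, h⟩ := hD ρ (interior_subset hρ)
    exact h.differentiableAt.differentiableWithinAt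
  · intro ρ hρ
    obtain ⟨D, h', h⟩ := hD ρ (interior_subset hρ)
    rw [h.deriv]; exact h'

lemma mlF_bound {ρ lam0 t : ℝ} (hρ : 0 < ρ) (hρ1 : ρ < 1) (hl0 : 0 < lam0) (ht : 0 < t) :
    ∃ C ≥ 0, ∀ lam ≥ lam0, mlF lam t ρ ≤ C := by
  have i1 : Integrable (fun x : ℝ => mlh 1 (x + mlTh * Complex.I)) :=
    (ml_integrable_exp one_pos).mono' (by fun_prop) (Eventually.of_forall fun x => (mlh_norm_th 1 x).le)
  have htp : 0 < t ^ ρ := rpow_pos_of_pos ht ρ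
  have htq : 0 < t ^ (ρ - 1) := rpow_pos_of_pos ht _
  have hI : 0 ≤ ∫ x : ℝ, ‖mlh 1 (x + mlTh * Complex.I)‖ := integral_nonneg fun x => norm_nonneg _
  refine ⟨t ^ (ρ - 1) * (1 / π * (2 / (lam0 * t ^ ρ) * ∫ x : ℝ, ‖mlh 1 (x + mlTh * Complex.I)‖)),
    by positivity, fun lam hl => ?_⟩
  have hlp : 0 < lam := hl0.trans_le hl
  rw [mlF, ml_repr hρ (by linarith) (by positivity)]
  gcongr
  calc _ ≤ ‖∫ x : ℝ, mlg ρ (lam * t ^ ρ) (x + mlTh * Complex.I)‖ :=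
        (le_abs_self _).trans (Complex.abs_im_le_norm _)
    _ ≤ ∫ x : ℝ, 2 / (lam * t ^ ρ) * ‖mlh 1 (x + mlTh * Complex.I)‖ :=
        norm_integral_le_of_norm_le (i1.norm.const_mul _) (Eventually.of_forall fun x =>
          mlg_norm_le hρ.le (by linarith) (abs_of_pos mlTh_pos).le (by positivity))
    _ = 2 / (lam * t ^ ρ) * ∫ x : ℝ, ‖mlh 1 (x + mlTh * Complex.I)‖ := integral_const_mul _ _
    _ ≤ _ := by gcongr

end MLHelpers

/-- For every `ρ₀ ∈ (0,1)` there is `T₀ > 0` (as in the monotonicity lemma) such that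
for every `t₀ ≥ T₀` and every `φ ∈ H`, the function
`ρ ↦ W(t₀, ρ) = Σ_k |(φ, v_k)|² (t₀^{ρ-1} E_{ρ,ρ}(-λ_k t₀^ρ))²` is continuous on
`[ρ₀, 1]`. -/
theorem statement6
    {H : Type*} [NormedAddCommGroup H] [InnerProductSpace ℝ H] [CompleteSpace H]
    (v : HilbertBasis ℕ ℝ H) (lam : ℕ → ℝ) (hlam1 : 0 < lam 0) (hmono : Monotone lam)
    (ρ₀ : ℝ) (hρ₀ : ρ₀ ∈ Set.Ioo (0 : ℝ) 1) :
    ∃ T₀ : ℝ, 0 < T₀ ∧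
      (∀ t₀ : ℝ, T₀ ≤ t₀ → ∀ φ : H,
        AntitoneOn (fun ρ : ℝ => ∑' k : ℕ,
            ⟪φ, v k⟫ ^ 2 * (t₀ ^ (ρ - 1) * mittagLeffler ρ ρ (-(lam k * t₀ ^ ρ))) ^ 2)
          (Set.Icc ρ₀ 1)) ∧
      (∀ t₀ : ℝ, T₀ ≤ t₀ → ∀ φ : H,
        ContinuousOn (fun ρ : ℝ => ∑' k : ℕ,
            ⟪φ, v k⟫ ^ 2 * (t₀ ^ (ρ - 1) * mittagLeffler ρ ρ (-(lam k * t₀ ^ ρ))) ^ 2)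
          (Set.Icc ρ₀ 1)) := by
  obtain ⟨T₀, hT, hF⟩ := mlF_anti hρ₀.1 hρ₀.2 hlam1
  have hsum : ∀ φ : H, Summable (fun k => ⟪φ, v k⟫ ^ 2) := by
    intro φ
    refine (v.orthonormal.inner_products_summable (x := φ)).congr fun k => ?_
    rw [Real.norm_eq_abs, sq_abs, real_inner_comm]
  have hl : ∀ k, lam 0 ≤ lam k := fun k => hmono (Nat.zero_le k)
  have hnn : ∀ t ≥ T₀, ∀ k, ∀ ρ ∈ Set.Icc ρ₀ 1, 0 ≤ mlF (lam k) t ρ := fun t ht k ρ hρ =>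
    (mlF_one_pos (lam k) t).le.trans
      ((hF t ht _ (hl k)).1 hρ (Set.right_mem_Icc.mpr hρ₀.2.le) hρ.2)
  have hbd : ∀ t ≥ T₀, ∃ C ≥ 0, ∀ k, ∀ ρ ∈ Set.Icc ρ₀ 1, mlF (lam k) t ρ ≤ C := by
    intro t ht
    obtain ⟨C, hC0, hC⟩ := mlF_bound hρ₀.1 hρ₀.2 hlam1 (hT.trans_le ht)
    exact ⟨C, hC0, fun k ρ hρ => ((hF t ht _ (hl k)).1 (Set.left_mem_Icc.mpr hρ₀.2.le) hρ hρ.1).trans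
      (hC _ (hl k))⟩
  have hs2 : ∀ t ≥ T₀, ∀ φ : H, ∀ ρ ∈ Set.Icc ρ₀ 1,
      Summable (fun k => ⟪φ, v k⟫ ^ 2 * (mlF (lam k) t ρ) ^ 2) := by
    intro t ht φ ρ hρ
    obtain ⟨C, hC0, hC⟩ := hbd t ht
    refine Summable.of_nonneg_of_le (fun k => by positivity) (fun k => ?_) ((hsum φ).mul_right (C ^ 2))
    have := hC k ρ hρ
    have := hnn t ht k ρ hρ
    gcongr
  refine ⟨T₀, hT, fun t ht φ => ?_, fun t ht φ => ?_⟩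
  · intro a ha b hb hab
    refine (hs2 t ht φ b hb).tsum_le_tsum (fun k => ?_) (hs2 t ht φ a ha)
    have h1 := hnn t ht k b hb
    have h2 := (hF t ht _ (hl k)).1 ha hb hab
    change ⟪φ, v k⟫ ^ 2 * (mlF (lam k) t b) ^ 2 ≤ ⟪φ, v k⟫ ^ 2 * (mlF (lam k) t a) ^ 2
    gcongr
  · obtain ⟨C, hC0, hC⟩ := hbd t ht
    refine continuousOn_tsum (u := fun k => ⟪φ, v k⟫ ^ 2 * C ^ 2)
      (fun k => continuousOn_const.mul ((hF t ht _ (hl k)).2.pow 2)) ((hsum φ).mul_right _) ?_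
    intro k ρ hρ
    have h1 := hC k ρ hρ
    have h2 := hnn t ht k ρ hρ
    change ‖⟪φ, v k⟫ ^ 2 * (mlF (lam k) t ρ) ^ 2‖ ≤ _
    rw [Real.norm_of_nonneg (by positivity)]
    gcongr
end
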